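/- Let 𝒜 be a finite alphabet of positive integers with δ_𝒜 > 1 − 5/312 (≈ 0.9839). Then a positive proportion of integers satisfy Zaremba's conjecture for 𝒜: there exists c > 0 such that #𝔇_𝒜(N) ≥ c·N for all sufficiently large N. -/

import Mathlib

open Filter

/-- Value of the finite continued fraction `[a₁,…,a_k] = 1/(a₁+1/(a₂+⋯+1/a_k))`. -/
def cfVal : List ℕ → ℚ
  | [] => 0
  | a :: l => 1 / ((a : ℚ) + cfVal l)

/-- `q ∈ 𝔯_𝒜`: `q` is a rational in `(0,1)` admitting a continued fraction expansion with
all partial quotients in the alphabet `𝒜`. -/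
def memR (A : Set ℕ) (q : ℚ) : Prop :=
  0 < q ∧ q < 1 ∧ ∃ l : List ℕ, l ≠ [] ∧ (∀ a ∈ l, a ∈ A) ∧ cfVal l = q

/-- `d ∈ 𝔇_𝒜`: `d ≥ 1` is the denominator of a reduced fraction `b/d ∈ 𝔯_𝒜`. -/
def memD (A : Set ℕ) (d : ℕ) : Prop :=
  1 ≤ d ∧ ∃ b : ℕ, Nat.Coprime b d ∧ memR A ((b : ℚ) / d)

/-- `#𝔇_𝒜(N)`, the number of `d ∈ 𝔇_𝒜` with `d ≤ N`. -/
noncomputable def Dcount (A : Set ℕ) (N : ℕ) : ℕ :=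
  Set.ncard {d : ℕ | d ≤ N ∧ memD A d}

/-- The Cantor set `𝔠_𝒜` of irrationals in `[0,1]` all of whose continued fraction partial
quotients lie in `𝒜` (equivalently, limits of the convergents `[a₁,…,a_k]` with all `a_j ∈ 𝒜`). -/
def cantorCF (A : Set ℕ) : Set ℝ :=
  {x | Irrational x ∧ 0 ≤ x ∧ x ≤ 1 ∧
    ∃ a : ℕ → ℕ, (∀ n, a n ∈ A) ∧
      Tendsto (fun k => ((cfVal (List.ofFn fun i : Fin k => a i) : ℚ) : ℝ)) atTop (nhds x)}

/-- `δ_𝒜`, the Hausdorff dimension of `𝔠_𝒜` (as a real number). -/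
noncomputable def hdim (A : Set ℕ) : ℝ := (dimH (cantorCF A)).toReal

/-- The matrix of a word. -/
def wM : List ℕ → Matrix (Fin 2) (Fin 2) ℤ
  | [] => 1
  | a :: l => !![0, 1; 1, (a : ℤ)] * wM l

def cA (l : List ℕ) : ℤ := wM l 0 0
def cB (l : List ℕ) : ℤ := wM l 0 1
def cC (l : List ℕ) : ℤ := wM l 1 0
def cD (l : List ℕ) : ℤ := wM l 1 1

/-- all letters positive -/
def Pos (l : List ℕ) : Prop := ∀ a ∈ l, 1 ≤ a

lemma cA_nil : cA [] = 1 := by simp [cA, wM]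
lemma cB_nil : cB [] = 0 := by simp [cB, wM]
lemma cC_nil : cC [] = 0 := by simp [cC, wM]
lemma cD_nil : cD [] = 1 := by simp [cD, wM]
lemma cA_cons (a : ℕ) (l : List ℕ) : cA (a :: l) = cC l := by
  simp [cA, cC, wM, Matrix.mul_apply, Fin.sum_univ_two]
lemma cB_cons (a : ℕ) (l : List ℕ) : cB (a :: l) = cD l := by
  simp [cB, cD, wM, Matrix.mul_apply, Fin.sum_univ_two]
lemma cC_cons (a : ℕ) (l : List ℕ) : cC (a :: l) = cA l + a * cC l := by
  simp [cA, cC, wM, Matrix.mul_apply, Fin.sum_univ_two]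
lemma cD_cons (a : ℕ) (l : List ℕ) : cD (a :: l) = cB l + a * cD l := by
  simp [cB, cD, wM, Matrix.mul_apply, Fin.sum_univ_two]

lemma wM_append (l s : List ℕ) : wM (l ++ s) = wM l * wM s := by
  induction l with
  | nil => simp [wM]
  | cons a l ih => simp only [List.cons_append, wM, ih, Matrix.mul_assoc]

lemma cA_append (l s : List ℕ) : cA (l ++ s) = cA l * cA s + cB l * cC s := by
  simp [cA, cB, cC, wM_append, Matrix.mul_apply, Fin.sum_univ_two]
lemma cB_append (l s : List ℕ) : cB (l ++ s) = cA l * cB s + cB l * cD s := by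
  simp [cA, cB, cD, wM_append, Matrix.mul_apply, Fin.sum_univ_two]
lemma cC_append (l s : List ℕ) : cC (l ++ s) = cC l * cA s + cD l * cC s := by
  simp [cA, cD, cC, wM_append, Matrix.mul_apply, Fin.sum_univ_two]
lemma cD_append (l s : List ℕ) : cD (l ++ s) = cC l * cB s + cD l * cD s := by
  simp [cD, cB, cC, wM_append, Matrix.mul_apply, Fin.sum_univ_two]

lemma wdet (l : List ℕ) : cA l * cD l - cB l * cC l = (-1) ^ l.length := by
  induction l with
  | nil => simp [cA_nil, cB_nil, cC_nil, cD_nil]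
  | cons a l ih =>
    rw [cA_cons, cB_cons, cC_cons, cD_cons, List.length_cons, pow_succ, ← ih]; ring

lemma wT (l : List ℕ) : wM l.reverse = (wM l).transpose := by
  induction l with
  | nil => simp [wM]
  | cons a l ih =>
    rw [List.reverse_cons, wM_append, ih]
    simp only [wM, Matrix.transpose_mul, mul_one]
    congr 1
    ext i j; fin_cases i <;> fin_cases j <;> simp

lemma cB_reverse (l : List ℕ) : cB l.reverse = cC l := by simp [cB, cC, wT]
lemma cD_reverse (l : List ℕ) : cD l.reverse = cD l := by simp [cD, wT]

lemma Pos.cons {a : ℕ} {l : List ℕ} (h : Pos (a :: l)) : 1 ≤ a ∧ Pos l :=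
  ⟨h a (by simp), fun b hb => h b (by simp [hb])⟩

lemma Pos.append {l s : List ℕ} (h : Pos l) (h' : Pos s) : Pos (l ++ s) := by
  intro a ha
  rcases List.mem_append.1 ha with h1 | h1
  · exact h a h1
  · exact h' a h1

lemma wpos (l : List ℕ) (h : Pos l) : 0 ≤ cA l ∧ 0 ≤ cB l ∧ 0 ≤ cC l ∧ 1 ≤ cD l ∧
    cB l ≤ cD l ∧ cC l ≤ cD l ∧ cA l + cC l ≤ cB l + cD l ∧ cA l ≤ cD l := by
  induction l with
  | nil => simp [cA_nil, cB_nil, cC_nil, cD_nil]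
  | cons a l ih =>
    obtain ⟨ha, hl⟩ := h.cons
    obtain ⟨h1, h2, h3, h4, h5, h6, h7, h8⟩ := ih hl
    rw [cA_cons, cB_cons, cC_cons, cD_cons]
    have ha' : (1 : ℤ) ≤ a := by exact_mod_cast ha
    refine ⟨h3, by linarith, by positivity, by nlinarith, by nlinarith, by nlinarith, by nlinarith,
      by nlinarith⟩

lemma cC_pos (l : List ℕ) (h : Pos l) (hl : l ≠ []) : 1 ≤ cC l := by
  induction l with
  | nil => simp at hl
  | cons a l ih =>
    obtain ⟨ha, hp⟩ := h.cons
    have ha' : (1 : ℤ) ≤ a := by exact_mod_cast ha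
    rw [cC_cons]
    have := wpos l hp
    by_cases h0 : l = []
    · subst h0; simp [cA_nil, cC_nil]
    · nlinarith [ih hp h0]

lemma cB_pos (l : List ℕ) (h : Pos l) (hl : l ≠ []) : 1 ≤ cB l := by
  cases l with
  | nil => simp at hl
  | cons a l => rw [cB_cons]; exact (wpos l h.cons.2).2.2.2.1

lemma cA_pos (l : List ℕ) (h : Pos l) (hl : 2 ≤ l.length) : 1 ≤ cA l := by
  cases l with
  | nil => simp at hl
  | cons a l =>
    rw [cA_cons]; exact cC_pos l h.cons.2 (by rintro rfl; simp at hl)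

lemma inj_W (l : List ℕ) : ∀ s : List ℕ, Pos l → Pos s → l.length = s.length →
    cB l = cB s → cD l = cD s → l = s := by
  induction l with
  | nil =>
    intro s _ _ hlen _ _
    exact (List.length_eq_zero_iff.1 hlen.symm).symm
  | cons a l ih =>
    intro s hl hs hlen hB hD
    cases s with
    | nil => simp at hlen
    | cons b s =>
      have hlen' : l.length = s.length := by simpa using hlen
      rw [cB_cons, cB_cons] at hB
      rw [cD_cons, cD_cons, hB] at hD
      have hab : (a : ℤ) = b ∧ cB l = cB s := by
        have hD1 := (wpos s hs.cons.2).2.2.2.1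
        by_cases h0 : l = []
        · have h0' : s = [] := by
            subst h0; exact List.length_eq_zero_iff.1 (by simpa using hlen'.symm)
          subst h0; subst h0'
          simp [cB_nil, cD_nil] at hD ⊢
          exact hD
        · have h0' : s ≠ [] := by
            rintro rfl; exact h0 (List.length_eq_zero_iff.1 (by simpa using hlen'))
          have e1 := cB_pos l hl.cons.2 h0
          have e2 := cB_pos s hs.cons.2 h0'
          have e3 := (wpos l hl.cons.2).2.2.2.2.1
          have e4 := (wpos s hs.cons.2).2.2.2.2.1
          have : (a : ℤ) = b := by
            rcases lt_trichotomy (a : ℤ) b with h | h | h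
            · nlinarith
            · exact h
            · nlinarith
          refine ⟨this, ?_⟩
          rw [this] at hD; linarith
      have := ih s hl.cons.2 hs.cons.2 hlen' hab.2 hB
      rw [this, show a = b by exact_mod_cast hab.1]

lemma Pos.reverse {l : List ℕ} (h : Pos l) : Pos l.reverse := fun a ha => h a (by simpa using ha)

lemma inj_U (l s : List ℕ) (hl : Pos l) (hs : Pos s) (hlen : l.length = s.length)
    (hC : cC l = cC s) (hD : cD l = cD s) : l = s := by
  have := inj_W l.reverse s.reverse hl.reverse hs.reverse (by simpa using hlen)
    (by rw [cB_reverse, cB_reverse, hC]) (by rw [cD_reverse, cD_reverse, hD])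
  exact List.reverse_injective this

lemma cD_mul_le (l s : List ℕ) (hl : Pos l) (hs : Pos s) :
    cD l * cD s ≤ cD (l ++ s) ∧ cD (l ++ s) ≤ 2 * (cD l * cD s) := by
  rw [cD_append]
  have h1 := wpos l hl
  have h2 := wpos s hs
  have h3 : cC l * cB s ≤ cD l * cD s :=
    mul_le_mul h1.2.2.2.2.2.1 h2.2.2.2.2.1 h2.2.1 (by linarith)
  have h4 : 0 ≤ cC l * cB s := mul_nonneg h1.2.2.1 h2.2.1
  constructor <;> linarith

lemma cD_len (n : ℕ) : ∀ l : List ℕ, Pos l → l.length = n → 2 ^ (n / 2) ≤ cD l := by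
  induction n using Nat.strong_induction_on with
  | _ n ih =>
    intro l hl hn
    match l, hl, hn with
    | [], _, hn => subst hn; simp [cD_nil]
    | [a], hl, hn => subst hn; simpa using (wpos _ hl).2.2.2.1
    | a :: b :: l, hl, hn =>
      subst hn
      have h1 := ih l.length (by simp) l hl.cons.2.cons.2 rfl
      have ha : (1 : ℤ) ≤ a := by exact_mod_cast hl.cons.1
      have hb : (1 : ℤ) ≤ b := by exact_mod_cast hl.cons.2.cons.1
      rw [cD_cons, cB_cons, cD_cons]
      have h2 := wpos l hl.cons.2.cons.2
      have : (a :: b :: l).length / 2 = l.length / 2 + 1 := by simp; omega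
      rw [this, pow_succ]
      have h3 : cD l ≤ b * cD l := by nlinarith
      have h4 : cB l + b * cD l ≤ a * (cB l + b * cD l) := by nlinarith
      nlinarith

lemma cfVal_eq (l : List ℕ) (h : Pos l) : cfVal l = (cB l : ℚ) / cD l := by
  induction l with
  | nil => simp [cfVal, cB_nil]
  | cons a l ih =>
    rw [cfVal, ih h.cons.2, cB_cons, cD_cons]
    have h1 := wpos l h.cons.2
    have h2 : (cD l : ℚ) ≠ 0 := by
      have : (1 : ℚ) ≤ cD l := by exact_mod_cast h1.2.2.2.1
      positivity
    push_cast
    field_simp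
    ring

lemma cop_BD (l : List ℕ) : IsCoprime (cB l) (cD l) := by
  have h := wdet l
  rcases neg_one_pow_eq_or ℤ l.length with h1 | h1 <;> rw [h1] at h
  · exact ⟨-cC l, cA l, by linarith⟩
  · exact ⟨cC l, -cA l, by linarith⟩

lemma cop_CD (l : List ℕ) : IsCoprime (cC l) (cD l) := by
  have h := wdet l
  rcases neg_one_pow_eq_or ℤ l.length with h1 | h1 <;> rw [h1] at h
  · exact ⟨-cB l, cA l, by linarith⟩
  · exact ⟨cB l, -cA l, by linarith⟩

lemma memD_word (A : Set ℕ) (hA : ∀ a ∈ A, 0 < a) (l : List ℕ) (hl : ∀ a ∈ l, a ∈ A)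
    (h2 : 2 ≤ l.length) : memD A (cD l).toNat := by
  have hp : Pos l := fun a ha => hA a (hl a ha)
  have h1 := wpos l hp
  have hne : l ≠ [] := by rintro rfl; simp at h2
  have hB := cB_pos l hp hne
  have hlt : cB l < cD l := by
    match l, h2 with
    | a :: s, h2 =>
      rw [cB_cons, cD_cons]
      have h3 := cB_pos s hp.cons.2 (by rintro rfl; simp at h2)
      have ha : (1 : ℤ) ≤ a := by exact_mod_cast hp.cons.1
      have h4 := wpos s hp.cons.2
      nlinarith
  obtain ⟨b, hb⟩ := Int.eq_ofNat_of_zero_le h1.2.1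
  obtain ⟨d, hd⟩ := Int.eq_ofNat_of_zero_le (by linarith : (0 : ℤ) ≤ cD l)
  have hcop := cop_BD l
  rw [hb, hd] at hcop hlt
  rw [hb] at hB
  rw [hd]
  refine ⟨by simp; omega, b, ?_, ?_⟩
  · simpa using Nat.isCoprime_iff_coprime.1 hcop
  · have hb0 : 0 < (b : ℚ) := by exact_mod_cast (by omega : 0 < b)
    have hd0 : (b : ℚ) < d := by exact_mod_cast hlt
    refine ⟨?_, ?_, l, hne, hl, ?_⟩
    · simp only [Int.toNat_natCast]; exact div_pos hb0 (hb0.trans hd0)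
    · simp only [Int.toNat_natCast]; rw [div_lt_one (hb0.trans hd0)]; exact hd0
    · rw [cfVal_eq l hp, hb, hd]; simp

lemma pow_two_bd (k : ℕ) : ∃ c : ℕ, 1 ≤ c ∧ ∀ v : ℕ, (v + 1) ^ k ≤ c * 2 ^ v := by
  have h := tendsto_pow_const_div_const_pow_of_one_lt k (r := (2 : ℝ)) (by norm_num)
  obtain ⟨M, hM⟩ := h.bddAbove_range
  obtain ⟨c, hc⟩ := exists_nat_gt (max 1 (2 * M))
  have hc1 : (1 : ℝ) < c := lt_of_le_of_lt (le_max_left _ _) hc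
  refine ⟨c, by exact_mod_cast hc1.le, fun v => ?_⟩
  have h1 : ((v + 1 : ℕ) : ℝ) ^ k / 2 ^ (v + 1) ≤ M := hM ⟨v + 1, rfl⟩
  rw [div_le_iff₀ (by positivity)] at h1
  have h2 : 2 * M ≤ c := (lt_of_le_of_lt (le_max_right _ _) hc).le
  have h3 : ((v + 1 : ℕ) : ℝ) ^ k ≤ c * 2 ^ v := by
    calc _ ≤ M * 2 ^ (v + 1) := h1
      _ = 2 * M * 2 ^ v := by ring
      _ ≤ _ := by gcongr
  exact_mod_cast h3

lemma tau_bd (k : ℕ) : ∃ C : ℕ, 1 ≤ C ∧ ∀ n : ℕ, n ≠ 0 → n.divisors.card ^ k ≤ C * n := by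
  obtain ⟨c, hc1, hc⟩ := pow_two_bd k
  refine ⟨c ^ (2 ^ k), Nat.one_le_pow _ _ hc1, fun n hn => ?_⟩
  rw [Nat.card_divisors hn, ← Finset.prod_pow]
  have h1 : ∀ p ∈ n.primeFactors, (n.factorization p + 1) ^ k ≤
      (if p < 2 ^ k then c else 1) * p ^ n.factorization p := by
    intro p hp
    have hp2 : 2 ≤ p := (Nat.prime_of_mem_primeFactors hp).two_le
    split_ifs with h
    · exact (hc _).trans (Nat.mul_le_mul_left _ (Nat.pow_le_pow_left hp2 _))
    · rw [one_mul]
      push Not at h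
      calc (n.factorization p + 1) ^ k ≤ (2 ^ n.factorization p) ^ k :=
            Nat.pow_le_pow_left (Nat.lt_two_pow_self) _
        _ = (2 ^ k) ^ n.factorization p := by rw [← pow_mul, ← pow_mul, mul_comm]
        _ ≤ _ := Nat.pow_le_pow_left h _
  refine (Finset.prod_le_prod' h1).trans ?_
  rw [Finset.prod_mul_distrib]
  have h2 : ∏ p ∈ n.primeFactors, p ^ n.factorization p = n := Nat.prod_factorization_pow_eq_self hn
  rw [h2]
  refine Nat.mul_le_mul_right _ ?_
  rw [← Finset.prod_filter, Finset.prod_const]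
  refine Nat.pow_le_pow_right hc1 ?_
  calc _ ≤ (Finset.range (2 ^ k)).card := Finset.card_le_card (by intro p; simp)
    _ = _ := by simp

/-- integer divisors of a nonzero integer -/
def zdiv (z : ℤ) : Finset ℤ := (z.natAbs.divisors.image (fun d : ℕ => (d : ℤ))) ∪
  (z.natAbs.divisors.image (fun d : ℕ => -(d : ℤ)))

lemma mem_zdiv {z x : ℤ} (hz : z ≠ 0) (h : x ∣ z) : x ∈ zdiv z := by
  unfold zdiv
  have h1 : x.natAbs ∈ z.natAbs.divisors := by
    simp [hz, Int.natAbs_dvd_natAbs, h]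
  rcases Int.natAbs_eq x with h2 | h2
  · exact Finset.mem_union_left _ (Finset.mem_image.2 ⟨_, h1, h2.symm⟩)
  · exact Finset.mem_union_right _ (Finset.mem_image.2 ⟨_, h1, h2.symm⟩)

lemma card_zdiv (z : ℤ) : (zdiv z).card ≤ 2 * z.natAbs.divisors.card := by
  unfold zdiv
  refine (Finset.card_union_le _ _).trans ?_
  have := Finset.card_image_le (s := z.natAbs.divisors) (f := fun d : ℕ => (d : ℤ))
  have := Finset.card_image_le (s := z.natAbs.divisors) (f := fun d : ℕ => -(d : ℤ))
  omega

lemma inj3 {a b c d a' b' d' α γ ε : ℤ} (hε : ε * ε = 1) (hb : 1 ≤ b) (hd : 1 ≤ d)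
    (hb' : 1 ≤ b') (hd' : 1 ≤ d') (h : a * d - b * c = ε) (h' : a' * d' - b' * c = ε)
    (h1 : α * b + γ * d = 0) (h1' : α * b' + γ * d' = 0) (h0 : α ≠ 0 ∨ γ ≠ 0) :
    a = a' ∧ b = b' ∧ d = d' := by
  have hx : b * d' = b' * d := by
    rcases h0 with h0 | h0
    · apply mul_left_cancel₀ h0
      linear_combination d' * h1 - d * h1'
    · apply mul_left_cancel₀ h0
      linear_combination b * h1' - b' * h1
  have co : IsCoprime b d := ⟨-c * ε, a * ε, by linear_combination ε * h + hε⟩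
  have co' : IsCoprime b' d' := ⟨-c * ε, a' * ε, by linear_combination ε * h' + hε⟩
  have e1 : b ∣ b' := co.dvd_of_dvd_mul_right (Dvd.intro _ hx)
  have e2 : b' ∣ b := co'.dvd_of_dvd_mul_right (Dvd.intro _ hx.symm)
  have hbb : b = b' := Int.dvd_antisymm (by omega) (by omega) e1 e2
  subst hbb
  have hdd : d' = d := mul_left_cancel₀ (by omega) hx
  subst hdd
  refine ⟨?_, rfl, rfl⟩
  have : a * d' = a' * d' := by linarith
  exact mul_right_cancel₀ (by omega) this

lemma ext4 {g g' : Fin 4 → ℤ} (h0 : g 0 = g' 0) (h1 : g 1 = g' 1) (h2 : g 2 = g' 2)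
    (h3 : g 3 = g' 3) : g = g' := by
  funext i; fin_cases i <;> assumption

def Quad (X : ℕ) (ε : ℤ) (g : Fin 4 → ℤ) : Prop :=
  (∀ i, 1 ≤ g i ∧ g i ≤ X) ∧ g 0 * g 3 - g 1 * g 2 = ε

lemma card_proj (X : ℕ) (G : Finset (Fin 4 → ℤ)) (i : Fin 4) (hG : ∀ g ∈ G, 1 ≤ g i ∧ g i ≤ X)
    (hi : ∀ g ∈ G, ∀ g' ∈ G, g i = g' i → g = g') : G.card ≤ X := by
  have : G.card ≤ (Finset.Icc (1 : ℤ) X).card := by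
    refine Finset.card_le_card_of_injOn (fun g => g i) ?_ ?_
    · intro g hg; simpa using hG g hg
    · intro g hg g' hg' h; exact hi g hg g' hg' h
  simpa using this

lemma card_sig (X τ : ℕ) (G : Finset (Fin 4 → ℤ)) (i : Fin 4) (f : (Fin 4 → ℤ) → ℤ) (R : ℤ → ℤ)
    (hG : ∀ g ∈ G, 1 ≤ g i ∧ g i ≤ X)
    (hR : ∀ g ∈ G, R (g i) ≠ 0 ∧ f g ∣ R (g i))
    (hτ : ∀ x : ℤ, 1 ≤ x → x ≤ X → R x ≠ 0 → (zdiv (R x)).card ≤ τ)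
    (hi : ∀ g ∈ G, ∀ g' ∈ G, g i = g' i → f g = f g' → g = g') : G.card ≤ X * τ := by
  classical
  have h1 : G.card ≤ (((Finset.Icc (1 : ℤ) X).filter (fun x => R x ≠ 0)).sigma
      (fun x => zdiv (R x))).card := by
    refine Finset.card_le_card_of_injOn (fun g => ⟨g i, f g⟩) ?_ ?_
    · intro g hg
      have := hG g hg
      have h2 := hR g hg
      simp only [Finset.coe_sigma, Set.mem_sigma_iff, Finset.mem_coe, Finset.mem_filter,
        Finset.mem_Icc]
      exact ⟨⟨this, h2.1⟩, mem_zdiv h2.1 h2.2⟩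
    · intro g hg g' hg' h
      simp only [Sigma.mk.injEq, heq_eq_eq] at h
      exact hi g hg g' hg' h.1 h.2
  refine h1.trans ?_
  rw [Finset.card_sigma]
  calc _ ≤ ∑ x ∈ (Finset.Icc (1 : ℤ) X).filter (fun x => R x ≠ 0), τ := by
        apply Finset.sum_le_sum
        intro x hx
        simp only [Finset.mem_filter, Finset.mem_Icc] at hx
        exact hτ x hx.1.1 hx.1.2 hx.2
    _ ≤ ∑ x ∈ (Finset.Icc (1 : ℤ) X), τ :=
        Finset.sum_le_sum_of_subset (Finset.filter_subset _ _)
    _ = _ := by simp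

lemma hyp_count (X K τ : ℕ) (ε : ℤ) (hε : ε * ε = 1) (G : Finset (Fin 4 → ℤ))
    (hG : ∀ g ∈ G, Quad X ε g) (T : Fin 4 → ℤ) (hT : T ≠ 0) (hTK : ∀ i, |T i| ≤ K)
    (hTG : ∀ g ∈ G, ∑ i, T i * g i = 0)
    (hτ : ∀ z : ℤ, z ≠ 0 → |z| ≤ 3 * K ^ 2 * X ^ 2 → (zdiv z).card ≤ τ) :
    G.card ≤ X * (τ + 2) := by
  classical
  have hrel : ∀ g ∈ G, T 0 * g 0 + T 1 * g 1 + T 2 * g 2 + T 3 * g 3 = 0 := by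
    intro g hg; have := hTG g hg; rwa [Fin.sum_univ_four] at this
  have hK := hTK
  simp only [abs_le] at hK
  have hε1 : ε = 1 ∨ ε = -1 := by
    rw [mul_self_eq_one_iff] at hε; exact hε
  have hεa : |ε| = 1 := by rcases hε1 with h | h <;> simp [h]
  by_cases h0 : T 0 = 0
  · by_cases h2 : T 2 = 0
    · -- only β δ
      have h13 : T 1 ≠ 0 ∨ T 3 ≠ 0 := by
        by_contra hcon
        push Not at hcon
        exact hT (ext4 h0 hcon.1 h2 hcon.2)
      have : G.card ≤ X := by
        refine card_proj X G 2 (fun g hg => (hG g hg).1 2) ?_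
        intro g hg g' hg' h
        have q := hG g hg
        have q' := hG g' hg'
        have r := hrel g hg
        have r' := hrel g' hg'
        simp only [h0, h2, zero_mul, zero_add, add_zero] at r r'
        have := inj3 (c := g 2) hε (q.1 1).1 (q.1 3).1 (q'.1 1).1 (q'.1 3).1 q.2 (by rw [h]; exact q'.2)
          r r' h13
        exact ext4 this.1 this.2.1 h this.2.2
      nlinarith
    · -- α = 0, γ ≠ 0
      have key : ∀ g ∈ G, g 3 * (T 2 * g 0 + T 3 * g 1) = T 2 * ε - T 1 * g 1 ^ 2 := by
        intro g hg
        have r := hrel g hg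
        have q := (hG g hg).2
        rw [h0] at r
        linear_combination (-g 1) * r * (-1) + T 2 * q
      set G1 := G.filter (fun g => T 2 * g 0 + T 3 * g 1 ≠ 0)
      set G2 := G.filter (fun g => ¬ (T 2 * g 0 + T 3 * g 1 ≠ 0))
      have hc : G1.card + G2.card = G.card := Finset.card_filter_add_card_filter_not _
      have c2 : G2.card ≤ X := by
        refine card_proj X G2 2 (fun g hg => (hG g (Finset.mem_filter.1 hg).1).1 2) ?_
        intro g hg g' hg' h
        obtain ⟨hg, e⟩ := Finset.mem_filter.1 hg
        obtain ⟨hg', e'⟩ := Finset.mem_filter.1 hg'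
        push Not at e e'
        have q := hG g hg
        have q' := hG g' hg'
        have := inj3 (a := g 3) (b := g 1) (c := g 2) (d := g 0) (a' := g' 3) (b' := g' 1)
          (d' := g' 0) (α := T 3) (γ := T 2) hε (q.1 1).1 (q.1 0).1 (q'.1 1).1 (q'.1 0).1
          (by linarith [q.2, mul_comm (g 3) (g 0)]) (by rw [h]; linarith [q'.2, mul_comm (g' 3) (g' 0)])
          (by linarith) (by linarith) (Or.inr h2)
        exact ext4 this.2.2 this.2.1 h this.1
      have c1 : G1.card ≤ X * τ := by
        refine card_sig X τ G1 1 (fun g => g 3) (fun b => T 2 * ε - T 1 * b ^ 2)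
          (fun g hg => (hG g (Finset.mem_filter.1 hg).1).1 1) ?_ ?_ ?_
        · intro g hg
          obtain ⟨hg, e⟩ := Finset.mem_filter.1 hg
          have k := key g hg
          refine ⟨?_, Dvd.intro _ k⟩
          rw [← k]
          exact mul_ne_zero (by have := ((hG g hg).1 3).1; omega) e
        · intro x hx1 hx2 hx
          apply hτ _ hx
          have hX : (1 : ℤ) ≤ X := by omega
          have hK1 : (1 : ℤ) ≤ K := le_trans (Int.one_le_abs h2) (hTK 2)
          calc |T 2 * ε - T 1 * x ^ 2| ≤ |T 2 * ε| + |T 1 * x ^ 2| := abs_sub _ _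
            _ = |T 2| + |T 1| * x ^ 2 := by rw [abs_mul, abs_mul, hεa, abs_of_nonneg (sq_nonneg x)]; ring
            _ ≤ K + K * X ^ 2 := by gcongr <;> first | exact hTK _ | omega
            _ ≤ K ^ 2 * X ^ 2 + K ^ 2 * X ^ 2 := by
              have a1 : (K : ℤ) ≤ K ^ 2 := by nlinarith
              have a2 : (1 : ℤ) ≤ X ^ 2 := by nlinarith
              have a3 : (K : ℤ) ^ 2 ≤ K ^ 2 * X ^ 2 := by nlinarith
              have a4 : (K : ℤ) * X ^ 2 ≤ K ^ 2 * X ^ 2 := by gcongr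
              linarith
            _ ≤ _ := by nlinarith [sq_nonneg ((K : ℤ) * X)]
        · intro g hg g' hg' hb hd
          obtain ⟨hg, e⟩ := Finset.mem_filter.1 hg
          obtain ⟨hg', e'⟩ := Finset.mem_filter.1 hg'
          have k := key g hg
          have k' := key g' hg'
          have r := hrel g hg
          have r' := hrel g' hg'
          rw [h0] at r r'
          have hd0 : g 3 ≠ 0 := by have := ((hG g hg).1 3).1; omega
          have ea : g 0 = g' 0 := by
            apply mul_left_cancel₀ h2
            apply mul_left_cancel₀ hd0
            rw [← hb, ← hd] at k'
            linear_combination k - k'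
          have ec : g 2 = g' 2 := by
            apply mul_left_cancel₀ h2
            rw [← hb, ← hd] at r'
            linear_combination r - r'
          exact ext4 ea hb ec hd
      nlinarith
  · have key : ∀ g ∈ G, (T 0 * g 1 + T 2 * g 3) * (T 0 * g 2 + T 1 * g 3) =
        T 2 * T 1 * g 3 ^ 2 - T 0 * T 3 * g 3 ^ 2 - T 0 ^ 2 * ε := by
      intro g hg
      have r := hrel g hg
      have q := (hG g hg).2
      linear_combination (T 0 * g 3) * r - T 0 ^ 2 * q
    set G1 := G.filter (fun g => T 0 * g 1 + T 2 * g 3 ≠ 0)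
    set G2 := G.filter (fun g => ¬ (T 0 * g 1 + T 2 * g 3 ≠ 0))
    have hc : G1.card + G2.card = G.card := Finset.card_filter_add_card_filter_not _
    set G3 := G1.filter (fun g => T 0 * g 2 + T 1 * g 3 ≠ 0)
    set G4 := G1.filter (fun g => ¬ (T 0 * g 2 + T 1 * g 3 ≠ 0))
    have hc' : G3.card + G4.card = G1.card := Finset.card_filter_add_card_filter_not _
    have c2 : G2.card ≤ X := by
      refine card_proj X G2 2 (fun g hg => (hG g (Finset.mem_filter.1 hg).1).1 2) ?_
      intro g hg g' hg' h
      obtain ⟨hg, e⟩ := Finset.mem_filter.1 hg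
      obtain ⟨hg', e'⟩ := Finset.mem_filter.1 hg'
      push Not at e e'
      have q := hG g hg
      have q' := hG g' hg'
      have := inj3 (c := g 2) hε (q.1 1).1 (q.1 3).1 (q'.1 1).1 (q'.1 3).1 q.2 (by rw [h]; exact q'.2)
          e e' (Or.inl h0)
      exact ext4 this.1 this.2.1 h this.2.2
    have c4 : G4.card ≤ X := by
      refine card_proj X G4 1 (fun g hg => (hG g (Finset.mem_filter.1 (Finset.mem_filter.1 hg).1).1).1 1) ?_
      intro g hg g' hg' h
      obtain ⟨hg, e⟩ := Finset.mem_filter.1 hg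
      obtain ⟨hg', e'⟩ := Finset.mem_filter.1 hg'
      replace hg := (Finset.mem_filter.1 hg).1
      replace hg' := (Finset.mem_filter.1 hg').1
      push Not at e e'
      have q := hG g hg
      have q' := hG g' hg'
      have := inj3 (a := g 0) (b := g 2) (c := g 1) (d := g 3) (a' := g' 0) (b' := g' 2)
          (d' := g' 3) hε (q.1 2).1 (q.1 3).1 (q'.1 2).1 (q'.1 3).1
          (by linarith [q.2, mul_comm (g 1) (g 2)]) (by rw [h]; linarith [q'.2, mul_comm (g' 1) (g' 2)])
          e e' (Or.inl h0)
      exact ext4 this.1 h this.2.1 this.2.2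
    have c3 : G3.card ≤ X * τ := by
      have mem : ∀ g ∈ G3, g ∈ G ∧ T 0 * g 1 + T 2 * g 3 ≠ 0 ∧ T 0 * g 2 + T 1 * g 3 ≠ 0 := by
        intro g hg
        obtain ⟨hg, e⟩ := Finset.mem_filter.1 hg
        obtain ⟨hg, f⟩ := Finset.mem_filter.1 hg
        exact ⟨hg, f, e⟩
      refine card_sig X τ G3 3 (fun g => T 0 * g 1 + T 2 * g 3)
          (fun d => T 2 * T 1 * d ^ 2 - T 0 * T 3 * d ^ 2 - T 0 ^ 2 * ε)
          (fun g hg => (hG g (mem g hg).1).1 3) ?_ ?_ ?_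
      · intro g hg
        obtain ⟨hg, e, f⟩ := mem g hg
        have k := key g hg
        refine ⟨?_, Dvd.intro _ k⟩
        rw [← k]
        exact mul_ne_zero e f
      · intro x hx1 hx2 hx
        apply hτ _ hx
        have hX : (1 : ℤ) ≤ X := by omega
        calc |T 2 * T 1 * x ^ 2 - T 0 * T 3 * x ^ 2 - T 0 ^ 2 * ε|
            ≤ |T 2 * T 1 * x ^ 2| + |T 0 * T 3 * x ^ 2| + |T 0 ^ 2 * ε| :=
              (abs_sub _ _).trans (by gcongr; exact abs_sub _ _)
          _ = |T 2| * |T 1| * x ^ 2 + |T 0| * |T 3| * x ^ 2 + |T 0| * |T 0| := by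
              simp only [abs_mul, hεa, abs_pow]; rw [abs_of_nonneg (by omega : 0 ≤ x)]; ring
          _ ≤ K * K * X ^ 2 + K * K * X ^ 2 + K * K := by
              gcongr <;> first | exact hTK _ | omega
          _ ≤ _ := by nlinarith [sq_nonneg (K : ℤ), mul_nonneg (sq_nonneg (K : ℤ)) (sub_nonneg.2 hX)]
      · intro g hg g' hg' hd hf
        obtain ⟨hg, e, f⟩ := mem g hg
        obtain ⟨hg', e', f'⟩ := mem g' hg'
        have k := key g hg
        have k' := key g' hg'
        have r := hrel g hg
        have r' := hrel g' hg'
        have eb : g 1 = g' 1 := by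
          apply mul_left_cancel₀ h0
          rw [← hd] at hf
          linarith
        have ec : g 2 = g' 2 := by
          apply mul_left_cancel₀ h0
          apply mul_left_cancel₀ e
          rw [← hd, ← eb] at k'
          linear_combination k - k'
        have ea : g 0 = g' 0 := by
          apply mul_left_cancel₀ h0
          rw [← hd, ← eb, ← ec] at r'
          linear_combination r - r'
        exact ext4 ea eb ec hd
    nlinarith

lemma det_zero (A : Matrix (Fin 4) (Fin 4) ℤ) (X : ℤ) (hX : 0 ≤ X) (hA : ∀ i j, |A i j| ≤ X)
    (κ : Fin 4 → ℤ) (c : Fin 4 → ℤ) (hc : ∑ i, c i * κ i = 1) (q : ℤ) (hq1 : 1 ≤ q)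
    (hq : ∀ i, q ∣ (A.mulVec κ) i) (r B : ℤ) (hr : ∀ i, |r| * |(A.mulVec κ) i| ≤ q * B)
    (h : 24 * X ^ 4 < q ∨ 24 * X ^ 3 * B < |r| * |κ 1|) : A.det = 0 := by
  by_contra hD
  have hadj : ∀ i j, |A.adjugate i j| ≤ 6 * X ^ 3 := by
    intro i j
    rw [Matrix.adjugate_fin_succ_eq_det_submatrix, abs_mul, abs_pow, abs_neg, abs_one, one_pow, one_mul]
    have := Matrix.det_le (A := A.submatrix j.succAbove i.succAbove) (abv := AbsoluteValue.abs)
      (x := X) (fun a b => hA _ _)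
    simpa [Nat.factorial] using this
  have hdet : |A.det| ≤ 24 * X ^ 4 := by
    have := Matrix.det_le (A := A) (abv := AbsoluteValue.abs) (x := X) (fun a b => hA _ _)
    simpa [Nat.factorial] using this
  have hrel : ∀ j, A.det * κ j = ∑ i, A.adjugate j i * (A.mulVec κ) i := by
    intro j
    have : (A.adjugate.mulVec (A.mulVec κ)) j = (A.det • κ) j := by
      rw [Matrix.mulVec_mulVec, Matrix.adjugate_mul, Matrix.smul_mulVec, Matrix.one_mulVec]
    rw [Pi.smul_apply, smul_eq_mul] at this
    rw [← this]; rfl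
  have hqd : q ∣ A.det := by
    have h1 : A.det = ∑ j, c j * (A.det * κ j) := by
      calc A.det = A.det * ∑ i, c i * κ i := by rw [hc, mul_one]
        _ = _ := by rw [Finset.mul_sum]; exact Finset.sum_congr rfl fun _ _ => by ring
    rw [h1]
    refine Finset.dvd_sum fun j _ => Dvd.dvd.mul_left ?_ _
    rw [hrel]
    exact Finset.dvd_sum fun i _ => Dvd.dvd.mul_left (hq i) _
  have hqD : q ≤ |A.det| := Int.le_of_dvd (abs_pos.2 hD) ((dvd_abs _ _).2 hqd)
  rcases h with h | h
  · linarith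
  · have h1 : |r| * (|A.det| * |κ 1|) ≤ 24 * X ^ 3 * (q * B) := by
      rw [← abs_mul A.det, hrel]
      calc |r| * |∑ i, A.adjugate 1 i * (A.mulVec κ) i|
          ≤ |r| * ∑ i, |A.adjugate 1 i * (A.mulVec κ) i| := by
            gcongr; exact Finset.abs_sum_le_sum_abs _ _
        _ = ∑ i, |A.adjugate 1 i| * (|r| * |(A.mulVec κ) i|) := by
            rw [Finset.mul_sum]; refine Finset.sum_congr rfl fun _ _ => by rw [abs_mul]; ring
        _ ≤ ∑ i : Fin 4, 6 * X ^ 3 * (q * B) := by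
            refine Finset.sum_le_sum fun i _ => ?_
            exact mul_le_mul (hadj 1 i) (hr i) (by positivity) (by positivity)
        _ = _ := by simp; ring
    have h2 : q * (|r| * |κ 1|) ≤ |r| * (|A.det| * |κ 1|) := by
      calc q * (|r| * |κ 1|) ≤ |A.det| * (|r| * |κ 1|) := by gcongr
        _ = _ := by ring
    have h3 : q * (24 * X ^ 3 * B) < q * (|r| * |κ 1|) := by
      apply mul_lt_mul_of_pos_left h; omega
    linarith [mul_left_comm q (24 * X ^ 3) B]

attribute [local instance] Matrix.seminormedAddCommGroup in
lemma exists_hyp (X : ℕ) (hX : 1 ≤ X) (G : Finset (Fin 4 → ℤ))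
    (hG : ∀ g ∈ G, ∀ i, |g i| ≤ X) (hG0 : ∀ g ∈ G, g ≠ 0) (hne : G.Nonempty)
    (hdet : ∀ A : Matrix (Fin 4) (Fin 4) ℤ, (∀ i, A i ∈ G) → A.det = 0) :
    ∃ T : Fin 4 → ℤ, T ≠ 0 ∧ (∀ i, |T i| ≤ (4 * X) ^ 3) ∧ ∀ g ∈ G, ∑ i, T i * g i = 0 := by
  classical
  let ι : (Fin 4 → ℤ) → (Fin 4 → ℚ) := fun g i => (g i : ℚ)
  have hι : Function.Injective ι := by
    intro g g' h; funext i; have := congrFun h i; simpa [ι] using this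
  obtain ⟨b, hb1, hb2, hb3⟩ := exists_linearIndependent ℚ (ι '' (G : Set (Fin 4 → ℤ)))
  have hbfin : b.Finite := (G.finite_toSet.image ι).subset hb1
  haveI : Fintype b := hbfin.fintype
  have hmem : ∀ x : b, ∃ g ∈ G, ι g = x.1 := fun x => by
    obtain ⟨g, hg, h⟩ := hb1 x.2; exact ⟨g, hg, h⟩
  choose f hfG hf using hmem
  have hcard : Fintype.card b < 4 := by
    by_contra hcon
    push Not at hcon
    obtain ⟨e⟩ : Nonempty (Fin 4 ↪ b) := by
      apply Function.Embedding.nonempty_of_card_le; simpa using hcon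
    have h0 := hdet (fun i => f (e i)) (fun i => hfG _)
    let A : Matrix (Fin 4) (Fin 4) ℤ := fun i => f (e i)
    have h1 : LinearIndependent ℚ (A.map (Int.castRingHom ℚ)).row := by
      have : (A.map (Int.castRingHom ℚ)).row = fun i => ((e i : b) : Fin 4 → ℚ) := by
        funext i
        rw [← hf]; rfl
      rw [this]
      exact hb3.comp e e.injective
    rw [Matrix.linearIndependent_rows_iff_isUnit, Matrix.isUnit_iff_isUnit_det] at h1
    have h2 : (A.map (Int.castRingHom ℚ)).det = ((A.det : ℤ) : ℚ) := by
      have := RingHom.map_det (Int.castRingHom ℚ) A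
      simpa using this.symm
    rw [h2] at h1
    have : A.det = 0 := h0
    simp [this] at h1
  have hpos : 0 < Fintype.card b := by
    rw [Fintype.card_pos_iff]
    by_contra hcon
    rw [not_nonempty_iff] at hcon
    have hbe : b = ∅ := Set.isEmpty_coe_sort.1 hcon
    obtain ⟨g, hg⟩ := hne
    have : ι g ∈ Submodule.span ℚ b := by rw [hb2]; exact Submodule.subset_span ⟨g, hg, rfl⟩
    rw [hbe, Submodule.span_empty, Submodule.mem_bot] at this
    exact hG0 g hg (hι (by rw [this]; funext i; simp [ι]))
  obtain ⟨T, hT0, hT1, hT2⟩ := Int.Matrix.exists_ne_zero_int_vec_norm_le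
    (Matrix.of f) (by simpa using hcard) hpos
  refine ⟨T, hT0, ?_, ?_⟩
  · have hn : max 1 ‖Matrix.of f‖ ≤ (X : ℝ) := by
      refine max_le (by exact_mod_cast hX) ?_
      rw [Matrix.norm_le_iff (by positivity)]
      intro i j
      have := hG _ (hfG i) j
      rw [Int.norm_eq_abs]
      exact_mod_cast this
    have h3 : ‖T‖ ≤ (4 * X : ℝ) ^ 3 := by
      refine hT2.trans ?_
      have h4 : ((Fintype.card (Fin 4) : ℝ) * max 1 ‖Matrix.of f‖) ≤ 4 * X := by
        simp only [Fintype.card_fin, Nat.cast_ofNat]; gcongr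
      have h5 : (1 : ℝ) ≤ ((Fintype.card (Fin 4) : ℝ) * max 1 ‖Matrix.of f‖) := by
        simp only [Fintype.card_fin, Nat.cast_ofNat]
        have := le_max_left 1 ‖Matrix.of f‖
        linarith
      have h6 : (Fintype.card b : ℝ) ≤ 3 := by exact_mod_cast Nat.le_of_lt_succ hcard
      have h7 : ((Fintype.card b : ℝ) / ((Fintype.card (Fin 4) : ℝ) - Fintype.card b)) ≤ 3 := by
        rw [Fintype.card_fin, div_le_iff₀ (by push_cast; linarith)]
        push_cast; linarith
      calc _ ≤ ((Fintype.card (Fin 4) : ℝ) * max 1 ‖Matrix.of f‖) ^ (3 : ℝ) :=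
            Real.rpow_le_rpow_of_exponent_le h5 h7
        _ ≤ (4 * X : ℝ) ^ (3 : ℝ) := Real.rpow_le_rpow (by linarith) h4 (by norm_num)
        _ = _ := by norm_cast
    intro i
    have h8 := (norm_le_pi_norm T i).trans h3
    rw [Int.norm_eq_abs] at h8
    exact_mod_cast h8
  · intro g hg
    have hsp : ι g ∈ Submodule.span ℚ b := by rw [hb2]; exact Submodule.subset_span ⟨g, hg, rfl⟩
    have key : ∀ v ∈ Submodule.span ℚ b, ∑ i, (T i : ℚ) * v i = 0 := by
      intro v hv
      induction hv using Submodule.span_induction with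
      | mem x hx =>
        have h1 := congrFun hT1 ⟨x, hx⟩
        have h2 := hf ⟨x, hx⟩
        simp only at h2
        rw [← h2]
        simp only [Matrix.mulVec, dotProduct, Matrix.of_apply, Pi.zero_apply] at h1
        have h3 : (∑ i, f ⟨x, hx⟩ i * T i : ℚ) = 0 := by exact_mod_cast h1
        rw [← h3]
        exact Finset.sum_congr rfl fun i _ => mul_comm _ _
      | zero => simp
      | add x y _ _ h1 h2 => simp [mul_add, Finset.sum_add_distrib, h1, h2]
      | smul a x _ h1 =>
        calc _ = a * ∑ i, (T i : ℚ) * x i := by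
              rw [Finset.mul_sum]; exact Finset.sum_congr rfl fun i _ => by simp; ring
          _ = 0 := by rw [h1, mul_zero]
    have := key _ hsp
    simp only [ι] at this
    exact_mod_cast this

lemma nc_count : ∃ C : ℝ, 1 ≤ C ∧ ∀ (X : ℕ), 1 ≤ X → ∀ (ε : ℤ), ε * ε = 1 →
    ∀ (G : Finset (Fin 4 → ℤ)), (∀ g ∈ G, Quad X ε g) → ∀ (x y w1 w2 q r B : ℤ),
    IsCoprime x y → IsCoprime w1 w2 → 1 ≤ q →
    (∀ g ∈ G, q ∣ (g 0 * x + g 1 * y) * w2 - (g 2 * x + g 3 * y) * w1) →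
    (∀ g ∈ G, |r| * |(g 0 * x + g 1 * y) * w2 - (g 2 * x + g 3 * y) * w1| ≤ q * B) →
    (24 * (X : ℤ) ^ 4 < q ∨ 24 * (X : ℤ) ^ 3 * B < |r| * |y * w2|) →
    (G.card : ℝ) ≤ C * (X : ℝ) ^ (1.1 : ℝ) := by
  obtain ⟨C0, hC0, htau⟩ := tau_bd 80
  set Cb : ℝ := 2 ^ 80 * C0 * 12288 with hCb
  have hC0' : (1 : ℝ) ≤ C0 := by exact_mod_cast hC0
  have hCb1 : 1 ≤ Cb := by rw [hCb]; nlinarith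
  refine ⟨Cb + 2, by linarith, ?_⟩
  intro X hX ε hε G hG x y w1 w2 q r B hxy hw hq1 hq hr h
  have hX1 : (1 : ℝ) ≤ X := by exact_mod_cast hX
  have hX0 : (0 : ℝ) < X := by linarith
  rcases G.eq_empty_or_nonempty with rfl | hne
  · simp only [Finset.card_empty, Nat.cast_zero]; positivity
  set κ : Fin 4 → ℤ := ![x * w2, y * w2, -(x * w1), -(y * w1)] with hκ
  have hdot : ∀ g : Fin 4 → ℤ, ∑ i, g i * κ i =
      (g 0 * x + g 1 * y) * w2 - (g 2 * x + g 3 * y) * w1 := by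
    intro g; rw [Fin.sum_univ_four]; simp [hκ]; ring
  obtain ⟨s, t, hst⟩ := hxy
  obtain ⟨s', t', hst'⟩ := hw
  have hdet : ∀ A : Matrix (Fin 4) (Fin 4) ℤ, (∀ i, A i ∈ G) → A.det = 0 := by
    intro A hA
    have hv : ∀ i, A.mulVec κ i = (A i 0 * x + A i 1 * y) * w2 - (A i 2 * x + A i 3 * y) * w1 :=
      fun i => hdot (A i)
    refine det_zero A X (by positivity) ?_ κ ![s * t', t * t', -(s * s'), -(t * s')] ?_ q hq1 ?_ r B ?_ ?_
    · intro i j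
      have := (hG _ (hA i)).1 j
      rw [abs_of_nonneg (by omega)]; exact this.2
    · rw [Fin.sum_univ_four]; simp [hκ]
      linear_combination hst * (s' * w1 + t' * w2) + hst'
    · intro i; rw [hv]; exact hq _ (hA i)
    · intro i; rw [hv]; exact hr _ (hA i)
    · simpa [hκ] using h
  obtain ⟨T, hT0, hT1, hT2⟩ := exists_hyp X hX G (fun g hg i => by
      have := (hG g hg).1 i
      rw [abs_of_nonneg (by omega)]; exact this.2)
    (fun g hg h0 => by have := ((hG g hg).1 0).1; simp [h0] at this) hne hdet
  set τ : ℕ := ⌊Cb * (X : ℝ) ^ (0.1 : ℝ)⌋₊ with hτd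
  have hτ : ∀ z : ℤ, z ≠ 0 → |z| ≤ 3 * (((4 * X) ^ 3 : ℕ) : ℤ) ^ 2 * X ^ 2 → (zdiv z).card ≤ τ := by
    intro z hz hzb
    apply Nat.le_floor
    have h1 := card_zdiv z
    have h2 := htau z.natAbs (by simpa using hz)
    have h3 : ((zdiv z).card : ℝ) ^ 80 ≤ (Cb * (X : ℝ) ^ (0.1 : ℝ)) ^ 80 := by
      have h4 : ((zdiv z).card : ℝ) ≤ 2 * (z.natAbs.divisors.card : ℝ) := by exact_mod_cast h1
      have h5 : (z.natAbs.divisors.card : ℝ) ^ 80 ≤ C0 * (z.natAbs : ℝ) := by exact_mod_cast h2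
      have h6 : (z.natAbs : ℝ) ≤ 12288 * (X : ℝ) ^ 8 := by
        have e1 : (z.natAbs : ℤ) ≤ 12288 * (X : ℤ) ^ 8 := by
          rw [Int.natCast_natAbs]
          refine hzb.trans (le_of_eq ?_)
          push_cast; ring
        exact_mod_cast e1
      have h7 : ((X : ℝ) ^ (0.1 : ℝ)) ^ 80 = (X : ℝ) ^ 8 := by
        rw [← Real.rpow_natCast, ← Real.rpow_mul hX0.le, ← Real.rpow_natCast]; norm_num
      calc ((zdiv z).card : ℝ) ^ 80 ≤ (2 * (z.natAbs.divisors.card : ℝ)) ^ 80 := by gcongr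
        _ = 2 ^ 80 * (z.natAbs.divisors.card : ℝ) ^ 80 := by rw [mul_pow]
        _ ≤ 2 ^ 80 * (C0 * (12288 * (X : ℝ) ^ 8)) := by
            gcongr; exact h5.trans (by gcongr)
        _ = Cb * X ^ 8 := by rw [hCb]; ring
        _ ≤ Cb ^ 80 * X ^ 8 := by gcongr; exact le_self_pow₀ hCb1 (by norm_num)
        _ = _ := by rw [mul_pow Cb, h7]
    exact le_of_pow_le_pow_left₀ (by norm_num) (by positivity) h3
  have hfin := hyp_count X ((4 * X) ^ 3) τ ε hε G hG T hT0 (by intro i; push_cast; exact hT1 i) hT2 hτ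
  have h8 : (G.card : ℝ) ≤ X * (τ + 2) := by exact_mod_cast hfin
  have h9 : (τ : ℝ) ≤ Cb * (X : ℝ) ^ (0.1 : ℝ) := Nat.floor_le (by positivity)
  have h10 : (1 : ℝ) ≤ (X : ℝ) ^ (0.1 : ℝ) := Real.one_le_rpow hX1 (by norm_num)
  calc (G.card : ℝ) ≤ X * (τ + 2) := h8
    _ ≤ X * (Cb * (X : ℝ) ^ (0.1 : ℝ) + 2 * (X : ℝ) ^ (0.1 : ℝ)) := by gcongr; linarith
    _ = (Cb + 2) * ((X : ℝ) ^ (1 : ℝ) * (X : ℝ) ^ (0.1 : ℝ)) := by rw [Real.rpow_one]; ring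
    _ = _ := by rw [← Real.rpow_add hX0]; norm_num

open ZMod in
lemma char_orth (P : ℕ) [NeZero P] (a : ZMod P) :
    ∑ x : ZMod P, stdAddChar (x * a) = if a = 0 then (P : ℂ) else 0 := by
  have := AddChar.sum_mulShift (ψ := (stdAddChar : AddChar (ZMod P) ℂ)) a (isPrimitive_stdAddChar P)
  rw [this]; split_ifs <;> simp

open ZMod in
lemma char_conj (P : ℕ) [NeZero P] (a : ZMod P) :
    (starRingEnd ℂ) (stdAddChar a) = stdAddChar (-a) := by
  rw [← AddChar.map_neg_eq_conj]

open ZMod in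
lemma parseval_le (P : ℕ) [NeZero P] {ι : Type*} [DecidableEq ι] (I : Finset ι) (c : ι → ℂ)
    (f : ι → ZMod P × ZMod P) :
    ∑ u : ZMod P × ZMod P, ‖∑ i ∈ I, c i * stdAddChar (u.1 * (f i).1 + u.2 * (f i).2)‖ ^ 2 ≤
      (P : ℝ) ^ 2 * ∑ i ∈ I, ‖c i‖ ^ 2 * ((I.filter (fun j => f j = f i)).card : ℝ) := by
  have h1 : ((∑ u : ZMod P × ZMod P,
      ‖∑ i ∈ I, c i * stdAddChar (u.1 * (f i).1 + u.2 * (f i).2)‖ ^ 2 : ℝ) : ℂ) =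
      ∑ i ∈ I, ∑ j ∈ I, c i * (starRingEnd ℂ) (c j) * (if f i = f j then (P : ℂ) ^ 2 else 0) := by
    push_cast
    calc _ = ∑ u : ZMod P × ZMod P, ∑ i ∈ I, ∑ j ∈ I, c i * (starRingEnd ℂ) (c j) *
          (stdAddChar (u.1 * ((f i).1 - (f j).1)) * stdAddChar (u.2 * ((f i).2 - (f j).2))) := by
          refine Finset.sum_congr rfl fun u _ => ?_
          rw [← Complex.mul_conj', map_sum, Finset.sum_mul_sum]
          refine Finset.sum_congr rfl fun i _ => Finset.sum_congr rfl fun j _ => ?_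
          have e : (stdAddChar (u.1 * ((f i).1 - (f j).1)) * stdAddChar (u.2 * ((f i).2 - (f j).2)) : ℂ)
              = stdAddChar (u.1 * (f i).1 + u.2 * (f i).2) *
                stdAddChar (-(u.1 * (f j).1 + u.2 * (f j).2)) := by
            rw [← AddChar.map_add_eq_mul, ← AddChar.map_add_eq_mul]; congr 1; ring
          rw [map_mul, char_conj, e]; ring
      _ = _ := by
          rw [Finset.sum_comm]
          refine Finset.sum_congr rfl fun i _ => ?_
          rw [Finset.sum_comm]
          refine Finset.sum_congr rfl fun j _ => ?_
          rw [← Finset.mul_sum, Fintype.sum_prod_type]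
          simp only
          rw [← Finset.sum_mul_sum, char_orth, char_orth]
          congr 1
          simp only [sub_eq_zero, Prod.ext_iff]
          by_cases h1 : (f i).1 = (f j).1 <;> by_cases h2 : (f i).2 = (f j).2 <;> simp [h1, h2, sq]
  have h2 : (∑ u : ZMod P × ZMod P,
      ‖∑ i ∈ I, c i * stdAddChar (u.1 * (f i).1 + u.2 * (f i).2)‖ ^ 2 : ℝ) ≤
      ∑ i ∈ I, ∑ j ∈ I, (if f i = f j then (P : ℝ) ^ 2 * ((‖c i‖ ^ 2 + ‖c j‖ ^ 2) / 2) else 0) := by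
    have h3 := congrArg norm h1
    rw [Complex.norm_real, Real.norm_of_nonneg (by positivity)] at h3
    rw [h3]
    refine (norm_sum_le _ _).trans (Finset.sum_le_sum fun i _ => (norm_sum_le _ _).trans
      (Finset.sum_le_sum fun j _ => ?_))
    split_ifs with h
    · rw [norm_mul, norm_mul, norm_pow, Complex.norm_natCast, RCLike.norm_conj, mul_comm]
      gcongr
      nlinarith [sq_nonneg (‖c i‖ - ‖c j‖)]
    · simp
  refine h2.trans (le_of_eq ?_)
  have e1 : ∀ g : ι → ι → ℝ, (∑ i ∈ I, ∑ j ∈ I, (if f i = f j then g i j else 0)) =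
      ∑ i ∈ I, ∑ j ∈ I.filter (fun j => f j = f i), g i j := by
    intro g
    refine Finset.sum_congr rfl fun i _ => ?_
    rw [Finset.sum_filter]
    exact Finset.sum_congr rfl fun j _ => by simp only [eq_comm]
  have e2 : (∑ i ∈ I, ∑ j ∈ I, (if f i = f j then ‖c j‖ ^ 2 else 0)) =
      ∑ i ∈ I, ∑ j ∈ I, (if f i = f j then ‖c i‖ ^ 2 else 0) := by
    rw [Finset.sum_comm]
    exact Finset.sum_congr rfl fun i _ => Finset.sum_congr rfl fun j _ => by simp only [eq_comm]
  calc _ = (P : ℝ) ^ 2 / 2 * ((∑ i ∈ I, ∑ j ∈ I, (if f i = f j then ‖c i‖ ^ 2 else 0)) +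
        (∑ i ∈ I, ∑ j ∈ I, (if f i = f j then ‖c j‖ ^ 2 else 0))) := by
        rw [← Finset.sum_add_distrib, Finset.mul_sum]
        refine Finset.sum_congr rfl fun i _ => ?_
        rw [← Finset.sum_add_distrib, Finset.mul_sum]
        refine Finset.sum_congr rfl fun j _ => ?_
        split_ifs <;> ring
    _ = (P : ℝ) ^ 2 * (∑ i ∈ I, ∑ j ∈ I, (if f i = f j then ‖c i‖ ^ 2 else 0)) := by
        rw [e2]; ring
    _ = _ := by
        rw [e1]
        congr 1
        refine Finset.sum_congr rfl fun i _ => ?_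
        rw [Finset.sum_const, nsmul_eq_mul, mul_comm]

open ZMod in
lemma kern_lower (P : ℕ) [NeZero P] (H : ℕ) (u : ℤ) (hu0 : 0 ≤ u) (M : ℤ) (hu : u ≤ M)
    (hHM : 6 * H * M ≤ P) :
    (H : ℝ) / 2 ≤ ‖∑ h ∈ Finset.range H, stdAddChar ((u : ZMod P) * (h : ZMod P))‖ := by
  refine le_trans ?_ (Complex.re_le_norm _)
  rw [Complex.re_sum]
  have hP : (0 : ℝ) < P := by exact_mod_cast Nat.pos_of_ne_zero (NeZero.ne P)
  have : ∀ h ∈ Finset.range H, (1 / 2 : ℝ) ≤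
      (stdAddChar ((u : ZMod P) * (h : ZMod P)) : ℂ).re := by
    intro h hh
    have hh' : h ≤ H := (Finset.mem_range.1 hh).le
    have e1 : (u : ZMod P) * (h : ZMod P) = ((u * h : ℤ) : ZMod P) := by push_cast; rfl
    rw [e1, stdAddChar_coe]
    have e2 : (2 * Real.pi * Complex.I * ((u * h : ℤ) : ℂ) / (P : ℂ)) =
      ((2 * Real.pi * ((u * h : ℤ) : ℝ) / P : ℝ) : ℂ) * Complex.I := by push_cast; ring
    rw [e2, Complex.exp_ofReal_mul_I_re]
    rw [← Real.cos_pi_div_three]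
    have hb : 6 * ((u * h : ℤ) : ℝ) ≤ P := by
      have : 6 * (u * h) ≤ (P : ℤ) := by
        have a1 : (h : ℤ) ≤ H := by exact_mod_cast hh'
        have a2 : u * h ≤ M * H := by
          apply mul_le_mul hu a1 (by positivity) (by linarith)
        linarith
      exact_mod_cast this
    have hnn : (0 : ℝ) ≤ ((u * h : ℤ) : ℝ) := by
      have : 0 ≤ u * h := by positivity
      exact_mod_cast this
    apply Real.cos_le_cos_of_nonneg_of_le_pi
    · have := Real.pi_pos; positivity
    · linarith [Real.pi_pos]
    · rw [div_le_iff₀ hP]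
      nlinarith [Real.pi_pos]
  calc (H : ℝ) / 2 = ∑ h ∈ Finset.range H, (1 / 2 : ℝ) := by simp; ring
    _ ≤ _ := Finset.sum_le_sum this

lemma natCast_inj_lt {P : ℕ} {a b : ℕ} (ha : a < P) (hb : b < P)
    (h : (a : ZMod P) = (b : ZMod P)) : a = b := by
  rw [ZMod.natCast_eq_natCast_iff] at h
  exact Nat.ModEq.eq_of_lt_of_lt h ha hb

set_option maxHeartbeats 1000000 in
lemma count_aux (P : ℕ) [NeZero P] (H : ℕ) (hHP : H ≤ P) {β : Type} [DecidableEq β] (V : Finset β)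
    (w1 w2 : β → ℤ) (Z : Finset (ZMod P)) (t : ZMod P) (Q : β × ZMod P × β → Prop) [DecidablePred Q]
    (hQ : ∀ w ∈ V, ∀ t' ∈ Z, ∀ w' ∈ V, ∀ h1 h2 : ℤ, |h1| < H → |h2| < H →
      t * w1 w - t' * w1 w' = h1 → t * w2 w - t' * w2 w' = h2 → Q (w, t', w')) :
    (((Finset.range H ×ˢ Finset.range H) ×ˢ V).sigma
      (fun x => ((Finset.range H ×ˢ Finset.range H) ×ˢ (Z ×ˢ V)).filter (fun j =>
        ((j.1.1 : ZMod P) + j.2.1 * w1 j.2.2, (j.1.2 : ZMod P) + j.2.1 * w2 j.2.2) =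
        ((x.1.1 : ZMod P) + t * w1 x.2, (x.1.2 : ZMod P) + t * w2 x.2)))).card ≤
        ((Finset.range H ×ˢ Finset.range H) ×ˢ ((V ×ˢ Z ×ˢ V).filter Q)).card := by
  refine Finset.card_le_card_of_injOn
    (fun x => (x.1.1, (x.1.2, x.2.2.1, x.2.2.2))) ?_ ?_
  · rintro ⟨⟨⟨h1, h2⟩, w⟩, ⟨⟨h1', h2'⟩, ⟨t', w'⟩⟩⟩ hx
    simp only [Finset.coe_sigma, Set.mem_sigma_iff, Finset.mem_coe, Finset.mem_filter,
      Finset.mem_product, Finset.mem_range, Prod.mk.injEq] at hx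
    obtain ⟨⟨⟨a1, a2⟩, aw⟩, ⟨⟨b1, b2⟩, bt, bw⟩, e1, e2⟩ := hx
    simp only [Finset.mem_coe, Finset.mem_product, Finset.mem_range, Finset.mem_filter]
    refine ⟨⟨a1, a2⟩, ⟨aw, bt, bw⟩, ?_⟩
    refine hQ w aw t' bt w' bw ((h1' : ℤ) - h1) ((h2' : ℤ) - h2) ?_ ?_ ?_ ?_
    · rw [abs_lt]; omega
    · rw [abs_lt]; omega
    · push_cast; linear_combination -e1
    · push_cast; linear_combination -e2
  · rintro ⟨⟨⟨h1, h2⟩, w⟩, ⟨⟨h1', h2'⟩, ⟨t', w'⟩⟩⟩ hx ⟨⟨⟨k1, k2⟩, v⟩, ⟨⟨k1', k2'⟩, ⟨s', v'⟩⟩⟩ hy h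
    simp only [Finset.coe_sigma, Set.mem_sigma_iff, Finset.mem_coe, Finset.mem_filter,
      Finset.mem_product, Finset.mem_range, Prod.mk.injEq] at hx hy h
    obtain ⟨⟨⟨a1, a2⟩, aw⟩, ⟨⟨b1, b2⟩, bt, bw⟩, e1, e2⟩ := hx
    obtain ⟨⟨⟨c1, c2⟩, cw⟩, ⟨⟨d1, d2⟩, dt, dw⟩, g1, g2⟩ := hy
    obtain ⟨⟨rfl, rfl⟩, rfl, rfl, rfl⟩ := h
    have z1 : h1' = k1' := natCast_inj_lt (P := P) (by omega) (by omega)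
      (by linear_combination e1 - g1)
    have z2 : h2' = k2' := natCast_inj_lt (P := P) (by omega) (by omega)
      (by linear_combination e2 - g2)
    subst z1 z2
    rfl

lemma bil_num (A m H P Nm F2 G2 G3 G4 : ℝ) (hH : 0 < H) (hA : 0 ≤ A) (hm : 0 ≤ m) (hN : 0 ≤ Nm)
    (h1 : A ^ 2 ≤ m * F2) (h2 : F2 ≤ 16 / H ^ 4 * G2) (h3 : G2 ≤ G3) (h4 : G3 ≤ P ^ 2 * G4)
    (h5 : G4 ≤ H ^ 2 * Nm * A) : A ≤ 16 * P ^ 2 / H ^ 2 * m * Nm := by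
  have hfinal : A * A ≤ (16 * P ^ 2 / H ^ 2 * m * Nm) * A := by
    calc A * A = A ^ 2 := by ring
      _ ≤ m * F2 := h1
      _ ≤ m * (16 / H ^ 4 * (P ^ 2 * (H ^ 2 * Nm * A))) := by
          gcongr
          refine h2.trans ?_
          gcongr
          refine h3.trans (h4.trans ?_)
          gcongr
      _ = _ := by field_simp
  rcases hA.eq_or_lt with h | h
  · rw [← h]; positivity
  · exact le_of_mul_le_mul_right hfinal h

set_option maxHeartbeats 1000000 in
open ZMod in
lemma bilinear (P : ℕ) [NeZero P] {α β : Type} [DecidableEq α] [DecidableEq β]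
    (U : Finset α) (V : Finset β) (u1 u2 : α → ℤ) (w1 w2 : β → ℤ) (M : ℤ) (hM : 1 ≤ M)
    (H : ℕ) (hH : 1 ≤ H) (hHM : 6 * H * M ≤ P)
    (hU : ∀ a ∈ U, (0 ≤ u1 a ∧ u1 a ≤ M) ∧ (0 ≤ u2 a ∧ u2 a ≤ M))
    (hinj : ∀ a ∈ U, ∀ b ∈ U, u1 a = u1 b → u2 a = u2 b → a = b)
    (Z : Finset (ZMod P)) (Nm : ℝ) (Q : ZMod P → β × ZMod P × β → Prop)
    [∀ t, DecidablePred (Q t)]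
    (hQ : ∀ t ∈ Z, ∀ w ∈ V, ∀ t' ∈ Z, ∀ w' ∈ V, ∀ h1 h2 : ℤ, |h1| < H → |h2| < H →
      t * w1 w - t' * w1 w' = h1 → t * w2 w - t' * w2 w' = h2 → Q t (w, t', w'))
    (hNm : 0 ≤ Nm) (hN : ∀ t ∈ Z, (((V ×ˢ Z ×ˢ V).filter (Q t)).card : ℝ) ≤ Nm) :
    ∑ t ∈ Z, ‖∑ a ∈ U, ∑ b ∈ V, stdAddChar (t * (u1 a * w1 b + u2 a * w2 b) : ZMod P)‖ ^ 2 ≤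
      16 * (P : ℝ) ^ 2 / (H : ℝ) ^ 2 * U.card * Nm := by
  classical
  have hPpos : 0 < P := Nat.pos_of_ne_zero (NeZero.ne P)
  have hHr : (0 : ℝ) < H := by exact_mod_cast hH
  set S : ZMod P → ℂ := fun t => ∑ a ∈ U, ∑ b ∈ V, stdAddChar (t * (u1 a * w1 b + u2 a * w2 b) : ZMod P)
    with hS
  set A : ℝ := ∑ t ∈ Z, ‖S t‖ ^ 2 with hA
  have hA0 : 0 ≤ A := by positivity
  set F : ZMod P × ZMod P → ℂ := fun u => ∑ t ∈ Z, ∑ b ∈ V,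
    (starRingEnd ℂ) (S t) * stdAddChar (u.1 * (t * (w1 b : ZMod P)) + u.2 * (t * (w2 b : ZMod P)) : ZMod P) with hF
  set ι := (ℕ × ℕ) × (ZMod P × β)
  set I : Finset ((ℕ × ℕ) × (ZMod P × β)) := (Finset.range H ×ˢ Finset.range H) ×ˢ (Z ×ˢ V) with hI
  set c : (ℕ × ℕ) × (ZMod P × β) → ℂ := fun i => (starRingEnd ℂ) (S i.2.1) with hc
  set f : (ℕ × ℕ) × (ZMod P × β) → ZMod P × ZMod P := fun i =>
    ((i.1.1 : ZMod P) + i.2.1 * w1 i.2.2, (i.1.2 : ZMod P) + i.2.1 * w2 i.2.2) with hf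
  set G : ZMod P × ZMod P → ℂ := fun u => ∑ i ∈ I, c i * stdAddChar (u.1 * (f i).1 + u.2 * (f i).2)
    with hG
  have hfac : ∀ u, G u = (∑ h ∈ Finset.range H, stdAddChar (u.1 * (h : ZMod P))) *
      (∑ h ∈ Finset.range H, stdAddChar (u.2 * (h : ZMod P))) * F u := by
    intro u
    simp only [hG, hI, hF, hc, hf]
    rw [Finset.sum_product, Finset.sum_product, Finset.sum_mul_sum, Finset.sum_mul]
    refine Finset.sum_congr rfl fun h1 _ => ?_
    rw [Finset.sum_mul]
    refine Finset.sum_congr rfl fun h2 _ => ?_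
    rw [Finset.sum_product, Finset.mul_sum]
    refine Finset.sum_congr rfl fun t _ => ?_
    rw [Finset.mul_sum]
    refine Finset.sum_congr rfl fun b _ => ?_
    simp only
    have : u.1 * ((h1 : ZMod P) + t * w1 b) + u.2 * ((h2 : ZMod P) + t * w2 b) =
      (u.1 * h1 + u.2 * h2) + (u.1 * (t * w1 b) + u.2 * (t * w2 b)) := by ring
    rw [this, AddChar.map_add_eq_mul, AddChar.map_add_eq_mul _ (u.1 * (h1 : ZMod P))]; ring
  have hAF : (A : ℂ) = ∑ a ∈ U, F ((u1 a : ZMod P), (u2 a : ZMod P)) := by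
    simp only [hA, hF]
    push_cast
    rw [Finset.sum_comm]
    refine Finset.sum_congr rfl fun t _ => ?_
    rw [← Complex.conj_mul']
    conv_lhs => rw [hS]
    simp only
    rw [Finset.mul_sum]
    refine Finset.sum_congr rfl fun a _ => ?_
    rw [Finset.mul_sum]
    refine Finset.sum_congr rfl fun b _ => ?_
    congr 2
    ring
  have hAle : A ≤ ∑ a ∈ U, ‖F ((u1 a : ZMod P), (u2 a : ZMod P))‖ := by
    have h3 := congrArg norm hAF
    rw [Complex.norm_real, Real.norm_of_nonneg hA0] at h3
    rw [h3]; exact norm_sum_le _ _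
  have hsq : A ^ 2 ≤ U.card * ∑ a ∈ U, ‖F ((u1 a : ZMod P), (u2 a : ZMod P))‖ ^ 2 :=
    (pow_le_pow_left₀ hA0 hAle 2).trans sq_sum_le_card_mul_sum_sq
  have hFG : ∀ a ∈ U, ‖F ((u1 a : ZMod P), (u2 a : ZMod P))‖ ^ 2 ≤
      16 / (H : ℝ) ^ 4 * ‖G ((u1 a : ZMod P), (u2 a : ZMod P))‖ ^ 2 := by
    intro a ha
    rw [hfac, norm_mul, norm_mul]
    have k1 := kern_lower P H (u1 a) (hU a ha).1.1 M (hU a ha).1.2 hHM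
    have k2 := kern_lower P H (u2 a) (hU a ha).2.1 M (hU a ha).2.2 hHM
    set e1 := ‖∑ h ∈ Finset.range H, stdAddChar ((u1 a : ZMod P) * (h : ZMod P))‖
    set e2 := ‖∑ h ∈ Finset.range H, stdAddChar ((u2 a : ZMod P) * (h : ZMod P))‖
    have k3 : (H : ℝ) ^ 2 / 4 ≤ e1 * e2 := by
      calc (H : ℝ) ^ 2 / 4 = (H / 2) * (H / 2) := by ring
        _ ≤ _ := by gcongr
    have k4 : 1 ≤ 16 / (H : ℝ) ^ 4 * (e1 * e2) ^ 2 := by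
      rw [div_mul_eq_mul_div, le_div_iff₀ (by positivity)]
      have := pow_le_pow_left₀ (by positivity) k3 2
      calc 1 * (H : ℝ) ^ 4 = 16 * (((H : ℝ) ^ 2 / 4) ^ 2) := by ring
        _ ≤ _ := by gcongr
    calc _ ≤ (16 / (H : ℝ) ^ 4 * (e1 * e2) ^ 2) * ‖F ((u1 a : ZMod P), (u2 a : ZMod P))‖ ^ 2 :=
          le_mul_of_one_le_left (by positivity) k4
      _ = _ := by ring
  have hMP : M < P := by
    have : (1 : ℤ) ≤ H := by exact_mod_cast hH
    nlinarith
  have hHP : H ≤ P := by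
    have : (1 : ℤ) ≤ H := by exact_mod_cast hH
    have : (H : ℤ) ≤ P := by nlinarith
    exact_mod_cast this
  have hcast : ∀ x y : ℤ, 0 ≤ x → x ≤ M → 0 ≤ y → y ≤ M → (x : ZMod P) = (y : ZMod P) → x = y := by
    intro x y hx hx' hy hy' h
    rw [ZMod.intCast_eq_intCast_iff] at h
    have h' : x % P = y % P := h
    rwa [Int.emod_eq_of_lt hx (by omega), Int.emod_eq_of_lt hy (by omega)] at h'
  have hGsum : ∑ a ∈ U, ‖G ((u1 a : ZMod P), (u2 a : ZMod P))‖ ^ 2 ≤ ∑ u, ‖G u‖ ^ 2 := by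
    have := Finset.sum_image (s := U) (f := fun u => ‖G u‖ ^ 2)
      (g := fun a => ((u1 a : ZMod P), (u2 a : ZMod P))) (by
        intro a ha b hb h
        simp only [Prod.mk.injEq] at h
        have qa := hU a ha
        have qb := hU b hb
        exact hinj a ha b hb (hcast _ _ qa.1.1 qa.1.2 qb.1.1 qb.1.2 h.1)
          (hcast _ _ qa.2.1 qa.2.2 qb.2.1 qb.2.2 h.2))
    rw [← this]
    exact Finset.sum_le_sum_of_subset_of_nonneg (Finset.subset_univ _) fun _ _ _ => by positivity
  have hpars := parseval_le P I c f
  have hcount : ∑ i ∈ I, ‖c i‖ ^ 2 * ((I.filter (fun j => f j = f i)).card : ℝ) ≤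
      (H : ℝ) ^ 2 * Nm * A := by
    have r1 : ∑ i ∈ I, ‖c i‖ ^ 2 * ((I.filter (fun j => f j = f i)).card : ℝ) =
        ∑ t ∈ Z, ‖S t‖ ^ 2 * ∑ x ∈ (Finset.range H ×ˢ Finset.range H) ×ˢ V,
          ((I.filter (fun j => f j = f (x.1, (t, x.2)))).card : ℝ) := by
      rw [hI, Finset.sum_product, Finset.sum_comm, Finset.sum_product]
      refine Finset.sum_congr rfl fun t _ => ?_
      rw [Finset.mul_sum, Finset.sum_product, Finset.sum_comm]
      simp only [hc, RCLike.norm_conj]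
    rw [r1, hA, Finset.mul_sum]
    refine Finset.sum_le_sum fun t ht => ?_
    rw [mul_comm]
    refine mul_le_mul_of_nonneg_right ?_ (by positivity)
    have r2 : ∑ x ∈ (Finset.range H ×ˢ Finset.range H) ×ˢ V,
          ((I.filter (fun j => f j = f (x.1, (t, x.2)))).card : ℝ) =
        (((((Finset.range H ×ˢ Finset.range H) ×ˢ V).sigma
          (fun x => I.filter (fun j => f j = f (x.1, (t, x.2)))))).card : ℝ) := by
      rw [Finset.card_sigma]; push_cast; rfl
    rw [r2]
    have r3 := count_aux P H hHP V w1 w2 Z t (Q t) (hQ t ht)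
    calc _ ≤ ((((Finset.range H ×ˢ Finset.range H) ×ˢ ((V ×ˢ Z ×ˢ V).filter (Q t))).card : ℕ) : ℝ) := by
          exact_mod_cast r3
      _ = (H : ℝ) ^ 2 * (((V ×ˢ Z ×ˢ V).filter (Q t)).card : ℝ) := by
          rw [Finset.card_product, Finset.card_product, Finset.card_range]; push_cast; ring
      _ ≤ _ := by gcongr; exact hN t ht
  have hFs : ∑ a ∈ U, ‖F ((u1 a : ZMod P), (u2 a : ZMod P))‖ ^ 2 ≤
      16 / (H : ℝ) ^ 4 * ∑ a ∈ U, ‖G ((u1 a : ZMod P), (u2 a : ZMod P))‖ ^ 2 := by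
    rw [Finset.mul_sum]; exact Finset.sum_le_sum hFG
  exact bil_num A U.card H P Nm _ _ _ _ hHr hA0 (Nat.cast_nonneg _) hNm hsq hFs hGsum hpars hcount

def Maj (P : ℕ) (Y : ℤ) (t : ZMod P) : Prop :=
  ∃ n r : ℤ, 1 ≤ n ∧ n ≤ Y ∧ |r| ≤ Y ∧ t * (n : ZMod P) = (r : ZMod P)

def MRep (P : ℕ) (Y : ℤ) (t : ZMod P) (T q a r : ℤ) : Prop :=
  (T : ZMod P) = t ∧ T * q = a * P + r ∧ 1 ≤ q ∧ q ≤ Y ∧ |r| ≤ Y ∧ IsCoprime a q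

lemma Maj.rep {P : ℕ} [NeZero P] {Y : ℤ} {t : ZMod P} (h : Maj P Y t) : ∃ T q a r, MRep P Y t T q a r := by
  obtain ⟨n, r, hn1, hn2, hr, h⟩ := h
  obtain ⟨T, rfl⟩ := ZMod.intCast_surjective t
  have h1 : ((T * n - r : ℤ) : ZMod P) = 0 := by push_cast; rw [h]; ring
  rw [ZMod.intCast_zmod_eq_zero_iff_dvd] at h1
  obtain ⟨a, ha⟩ := h1
  have hg : Int.gcd a n ≠ 0 := by
    intro h0; rw [Int.gcd_eq_zero_iff] at h0; omega
  have hg1 : (1 : ℤ) ≤ Int.gcd a n := by exact_mod_cast Nat.pos_of_ne_zero hg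
  obtain ⟨a', ha'⟩ := Int.gcd_dvd_left a n
  obtain ⟨n', hn'⟩ := Int.gcd_dvd_right a n
  set g : ℤ := (Int.gcd a n : ℤ) with hgd
  have hr' : r = g * (T * n' - P * a') := by
    linear_combination (-1) * ha + T * hn' - P * ha'
  have hn'1 : 1 ≤ n' := by nlinarith
  refine ⟨T, n', a', T * n' - P * a', rfl, by ring, hn'1, by nlinarith, ?_, ?_⟩
  · rw [hr', abs_mul, abs_of_pos (by omega)] at hr
    nlinarith [abs_nonneg (T * n' - P * a')]
  · have h2 := Int.gcd_eq_gcd_ab a n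
    refine ⟨Int.gcdA a n, Int.gcdB a n, ?_⟩
    apply mul_left_cancel₀ (show g ≠ 0 by omega)
    rw [← hgd] at h2
    linear_combination (-1) * h2 - Int.gcdA a n * ha' - Int.gcdB a n * hn'

lemma MRep.not_maj {P : ℕ} {Y Y' : ℤ} {t : ZMod P} {T q a r : ℤ} (h : MRep P Y t T q a r)
    (h' : ¬ Maj P Y' t) : Y' < q ∨ Y' < |r| := by
  by_contra hcon
  push Not at hcon
  obtain ⟨h1, h2, h3, -⟩ := h
  refine h' ⟨q, r, h3, hcon.1, hcon.2, ?_⟩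
  rw [← h1]
  have := congrArg (fun z : ℤ => (z : ZMod P)) h2
  push_cast at this
  rw [this]; simp

lemma dvd_of_two {q x w1 w2 : ℤ} (hw : IsCoprime w1 w2) (h1 : q ∣ x * w1) (h2 : q ∣ x * w2) :
    q ∣ x := by
  obtain ⟨s, t, hst⟩ := hw
  have : x = s * (x * w1) + t * (x * w2) := by linear_combination (-x) * hst
  rw [this]
  exact dvd_add (Dvd.dvd.mul_left h1 _) (Dvd.dvd.mul_left h2 _)

lemma pairB_aux {P : ℕ} (hP : 0 < P) {Y H W : ℤ} (hY : 0 ≤ Y) (hW : 0 ≤ W)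
    (hsz : Y ^ 2 * (H + 2 * W) < P) {T q a r T' q' a' r' w w' h : ℤ}
    (e : T * q = a * P + r) (e' : T' * q' = a' * P + r') (hq : 1 ≤ q) (hqY : q ≤ Y) (hq' : 1 ≤ q')
    (hqY' : q' ≤ Y) (hr : |r| ≤ Y) (hr' : |r'| ≤ Y) (hw : 0 ≤ w ∧ w ≤ W) (hw' : 0 ≤ w' ∧ w' ≤ W)
    (hh : |h| < H) (hd : (P : ℤ) ∣ T * w - T' * w' - h) :
    q' * r * w - q * r' * w' = q * q' * h ∧
      ∃ m, q' * (a * w) = q * (a' * w') + q * q' * m := by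
  obtain ⟨m, hm⟩ := hd
  have hE : q' * r * w - q * r' * w' - q * q' * h =
      P * (q * q' * m - q' * a * w + q * a' * w') := by
    linear_combination (q * q') * hm - q' * w * e + q * w' * e'
  have b1 : |q' * r * w| ≤ Y * Y * W := by
    rw [abs_mul, abs_mul, abs_of_pos (by omega : 0 < q'), abs_of_nonneg hw.1]
    exact mul_le_mul (mul_le_mul hqY' hr (abs_nonneg _) hY) hw.2 hw.1 (by positivity)
  have b2 : |q * r' * w'| ≤ Y * Y * W := by
    rw [abs_mul, abs_mul, abs_of_pos (by omega : 0 < q), abs_of_nonneg hw'.1]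
    exact mul_le_mul (mul_le_mul hqY hr' (abs_nonneg _) hY) hw'.2 hw'.1 (by positivity)
  have b3 : |q * q' * h| ≤ Y * Y * H := by
    rw [abs_mul, abs_mul, abs_of_pos (by omega : 0 < q), abs_of_pos (by omega : 0 < q')]
    gcongr
  have b4 : |q' * r * w - q * r' * w' - q * q' * h| < P := by
    calc _ ≤ |q' * r * w| + |q * r' * w'| + |q * q' * h| :=
          (abs_sub _ _).trans (by gcongr; exact abs_sub _ _)
      _ ≤ Y ^ 2 * (H + 2 * W) := by linarith
      _ < P := hsz
  have z : q' * r * w - q * r' * w' - q * q' * h = 0 :=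
    Int.eq_zero_of_abs_lt_dvd (Dvd.intro _ hE.symm) b4
  refine ⟨by linarith, m, ?_⟩
  rw [z] at hE
  have hP0 : (P : ℤ) ≠ 0 := by exact_mod_cast hP.ne'
  have := (mul_eq_zero.1 hE.symm).resolve_left hP0
  linarith

lemma pairB {P : ℕ} [NeZero P] {Y H W : ℤ} (hW : 0 ≤ W)
    (hsz : Y ^ 2 * (H + 2 * W) < P) {t t' : ZMod P} {T q a r T' q' a' r' : ℤ}
    (R : MRep P Y t T q a r) (R' : MRep P Y t' T' q' a' r') {w1 w2 w1' w2' h1 h2 : ℤ}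
    (cw : IsCoprime w1 w2) (cw' : IsCoprime w1' w2')
    (b1 : 0 ≤ w1 ∧ w1 ≤ W) (b2 : 0 ≤ w2 ∧ w2 ≤ W) (b1' : 0 ≤ w1' ∧ w1' ≤ W) (b2' : 0 ≤ w2' ∧ w2' ≤ W)
    (k1 : |h1| < H) (k2 : |h2| < H)
    (e1 : t * w1 - t' * w1' = h1) (e2 : t * w2 - t' * w2' = h2) :
    q = q' ∧ q ∣ w1 * w2' - w2 * w1' ∧ r * w1 - r' * w1' = q * h1 ∧ r * w2 - r' * w2' = q * h2 ∧
      |r| * |w1 * w2' - w2 * w1'| ≤ q * (2 * H * W) := by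
  obtain ⟨rfl, f, hq, hqY, hr, hc⟩ := R
  obtain ⟨rfl, f', hq', hqY', hr', hc'⟩ := R'
  have hP : 0 < P := Nat.pos_of_ne_zero (NeZero.ne P)
  have d1 : (P : ℤ) ∣ T * w1 - T' * w1' - h1 := by
    rw [← ZMod.intCast_zmod_eq_zero_iff_dvd]; push_cast; rw [e1]; ring
  have d2 : (P : ℤ) ∣ T * w2 - T' * w2' - h2 := by
    rw [← ZMod.intCast_zmod_eq_zero_iff_dvd]; push_cast; rw [e2]; ring
  obtain ⟨p1, m1, p1'⟩ := pairB_aux hP (by omega) hW hsz f f' hq hqY hq' hqY' hr hr' b1 b1' k1 d1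
  obtain ⟨p2, m2, p2'⟩ := pairB_aux hP (by omega) hW hsz f f' hq hqY hq' hqY' hr hr' b2 b2' k2 d2
  have qd : q ∣ q' := by
    apply dvd_of_two cw
    · apply (hc.symm).dvd_of_dvd_mul_left (z := q' * w1) 
      exact ⟨a' * w1' + q' * m1, by linarith⟩
    · apply (hc.symm).dvd_of_dvd_mul_left (z := q' * w2) 
      exact ⟨a' * w2' + q' * m2, by linarith⟩
  have qd' : q' ∣ q := by
    apply dvd_of_two cw'
    · apply (hc'.symm).dvd_of_dvd_mul_left (z := q * w1') 
      exact ⟨a * w1 - q * m1, by linarith⟩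
    · apply (hc'.symm).dvd_of_dvd_mul_left (z := q * w2') 
      exact ⟨a * w2 - q * m2, by linarith⟩
  have hqq : q = q' := Int.dvd_antisymm (by omega) (by omega) qd qd'
  subst hqq
  have hq0 : q ≠ 0 := by omega
  have r1 : r * w1 - r' * w1' = q * h1 := by
    apply mul_left_cancel₀ hq0; linarith
  have r2 : r * w2 - r' * w2' = q * h2 := by
    apply mul_left_cancel₀ hq0; linarith
  have a1 : a * w1 = a' * w1' + q * m1 := by
    apply mul_left_cancel₀ hq0; linarith
  have a2 : a * w2 = a' * w2' + q * m2 := by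
    apply mul_left_cancel₀ hq0; linarith
  refine ⟨rfl, ?_, r1, r2, ?_⟩
  · apply (hc.symm).dvd_of_dvd_mul_left
    exact ⟨m1 * w2' - m2 * w1', by linear_combination w2' * a1 - w1' * a2⟩
  · rw [← abs_mul]
    have : r * (w1 * w2' - w2 * w1') = q * (h1 * w2' - h2 * w1') := by
      linear_combination w2' * r1 - w1' * r2
    rw [this, abs_mul, abs_of_pos (by omega)]
    gcongr
    calc |h1 * w2' - h2 * w1'| ≤ |h1| * |w2'| + |h2| * |w1'| := by
          rw [← abs_mul, ← abs_mul]; exact abs_sub _ _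
      _ ≤ H * W + H * W := by
          rw [abs_of_nonneg b1'.1, abs_of_nonneg b2'.1]
          have hH : 0 ≤ H := by have := abs_nonneg h1; omega
          exact add_le_add (mul_le_mul k1.le b2'.2 b2'.1 hH) (mul_le_mul k2.le b1'.2 b1'.1 hH)
      _ = _ := by ring

lemma zmod_cancel {P : ℕ} {k w1 w2 : ℤ} (cw : IsCoprime w1 w2) {t : ZMod P}
    (h1 : t * w1 = (k : ZMod P) * w1) (h2 : t * w2 = (k : ZMod P) * w2) : t = k := by
  obtain ⟨x, y, hxy⟩ := cw
  have h := congrArg (fun z : ℤ => (z : ZMod P)) hxy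
  push_cast at h
  linear_combination (x : ZMod P) * h1 + (y : ZMod P) * h2 - (t - k) * h

lemma mul_pair {w1 w2 h1 h2 : ℤ} (cw : IsCoprime w1 w2) (h : h1 * w2 = h2 * w1) :
    ∃ k, h1 = k * w1 ∧ h2 = k * w2 := by
  obtain ⟨x, y, hxy⟩ := cw
  refine ⟨x * h1 + y * h2, ?_, ?_⟩
  · linear_combination (-h1) * hxy + y * h
  · linear_combination (-h2) * hxy - x * h

def Qp (P H : ℕ) {β : Type} (w1 w2 : β → ℤ) (t : ZMod P) (x : β × ZMod P × β) : Prop :=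
  ∃ h1 h2 : ℤ, |h1| < H ∧ |h2| < H ∧ t * w1 x.1 - x.2.1 * w1 x.2.2 = h1 ∧
    t * w2 x.1 - x.2.1 * w2 x.2.2 = h2

lemma card_shift {P : ℕ} (S : Finset (ZMod P)) (K : ℕ)
    (h : ∀ t ∈ S, ∀ t' ∈ S, ∃ k : ℤ, |k| ≤ K ∧ t' = t + k) : S.card ≤ 2 * K + 1 := by
  classical
  rcases S.eq_empty_or_nonempty with rfl | ⟨t0, ht0⟩
  · simp
  have hsub : S ⊆ (Finset.Icc (-(K : ℤ)) K).image (fun k : ℤ => t0 + (k : ZMod P)) := by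
    intro t ht
    obtain ⟨k, hk, e⟩ := h t0 ht0 t ht
    rw [Finset.mem_image]
    rw [abs_le] at hk
    exact ⟨k, Finset.mem_Icc.2 hk, e.symm⟩
  refine (Finset.card_le_card hsub).trans (Finset.card_image_le.trans ?_)
  rw [Int.card_Icc]; omega

lemma eq_of_wedge {w1 w2 w1' w2' : ℤ} (c : IsCoprime w1 w2) (c' : IsCoprime w1' w2')
    (h2 : 1 ≤ w2) (h2' : 1 ≤ w2') (h : w1 * w2' - w2 * w1' = 0) : w1 = w1' ∧ w2 = w2' := by
  have e : w2 ∣ w2' := c.symm.dvd_of_dvd_mul_left ⟨w1', by linarith⟩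
  have e' : w2' ∣ w2 := c'.symm.dvd_of_dvd_mul_left ⟨w1, by linarith⟩
  have : w2 = w2' := Int.dvd_antisymm (by omega) (by omega) e e'
  subst this
  refine ⟨?_, rfl⟩
  apply mul_right_cancel₀ (show w2 ≠ 0 by omega)
  linarith

lemma countA {P : ℕ} [NeZero P] {β : Type} [DecidableEq β] (V : Finset β) (w1 w2 : β → ℤ)
    (H w0 : ℕ) (hw0 : 1 ≤ w0) (W Y : ℤ)
    (hw : ∀ b ∈ V, IsCoprime (w1 b) (w2 b) ∧ (0 ≤ w1 b ∧ w1 b ≤ W) ∧ ((w0 : ℤ) ≤ w2 b ∧ w2 b ≤ W))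
    (hinj : ∀ b ∈ V, ∀ b' ∈ V, w1 b = w1 b' → w2 b = w2 b' → b = b')
    (h1 : W ^ 2 ≤ Y) (h2 : 2 * H * W ≤ Y) (h3 : 2 * H * W < P)
    (Z : Finset (ZMod P)) (hZ : ∀ t ∈ Z, ¬ Maj P Y t) (t : ZMod P) (ht : t ∈ Z)
    [DecidablePred (Qp P H w1 w2 t)] :
    ((V ×ˢ Z ×ˢ V).filter (Qp P H w1 w2 t)).card ≤ V.card * (2 * (H / w0) + 1) := by
  have hsub : (V ×ˢ Z ×ˢ V).filter (Qp P H w1 w2 t) ⊆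
      (V ×ˢ Finset.Icc (-((H / w0 : ℕ) : ℤ)) ((H / w0 : ℕ) : ℤ)).image
        (fun x => (x.1, t - (x.2 : ZMod P), x.1)) := by
    rintro ⟨w, t', w'⟩ hx
    obtain ⟨hx, k1, k2, b1, b2, e1, e2⟩ := Finset.mem_filter.1 hx
    simp only [Finset.mem_product] at hx e1 e2
    obtain ⟨hwV, ht', hwV'⟩ := hx
    obtain ⟨c, p1, p2⟩ := hw w hwV
    obtain ⟨c', p1', p2'⟩ := hw w' hwV'
    have hW0 : 0 ≤ W := p1.1.trans p1.2
    have hb : ∀ v : β, v ∈ V → |k1 * w2 v - k2 * w1 v| ≤ 2 * H * W := by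
      intro v hv
      obtain ⟨-, q1, q2⟩ := hw v hv
      calc |k1 * w2 v - k2 * w1 v| ≤ |k1| * |w2 v| + |k2| * |w1 v| := by
            rw [← abs_mul, ← abs_mul]; exact abs_sub _ _
        _ ≤ H * W + H * W := by
            rw [abs_of_nonneg q1.1, abs_of_nonneg (by omega : 0 ≤ w2 v)]
            exact add_le_add (mul_le_mul b1.le q2.2 (by omega) (by positivity))
              (mul_le_mul b2.le q1.2 q1.1 (by positivity))
        _ = _ := by ring
    set n := w1 w * w2 w' - w2 w * w1 w' with hn
    have hnb : |n| ≤ Y := by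
      have g1 : w1 w * w2 w' ≤ W * W := mul_le_mul p1.2 p2'.2 (by omega) hW0
      have g2 : w2 w * w1 w' ≤ W * W := mul_le_mul p2.2 p1'.2 p1'.1 hW0
      have g3 : 0 ≤ w1 w * w2 w' := mul_nonneg p1.1 (by omega)
      have g4 : 0 ≤ w2 w * w1 w' := mul_nonneg (by omega) p1'.1
      rw [abs_le]; constructor <;> nlinarith
    have hnt : t * (n : ZMod P) = ((k1 * w2 w' - k2 * w1 w' : ℤ) : ZMod P) := by
      rw [hn]; push_cast
      linear_combination (w2 w' : ZMod P) * e1 - (w1 w' : ZMod P) * e2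
    have hn0 : n = 0 := by
      by_contra hne
      rcases lt_or_gt_of_ne hne with hlt | hgt
      · refine hZ t ht ⟨-n, -(k1 * w2 w' - k2 * w1 w'), by omega, ?_, ?_, ?_⟩
        · rw [abs_le] at hnb; omega
        · rw [abs_neg]; exact (hb w' hwV').trans h2
        · push_cast at hnt ⊢; linear_combination -hnt
      · refine hZ t ht ⟨n, (k1 * w2 w' - k2 * w1 w'), by omega, ?_, ?_, hnt⟩
        · rw [abs_le] at hnb; omega
        · exact (hb w' hwV').trans h2
    have hww := eq_of_wedge c c' (by omega) (by omega) (hn ▸ hn0)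
    have hEq := hinj w hwV w' hwV' hww.1 hww.2
    subst hEq
    have hk0 : k1 * w2 w - k2 * w1 w = 0 := by
      refine Int.eq_zero_of_abs_lt_dvd (m := (P : ℤ)) ?_ (lt_of_le_of_lt (hb w hwV) h3)
      rw [← ZMod.intCast_zmod_eq_zero_iff_dvd]; push_cast
      linear_combination (w1 w : ZMod P) * e2 - (w2 w : ZMod P) * e1
    obtain ⟨k, f1, f2⟩ := mul_pair c (sub_eq_zero.1 hk0)
    have hs : t - t' = (k : ZMod P) := by
      apply zmod_cancel c
      · rw [f1] at e1; push_cast at e1; linear_combination e1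
      · rw [f2] at e2; push_cast at e2; linear_combination e2
    have hkb : |k| ≤ ((H / w0 : ℕ) : ℤ) := by
      rw [f2, abs_mul, abs_of_nonneg (by omega : 0 ≤ w2 w)] at b2
      push_cast
      apply (Int.le_ediv_iff_mul_le (by omega)).2
      have := mul_le_mul_of_nonneg_left p2.1 (abs_nonneg k)
      omega
    rw [Finset.mem_image]
    rw [abs_le] at hkb
    refine ⟨(w, k), Finset.mem_product.2 ⟨hwV, Finset.mem_Icc.2 hkb⟩, ?_⟩
    simp only [← hs]
    congr 2
    ring
  refine (Finset.card_le_card hsub).trans (Finset.card_image_le.trans ?_)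
  rw [Finset.card_product, Int.card_Icc]
  apply Nat.mul_le_mul_left
  omega

/-- pairs step of the second regime -/
lemma countB {P : ℕ} [NeZero P] {β : Type} [DecidableEq β] (V : Finset β) (w1 w2 : β → ℤ)
    (H w0 : ℕ) (hw0 : 1 ≤ w0) (W Y : ℤ) (hW : 0 ≤ W)
    (hw : ∀ b ∈ V, IsCoprime (w1 b) (w2 b) ∧ (0 ≤ w1 b ∧ w1 b ≤ W) ∧ ((w0 : ℤ) ≤ w2 b ∧ w2 b ≤ W))
    (hsz : Y ^ 2 * (H + 2 * W) < P)
    (Z : Finset (ZMod P)) (hZ : ∀ t ∈ Z, Maj P Y t) (t : ZMod P) {T q a r : ℤ}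
    (hR : MRep P Y t T q a r) [DecidablePred (Qp P H w1 w2 t)] :
    ((V ×ˢ Z ×ˢ V).filter (Qp P H w1 w2 t)).card ≤ (2 * (2 * H / w0) + 1) *
      ((V ×ˢ V).filter (fun x => q ∣ w1 x.1 * w2 x.2 - w2 x.1 * w1 x.2 ∧
        |r| * |w1 x.1 * w2 x.2 - w2 x.1 * w1 x.2| ≤ q * (2 * H * W))).card := by
  set s := (V ×ˢ Z ×ˢ V).filter (Qp P H w1 w2 t) with hs
  set f : β × ZMod P × β → β × β := fun x => (x.1, x.2.2) with hf
  have hfib : ∀ p ∈ s.image f, (s.filter (fun x => f x = p)).card ≤ 2 * (2 * H / w0) + 1 := by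
    intro p _
    have : (s.filter (fun x => f x = p)).card =
        ((s.filter (fun x => f x = p)).image (fun x => x.2.1)).card := by
      rw [Finset.card_image_of_injOn]
      rintro ⟨w, t', w'⟩ hx ⟨v, s', v'⟩ hy h
      have hx2 := (Finset.mem_filter.1 (Finset.mem_coe.1 hx)).2
      have hy2 := (Finset.mem_filter.1 (Finset.mem_coe.1 hy)).2
      simp only [hf] at hx2 hy2 h
      rw [← hy2] at hx2
      simp only [Prod.mk.injEq] at hx2
      rw [hx2.1, hx2.2, h]
    rw [this]
    apply card_shift
    intro t' ht' t'' ht''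
    obtain ⟨⟨w, t1, w'⟩, hx, rfl⟩ := Finset.mem_image.1 ht'
    obtain ⟨⟨v, t2, v'⟩, hy, rfl⟩ := Finset.mem_image.1 ht''
    obtain ⟨hx, hx2⟩ := Finset.mem_filter.1 hx
    obtain ⟨hy, hy2⟩ := Finset.mem_filter.1 hy
    simp only [hf] at hx2 hy2 ⊢
    rw [← hx2] at hy2
    simp only [Prod.mk.injEq] at hy2
    obtain ⟨rfl, rfl⟩ := hy2
    obtain ⟨hx, k1, k2, b1, b2, e1, e2⟩ := Finset.mem_filter.1 hx
    obtain ⟨hy, l1, l2, d1, d2, g1, g2⟩ := Finset.mem_filter.1 hy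
    simp only [Finset.mem_product] at hx hy e1 e2 g1 g2
    obtain ⟨c, p1, p2⟩ := hw v hx.1
    obtain ⟨c', p1', p2'⟩ := hw v' hx.2.2
    obtain ⟨T1, q1, a1, r1, R1⟩ := (hZ t1 hx.2.1).rep
    obtain ⟨T2, q2, a2, r2, R2⟩ := (hZ t2 hy.2.1).rep
    obtain ⟨m1, -, m2, m3, -⟩ := pairB hW hsz hR R1 c c' p1 ⟨by omega, p2.2⟩ p1' ⟨by omega, p2'.2⟩ b1 b2 e1 e2
    obtain ⟨n1, -, n2, n3, -⟩ := pairB hW hsz hR R2 c c' p1 ⟨by omega, p2.2⟩ p1' ⟨by omega, p2'.2⟩ d1 d2 g1 g2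
    have hq1 : 1 ≤ q := hR.2.2.1
    have hd : q ∣ r2 - r1 := by
      apply dvd_of_two c'
      · exact ⟨k1 - l1, by linear_combination m2 - n2⟩
      · exact ⟨k2 - l2, by linear_combination m3 - n3⟩
    obtain ⟨k, hk⟩ := hd
    have hk1 : k1 - l1 = k * w1 v' := by
      apply mul_left_cancel₀ (show q ≠ 0 by omega)
      linear_combination (-1) * m2 + n2 + w1 v' * hk
    have hk2 : k2 - l2 = k * w2 v' := by
      apply mul_left_cancel₀ (show q ≠ 0 by omega)
      linear_combination (-1) * m3 + n3 + w2 v' * hk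
    refine ⟨k, ?_, ?_⟩
    · push_cast
      apply (Int.le_ediv_iff_mul_le (by omega)).2
      have h1 := mul_le_mul_of_nonneg_left p2'.1 (abs_nonneg k)
      have h2 : |k| * w2 v' = |k2 - l2| := by
        rw [hk2, abs_mul, abs_of_nonneg (by omega : 0 ≤ w2 v')]
      have h3 := abs_sub k2 l2
      omega
    · have : t2 - t1 = (k : ZMod P) := by
        apply zmod_cancel c'
        · have := congrArg (fun z : ℤ => (z : ZMod P)) hk1
          push_cast at this
          linear_combination this + e1 - g1
        · have := congrArg (fun z : ℤ => (z : ZMod P)) hk2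
          push_cast at this
          linear_combination this + e2 - g2
      rw [← this]; ring
  refine (Finset.card_le_mul_card_image s _ hfib).trans ?_
  apply Nat.mul_le_mul_left
  apply Finset.card_le_card
  intro p hp
  obtain ⟨⟨w, t', w'⟩, hx, rfl⟩ := Finset.mem_image.1 hp
  obtain ⟨hx, k1, k2, b1, b2, e1, e2⟩ := Finset.mem_filter.1 hx
  simp only [Finset.mem_product] at hx e1 e2
  obtain ⟨c, p1, p2⟩ := hw w hx.1
  obtain ⟨c', p1', p2'⟩ := hw w' hx.2.2
  obtain ⟨T1, q1, a1, r1, R1⟩ := (hZ t' hx.2.1).rep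
  obtain ⟨-, m2, -, -, m3⟩ := pairB hW hsz hR R1 c c' p1 ⟨by omega, p2.2⟩ p1' ⟨by omega, p2'.2⟩ b1 b2 e1 e2
  exact Finset.mem_filter.2 ⟨Finset.mem_product.2 ⟨hx.1, hx.2.2⟩, m2, m3⟩

open Classical in
/-- concatenation of two sets of words -/
noncomputable def cat (X Y : Finset (List ℕ)) : Finset (List ℕ) := Finset.image₂ (· ++ ·) X Y

lemma mem_cat {X Y : Finset (List ℕ)} {l : List ℕ} :
    l ∈ cat X Y ↔ ∃ a ∈ X, ∃ b ∈ Y, a ++ b = l := by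
  simp [cat, Finset.mem_image₂]

lemma regimeA (P : ℕ) [NeZero P] (U V : Finset (List ℕ)) (nu nv : ℕ)
    (hU : ∀ a ∈ U, Pos a ∧ a.length = nu) (hV : ∀ a ∈ V, Pos a ∧ a.length = nv)
    (M W Y : ℤ) (H w0 : ℕ) (hw0 : 1 ≤ w0) (hM : 1 ≤ M) (hH : 1 ≤ H) (hHM : 6 * H * M ≤ P)
    (hUM : ∀ a ∈ U, cD a ≤ M) (hVW : ∀ b ∈ V, (w0 : ℤ) ≤ cD b ∧ cD b ≤ W)
    (h1 : W ^ 2 ≤ Y) (h2 : 2 * H * W ≤ Y) (h3 : 2 * H * W < P)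
    (Z : Finset (ZMod P)) (hZ : ∀ t ∈ Z, ¬ Maj P Y t) :
    ∑ t ∈ Z, ‖∑ a ∈ U, ∑ b ∈ V, ZMod.stdAddChar (t * (cC a * cB b + cD a * cD b) : ZMod P)‖ ^ 2 ≤
      16 * (P : ℝ) ^ 2 / (H : ℝ) ^ 2 * U.card * (V.card * (2 * (H / w0 : ℕ) + 1)) := by
  classical
  refine bilinear P U V cC cD cB cD M hM H hH hHM ?_ ?_ Z _ (Qp P H cB cD) ?_ (by positivity) ?_
  · intro a ha
    have := wpos a (hU a ha).1
    have := hUM a ha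
    omega
  · intro a ha b hb e1 e2
    exact inj_U a b (hU a ha).1 (hU b hb).1 ((hU a ha).2.trans (hU b hb).2.symm) e1 e2
  · intro t _ w _ t' _ w' _ k1 k2 a1 a2 e1 e2
    exact ⟨k1, k2, a1, a2, e1, e2⟩
  · intro t ht
    have := countA V cB cD H w0 hw0 W Y (fun b hb => by
      have := wpos b (hV b hb).1
      have := hVW b hb
      exact ⟨cop_BD b, by omega, by omega⟩) (fun b hb b' hb' e1 e2 =>
        inj_W b b' (hV b hb).1 (hV b' hb').1 ((hV b hb).2.trans (hV b' hb').2.symm) e1 e2)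
      h1 h2 h3 Z hZ t ht
    exact_mod_cast this

lemma pair_count : ∃ C : ℝ, 1 ≤ C ∧ ∀ (Ξ V4 : Finset (List ℕ)) (n X : ℕ), 1 ≤ X →
    (∀ g ∈ Ξ, Pos g ∧ g.length = n) → 2 ≤ n → (∀ g ∈ Ξ, cD g ≤ X) → (∀ v ∈ V4, Pos v) →
    ∀ (w0 y0 q r B Y' : ℤ), 1 ≤ w0 → 1 ≤ y0 → (∀ v ∈ V4, y0 ≤ cD v) →
    (∀ b ∈ cat Ξ V4, w0 ≤ cD b) → 1 ≤ q → 0 ≤ Y' → (Y' < q ∨ Y' < |r|) → 24 * (X : ℤ) ^ 4 ≤ Y' →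
    24 * (X : ℤ) ^ 3 * B ≤ Y' * (y0 * w0) →
    ((((cat Ξ V4) ×ˢ (cat Ξ V4)).filter (fun x => q ∣ cB x.1 * cD x.2 - cD x.1 * cB x.2 ∧
        |r| * |cB x.1 * cD x.2 - cD x.1 * cB x.2| ≤ q * B)).card : ℝ) ≤
      (cat Ξ V4).card * V4.card * (C * (X : ℝ) ^ (1.1 : ℝ)) := by
  classical
  obtain ⟨C, hC, h⟩ := nc_count
  refine ⟨C, hC, ?_⟩
  intro Ξ V4 n X hX hΞ hn hΞX hV4 w0 y0 q r B Y' hw0 hy0 hyV hwV hq hY' hqr hs1 hs2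
  set V := cat Ξ V4 with hV
  set Gd : List ℕ → List ℕ → Finset (List ℕ) := fun w' v => Ξ.filter (fun g =>
    q ∣ cB (g ++ v) * cD w' - cD (g ++ v) * cB w' ∧
        |r| * |cB (g ++ v) * cD w' - cD (g ++ v) * cB w'| ≤ q * B) with hG
  have hcard : ∀ w' ∈ V, ∀ v ∈ V4, ((Gd w' v).card : ℝ) ≤ C * (X : ℝ) ^ (1.1 : ℝ) := by
    intro w' hw' v hv
    set f : List ℕ → (Fin 4 → ℤ) := fun g => ![cA g, cB g, cC g, cD g] with hf
    have hinj : Set.InjOn f (Gd w' v : Set (List ℕ)) := by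
      intro a ha b hb e
      have ha' := (Finset.mem_filter.1 (Finset.mem_coe.1 ha)).1
      have hb' := (Finset.mem_filter.1 (Finset.mem_coe.1 hb)).1
      have e1 := congrFun e 1
      have e3 := congrFun e 3
      simp [hf] at e1 e3
      exact inj_W a b (hΞ a ha').1 (hΞ b hb').1 ((hΞ a ha').2.trans (hΞ b hb').2.symm) e1 e3
    rw [← Finset.card_image_of_injOn hinj]
    have key : ∀ g : List ℕ, (f g 0 * cB v + f g 1 * cD v) * cD w' - (f g 2 * cB v + f g 3 * cD v) * cB w'
        = cB (g ++ v) * cD w' - cD (g ++ v) * cB w' := by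
      intro g; simp [hf, cB_append, cD_append]
    refine h X hX ((-1) ^ n) ?_ _ ?_ (cB v) (cD v) (cB w') (cD w') q r B (cop_BD v) (cop_BD w') hq ?_ ?_ ?_
    · rw [← mul_pow]; simp
    · intro g hg
      obtain ⟨g, hg2, rfl⟩ := Finset.mem_image.1 hg
      have hg' := (Finset.mem_filter.1 hg2).1
      obtain ⟨p1, p2⟩ := hΞ g hg'
      have hne : g ≠ [] := by rintro rfl; simp at p2; omega
      have := cA_pos g p1 (by omega)
      have := cB_pos g p1 hne
      have := cC_pos g p1 hne
      have := wpos g p1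
      have := hΞX g hg'
      refine ⟨?_, ?_⟩
      · intro i
        fin_cases i <;> simp [hf] <;> omega
      · simp only [hf]; simp; rw [← p2, ← wdet g]
    · intro g hg
      obtain ⟨g, hg2, rfl⟩ := Finset.mem_image.1 hg
      rw [key]; exact (Finset.mem_filter.1 hg2).2.1
    · intro g hg
      obtain ⟨g, hg2, rfl⟩ := Finset.mem_image.1 hg
      rw [key]; exact (Finset.mem_filter.1 hg2).2.2
    · rcases hqr with h1 | h1
      · left; omega
      · right
        have a1 := hyV v hv
        have a2 := hwV w' hw'
        have a3 : y0 * w0 ≤ cD v * cD w' := mul_le_mul a1 a2 (by omega) (by omega)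
        have a4 : 1 ≤ y0 * w0 := by nlinarith
        rw [abs_of_nonneg (by linarith : 0 ≤ cD v * cD w')]
        calc _ ≤ Y' * (y0 * w0) := hs2
          _ < |r| * (y0 * w0) := by apply mul_lt_mul_of_pos_right h1; linarith
          _ ≤ _ := mul_le_mul_of_nonneg_left a3 (abs_nonneg r)
  have hsub : (V ×ˢ V).filter (fun x => q ∣ cB x.1 * cD x.2 - cD x.1 * cB x.2 ∧
        |r| * |cB x.1 * cD x.2 - cD x.1 * cB x.2| ≤ q * B) ⊆
      (V ×ˢ V4).biUnion (fun p => (Gd p.1 p.2).image (fun g => (g ++ p.2, p.1))) := by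
    rintro ⟨a, w'⟩ hx
    obtain ⟨hx, h1, h2⟩ := Finset.mem_filter.1 hx
    obtain ⟨ha, hw'⟩ := Finset.mem_product.1 hx
    obtain ⟨g, hg, v, hv, rfl⟩ := mem_cat.1 ha
    rw [Finset.mem_biUnion]
    refine ⟨(w', v), Finset.mem_product.2 ⟨hw', hv⟩, Finset.mem_image.2 ⟨g, ?_, rfl⟩⟩
    exact Finset.mem_filter.2 ⟨hg, h1, h2⟩
  have h1 := (Finset.card_le_card hsub).trans Finset.card_biUnion_le
  have h2 : ((∑ p ∈ V ×ˢ V4, ((Gd p.1 p.2).image (fun g => (g ++ p.2, p.1))).card : ℕ) : ℝ) ≤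
      ∑ p ∈ V ×ˢ V4, C * (X : ℝ) ^ (1.1 : ℝ) := by
    push_cast
    apply Finset.sum_le_sum
    rintro ⟨w', v⟩ hp
    obtain ⟨hw', hv⟩ := Finset.mem_product.1 hp
    refine le_trans ?_ (hcard w' hw' v hv)
    exact_mod_cast Finset.card_image_le
  rw [Finset.sum_const, Finset.card_product, nsmul_eq_mul] at h2
  push_cast at h2
  refine le_trans ?_ h2
  exact_mod_cast h1

lemma regimeB : ∃ C : ℝ, 1 ≤ C ∧ ∀ (P : ℕ) [NeZero P] (U Ξ V4 : Finset (List ℕ)) (nu n nv X : ℕ),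
    1 ≤ X → (∀ a ∈ U, Pos a ∧ a.length = nu) →
    (∀ g ∈ Ξ, Pos g ∧ g.length = n) → 2 ≤ n → (∀ g ∈ Ξ, cD g ≤ X) → (∀ v ∈ V4, Pos v ∧ v.length = nv) →
    ∀ (M W Y Y' y0 : ℤ) (H w0 : ℕ), 1 ≤ w0 → 1 ≤ M → 0 ≤ W → 1 ≤ H → 6 * H * M ≤ P →
    (∀ a ∈ U, cD a ≤ M) → (∀ b ∈ cat Ξ V4, (w0 : ℤ) ≤ cD b ∧ cD b ≤ W) →
    1 ≤ y0 → (∀ v ∈ V4, y0 ≤ cD v) → Y ^ 2 * (H + 2 * W) < P → 24 * (X : ℤ) ^ 4 ≤ Y' →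
    24 * (X : ℤ) ^ 3 * (2 * H * W) ≤ Y' * (y0 * w0) →
    ∀ (Z : Finset (ZMod P)), (∀ t ∈ Z, Maj P Y t ∧ ¬ Maj P Y' t) →
    ∑ t ∈ Z, ‖∑ a ∈ U, ∑ b ∈ cat Ξ V4,
        ZMod.stdAddChar (t * (cC a * cB b + cD a * cD b) : ZMod P)‖ ^ 2 ≤
      16 * (P : ℝ) ^ 2 / (H : ℝ) ^ 2 * U.card *
        ((2 * (2 * H / w0 : ℕ) + 1) * ((cat Ξ V4).card * V4.card * (C * (X : ℝ) ^ (1.1 : ℝ)))) := by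
  classical
  obtain ⟨C, hC, h⟩ := pair_count
  refine ⟨C, hC, ?_⟩
  intro P _ U Ξ V4 nu n nv X hX hU hΞ hn hΞX hV4 M W Y Y' y0 H w0 hw0 hM hW hH hHM hUM hVW hy0 hyV
    hsz hs1 hs2 Z hZ
  have hVp : ∀ b ∈ cat Ξ V4, Pos b := by
    intro b hb
    obtain ⟨g, hg, v, hv, rfl⟩ := mem_cat.1 hb
    exact (hΞ g hg).1.append (hV4 v hv).1
  refine bilinear P U _ cC cD cB cD M hM H hH hHM ?_ ?_ Z _ (Qp P H cB cD) ?_ (by positivity) ?_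
  · intro a ha
    have := wpos a (hU a ha).1
    have := hUM a ha
    omega
  · intro a ha b hb e1 e2
    exact inj_U a b (hU a ha).1 (hU b hb).1 ((hU a ha).2.trans (hU b hb).2.symm) e1 e2
  · intro t _ w _ t' _ w' _ k1 k2 a1 a2 e1 e2
    exact ⟨k1, k2, a1, a2, e1, e2⟩
  · intro t ht
    obtain ⟨T, q, a, r, hR⟩ := (hZ t ht).1.rep
    have hB := countB (cat Ξ V4) cB cD H w0 hw0 W Y hW (fun b hb => by
      have := wpos b (hVp b hb)
      have := hVW b hb
      exact ⟨cop_BD b, by omega, by omega⟩) hsz Z (fun t ht => (hZ t ht).1) t hR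
    have hB' := h Ξ V4 n X hX hΞ hn hΞX (fun v hv => (hV4 v hv).1) w0 y0 q r (2 * H * W) Y'
      (by exact_mod_cast hw0) hy0 hyV (fun b hb => (hVW b hb).1) hR.2.2.1
      (by have : (0 : ℤ) ≤ 24 * (X : ℤ) ^ 4 := by positivity
          omega) (hR.not_maj (hZ t ht).2) hs1 hs2
    have hB2 : ((((cat Ξ V4) ×ˢ Z ×ˢ (cat Ξ V4)).filter (Qp P H cB cD t)).card : ℝ) ≤
      ((2 * (2 * H / w0) + 1 : ℕ) : ℝ) * (((((cat Ξ V4) ×ˢ (cat Ξ V4)).filter (fun x => q ∣ cB x.1 * cD x.2 - cD x.1 * cB x.2 ∧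
        |r| * |cB x.1 * cD x.2 - cD x.1 * cB x.2| ≤ q * (2 * H * W))).card : ℕ) : ℝ) := by
      exact_mod_cast hB
    refine hB2.trans ?_
    have := mul_le_mul_of_nonneg_left hB' (Nat.cast_nonneg (α := ℝ) (2 * (2 * H / w0) + 1))
    refine this.trans (le_of_eq ?_)
    push_cast; ring

open Classical in
/-- words of given length over an alphabet -/
noncomputable def wordsN (A : Finset ℕ) : ℕ → Finset (List ℕ)
  | 0 => {[]}
  | n + 1 => Finset.image₂ (fun a l => a :: l) A (wordsN A n)

lemma mem_wordsN (A : Finset ℕ) (l : List ℕ) (h : ∀ a ∈ l, a ∈ A) : l ∈ wordsN A l.length := by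
  induction l with
  | nil => simp [wordsN]
  | cons a l ih =>
    simp only [List.length_cons, wordsN, Finset.mem_image₂]
    exact ⟨a, h a (by simp), l, ih (fun b hb => h b (by simp [hb])), rfl⟩

lemma wordsN_mem (A : Finset ℕ) (n : ℕ) : ∀ l ∈ wordsN A n, ∀ a ∈ l, a ∈ A := by
  induction n with
  | zero => simp [wordsN]
  | succ n ih =>
    intro l hl
    simp only [wordsN, Finset.mem_image₂] at hl
    obtain ⟨a, ha, l, hl, rfl⟩ := hl
    intro b hb
    rcases List.mem_cons.1 hb with rfl | hb
    · exact ha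
    · exact ih l hl b hb

lemma len_lt (l : List ℕ) (h : Pos l) : (l.length : ℤ) < 2 * cD l + 2 := by
  have h1 := cD_len l.length l h rfl
  have h2 : ((l.length / 2 : ℕ) : ℤ) < 2 ^ (l.length / 2) := by exact_mod_cast Nat.lt_two_pow_self
  omega

open Classical in
noncomputable def Vf (A : Finset ℕ) (R : ℕ) (Y : ℝ) : Finset (List ℕ) :=
  ((Finset.range (⌊2 * Y + 2⌋₊ + 1)).biUnion (wordsN A)).filter
    (fun v => v ≠ [] ∧ Y < (R + 1) * (cD v : ℝ) ∧ (cD v : ℝ) ≤ Y)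

lemma mem_Vf (A : Finset ℕ) (hA : ∀ a ∈ A, 0 < a) (R : ℕ) (Y : ℝ) (v : List ℕ) : v ∈ Vf A R Y ↔
    (∀ a ∈ v, a ∈ A) ∧ v ≠ [] ∧ Y < (R + 1) * (cD v : ℝ) ∧ (cD v : ℝ) ≤ Y := by
  classical
  simp only [Vf, Finset.mem_filter, Finset.mem_biUnion, Finset.mem_range]
  constructor
  · rintro ⟨⟨n, _, h⟩, h'⟩
    exact ⟨wordsN_mem A n v h, h'⟩
  · rintro ⟨h, h'⟩
    refine ⟨⟨v.length, ?_, mem_wordsN A v h⟩, h'⟩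
    have h1 := len_lt v (fun a ha => hA a (h a ha))
    have h2 : ((v.length : ℤ) : ℝ) < ((2 * cD v + 2 : ℤ) : ℝ) := by exact_mod_cast h1
    push_cast at h2
    have : v.length ≤ ⌊2 * Y + 2⌋₊ := by
      apply Nat.le_floor
      linarith [h'.2.2]
    omega

lemma cfVal_diff (v l : List ℕ) (hv : Pos v) (hl : Pos l) :
    |((cfVal (v ++ l) : ℚ) : ℝ) - ((cfVal v : ℚ) : ℝ)| ≤ 1 / (cD v : ℝ) ^ 2 := by
  rw [cfVal_eq _ (hv.append hl), cfVal_eq v hv]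
  push_cast
  obtain ⟨a0, b0, c0, d1, -⟩ := wpos v hv
  obtain ⟨a0', b0', c0', d1', bd', -⟩ := wpos l hl
  have w := wdet v
  have hD1 : (1 : ℝ) ≤ cD v := by exact_mod_cast d1
  have hd1 : (1 : ℝ) ≤ cD l := by exact_mod_cast d1'
  have hC0 : (0 : ℝ) ≤ cC v := by exact_mod_cast c0
  have hb0 : (0 : ℝ) ≤ cB l := by exact_mod_cast b0'
  have hbd : (cB l : ℝ) ≤ cD l := by exact_mod_cast bd'
  have w' : (cA v : ℝ) * cD v - cB v * cC v = (-1) ^ v.length := by exact_mod_cast w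
  rw [cB_append, cD_append]; push_cast
  have hpos : 0 < (cC v : ℝ) * cB l + cD v * cD l := by
    have := mul_nonneg hC0 hb0
    nlinarith
  have e : ((cA v : ℝ) * cB l + cB v * cD l) / (cC v * cB l + cD v * cD l) - cB v / cD v
      = (-1) ^ v.length * cB l / ((cC v * cB l + cD v * cD l) * cD v) := by
    rw [← w']; field_simp; ring
  rw [e, abs_div, abs_mul, abs_pow]
  simp only [abs_neg, abs_one, one_pow, one_mul]
  rw [abs_of_nonneg hb0, abs_of_pos (by positivity), div_le_div_iff₀ (by positivity) (by positivity)]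
  have h1 : cB l * (cD v:ℝ) ≤ cC v * cB l + cD v * cD l := by
    have := mul_nonneg hC0 hb0
    nlinarith
  nlinarith

lemma cover (A : Finset ℕ) (hA : ∀ a ∈ A, 0 < a) (R : ℕ) (hR : ∀ a ∈ A, a ≤ R) (Y : ℝ)
    (hY : (R : ℝ) ≤ Y) : cantorCF (A : Set ℕ) ⊆ ⋃ v : Vf A R Y,
      Set.Icc (((cfVal v.1 : ℚ) : ℝ) - (R + 1) ^ 2 / Y ^ 2) (((cfVal v.1 : ℚ) : ℝ) + (R + 1) ^ 2 / Y ^ 2) := by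
  rintro x ⟨-, -, -, a, ha, hx⟩
  set pre : ℕ → List ℕ := fun k => List.ofFn fun i : Fin k => a i with hpre
  have hsucc : ∀ k, pre (k + 1) = pre k ++ [a k] := by
    intro k; simp only [hpre]; rw [List.ofFn_succ_last]; simp
  have hmem : ∀ k, ∀ b ∈ pre k, b ∈ A := by
    intro k b hb
    simp only [hpre, List.mem_ofFn] at hb
    obtain ⟨i, rfl⟩ := hb
    exact ha i
  have hPos : ∀ k, Pos (pre k) := fun k b hb => hA b (hmem k b hb)
  have hlen : ∀ k, (pre k).length = k := by intro k; simp [hpre]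
  have hex : ∃ k, Y < cD (pre (k + 1)) := by
    obtain ⟨n, hn⟩ := exists_nat_gt (2 * Y + 2)
    refine ⟨n, ?_⟩
    have h1 := len_lt (pre (n + 1)) (hPos _)
    rw [hlen] at h1
    have h2 : (((n + 1 : ℕ) : ℤ) : ℝ) < ((2 * cD (pre (n + 1)) + 2 : ℤ) : ℝ) := by exact_mod_cast h1
    push_cast at h2
    linarith
  classical
  set p := Nat.find hex with hp
  have h1 : Y < cD (pre (p + 1)) := Nat.find_spec hex
  have hp0 : p ≠ 0 := by
    intro h0
    rw [h0] at h1
    have : cD (pre (0 + 1)) = a 0 := by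
      rw [hsucc]; simp [hpre, cD_cons, cB_nil, cD_nil]
    rw [this] at h1
    have : (a 0 : ℝ) ≤ R := by exact_mod_cast hR _ (ha 0)
    push_cast at h1
    linarith
  have h2 : (cD (pre p) : ℝ) ≤ Y := by
    have := Nat.find_min hex (m := p - 1) (by omega)
    rw [not_lt, Nat.sub_add_cancel (by omega)] at this
    exact this
  have h3 : cD (pre (p + 1)) ≤ (R + 1) * cD (pre p) := by
    rw [hsucc, cD_append]
    simp only [cD_cons, cB_cons, cB_nil, cD_nil]
    have := wpos (pre p) (hPos p)
    have h4 : (a p : ℤ) ≤ R := by exact_mod_cast hR _ (ha p)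
    nlinarith
  have h3' : (cD (pre (p + 1)) : ℝ) ≤ (R + 1) * cD (pre p) := by exact_mod_cast h3
  have hV : pre p ∈ Vf A R Y := by
    rw [mem_Vf A hA]
    refine ⟨hmem p, ?_, by linarith, h2⟩
    intro h0
    have := hlen p
    rw [h0] at this; simp at this; omega
  have hD1 : (1 : ℝ) ≤ cD (pre p) := by exact_mod_cast (wpos (pre p) (hPos p)).2.2.2.1
  have hY1 : 1 ≤ Y := by linarith
  rw [Set.mem_iUnion]
  refine ⟨⟨pre p, hV⟩, ?_⟩
  refine isClosed_Icc.mem_of_tendsto hx ?_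
  filter_upwards [eventually_ge_atTop p] with n hn
  have hl : ∃ l, Pos l ∧ pre n = pre p ++ l := by
    induction n, hn using Nat.le_induction with
    | base => exact ⟨[], by intro a ha; simp at ha, by simp⟩
    | succ n hn ih =>
      obtain ⟨l, hl, e⟩ := ih
      refine ⟨l ++ [a n], hl.append ?_, ?_⟩
      · intro b hb; simp at hb; subst hb; exact hA _ (ha n)
      · rw [hsucc, e, List.append_assoc]
  obtain ⟨l, hl, e⟩ := hl
  have h4 := cfVal_diff (pre p) l (hPos p) hl
  rw [← e] at h4
  have h5 : 1 / (cD (pre p) : ℝ) ^ 2 ≤ (R + 1) ^ 2 / Y ^ 2 := by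
    rw [div_le_div_iff₀ (by positivity) (by positivity), one_mul, ← mul_pow]
    apply pow_le_pow_left₀ (by linarith); linarith
  have h6 := abs_le.1 (h4.trans h5)
  constructor
  · simp only [hpre] at h6 ⊢; linarith [h6.1]
  · simp only [hpre] at h6 ⊢; linarith [h6.2]

lemma dim_count (A : Finset ℕ) (hA : ∀ a ∈ A, 0 < a) (R : ℕ) (hR : ∀ a ∈ A, a ≤ R) (s : ℝ)
    (hs : 0 < s) (hd : s < hdim (A : Set ℕ)) :
    ∃ Y0 : ℝ, 1 ≤ Y0 ∧ ∀ Y : ℝ, Y0 ≤ Y → Y ^ (2 * s) ≤ (Vf A R Y).card := by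
  by_contra! hcon
  have hch : ∀ n : ℕ, ∃ Y : ℝ, (R : ℝ) + 1 + n ≤ Y ∧ ((Vf A R Y).card : ℝ) < Y ^ (2 * s) :=
    fun n => hcon _ (by have : (0:ℝ) ≤ R := by positivity
                        have : (0:ℝ) ≤ n := by positivity
                        linarith)
  choose Y hY1 hY2 using hch
  have hYpos : ∀ n, 0 < Y n := fun n => by
    have : (0:ℝ) ≤ R := by positivity
    have : (0:ℝ) ≤ n := by positivity
    linarith [hY1 n]
  have hYt : Tendsto Y atTop atTop := by
    apply tendsto_atTop_mono (f := fun n : ℕ => (n : ℝ)) _ tendsto_natCast_atTop_atTop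
    intro n
    have : (0:ℝ) ≤ R := by positivity
    linarith [hY1 n]
  have hm := MeasureTheory.Measure.hausdorffMeasure_le_liminf_sum (ι := fun n => Vf A R (Y n)) s
    (cantorCF (A : Set ℕ)) (l := atTop)
    (fun n => ENNReal.ofReal (2 * ((R + 1) ^ 2 / Y n ^ 2))) ?_
    (fun n v => Set.Icc (((cfVal v.1 : ℚ) : ℝ) - (R + 1) ^ 2 / Y n ^ 2)
      (((cfVal v.1 : ℚ) : ℝ) + (R + 1) ^ 2 / Y n ^ 2)) ?_ ?_
  · have hb : MeasureTheory.Measure.hausdorffMeasure s (cantorCF (A : Set ℕ)) ≤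
        ENNReal.ofReal ((2 * (R + 1) ^ 2) ^ s) := by
      refine hm.trans (liminf_le_of_frequently_le' (Eventually.frequently (Eventually.of_forall ?_)))
      intro n
      calc _ ≤ ∑ i : Vf A R (Y n), ENNReal.ofReal (2 * ((R + 1) ^ 2 / Y n ^ 2)) ^ s := by
            apply Finset.sum_le_sum
            intro i _
            apply ENNReal.rpow_le_rpow _ hs.le
            rw [Real.ediam_Icc]
            apply ENNReal.ofReal_le_ofReal
            linarith
        _ = ENNReal.ofReal ((Vf A R (Y n)).card * (2 * ((R + 1) ^ 2 / Y n ^ 2)) ^ s) := by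
            rw [Finset.sum_const, nsmul_eq_mul,
              ENNReal.ofReal_rpow_of_nonneg (by positivity) hs.le, ENNReal.ofReal_mul (by positivity)]
            simp
        _ ≤ _ := by
            apply ENNReal.ofReal_le_ofReal
            have e : (2 * (((R:ℝ) + 1) ^ 2 / Y n ^ 2)) ^ s = (2 * (R + 1) ^ 2) ^ s / Y n ^ (2 * s) := by
              rw [← mul_div_assoc, Real.div_rpow (by positivity) (by positivity),
                Real.rpow_mul (hYpos n).le]
              norm_num
            rw [e]
            have hp : 0 < Y n ^ (2 * s) := Real.rpow_pos_of_pos (hYpos n) _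
            rw [mul_div_assoc', div_le_iff₀ hp, mul_comm]
            exact mul_le_mul_of_nonneg_left (hY2 n).le (by positivity)
    have hne : MeasureTheory.Measure.hausdorffMeasure ((⟨s, hs.le⟩ : NNReal) : ℝ) (cantorCF (A : Set ℕ)) ≠ ⊤ :=
      (lt_of_le_of_lt hb ENNReal.ofReal_lt_top).ne
    have hle := dimH_le_of_hausdorffMeasure_ne_top hne
    have : hdim (A : Set ℕ) ≤ s := by
      have := ENNReal.toReal_mono ENNReal.coe_ne_top hle
      exact this
    linarith
  · have h1 : Tendsto (fun n => 2 * (((R:ℝ) + 1) ^ 2 / Y n ^ 2)) atTop (nhds (2 * 0)) := by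
      apply Tendsto.const_mul
      apply Tendsto.const_div_atTop
      exact (tendsto_pow_atTop (by norm_num)).comp hYt
    have h2 := ENNReal.tendsto_ofReal h1
    simpa using h2
  · refine Eventually.of_forall fun n i => ?_
    rw [Real.ediam_Icc]
    apply ENNReal.ofReal_le_ofReal
    linarith
  · refine Eventually.of_forall fun n => ?_
    have : (0:ℝ) ≤ n := by positivity
    exact cover A hA R hR (Y n) (by linarith [hY1 n])

/-- perturbed denominator -/
noncomputable def Dr (ρ : ℝ) (l : List ℕ) : ℝ := cD l + ρ * cC l
/-- perturbed numerator -/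
noncomputable def Nr (ρ : ℝ) (l : List ℕ) : ℝ := cB l + ρ * cA l

lemma Dr_cons (ρ : ℝ) (a : ℕ) (l : List ℕ) : Dr ρ (a :: l) = Nr ρ l + a * Dr ρ l := by
  simp only [Dr, Nr, cD_cons, cC_cons]; push_cast; ring
lemma Nr_cons (ρ : ℝ) (a : ℕ) (l : List ℕ) : Nr ρ (a :: l) = Dr ρ l := by
  simp only [Dr, Nr, cB_cons, cA_cons]

lemma Dr_append (ρ : ℝ) (a b : List ℕ) : Dr ρ (a ++ b) = cC a * Nr ρ b + cD a * Dr ρ b := by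
  simp only [Dr, Nr, cD_append, cC_append]; push_cast; ring

lemma wposR (l : List ℕ) (h : Pos l) : (0:ℝ) ≤ cA l ∧ (0:ℝ) ≤ cB l ∧ (0:ℝ) ≤ cC l ∧ (1:ℝ) ≤ cD l ∧
    (cC l : ℝ) ≤ cD l := by
  obtain ⟨h1, h2, h3, h4, h5, h6, -⟩ := wpos l h
  refine ⟨?_, ?_, ?_, ?_, ?_⟩ <;> exact_mod_cast ‹_›

lemma Dr_bd (ρ : ℝ) (h0 : 0 < ρ) (h1 : ρ ≤ 1) (l : List ℕ) (h : Pos l) :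
    (cD l : ℝ) ≤ Dr ρ l ∧ Dr ρ l ≤ 2 * cD l ∧ 0 ≤ Nr ρ l := by
  obtain ⟨a, b, c, d, e⟩ := wposR l h
  unfold Dr Nr
  refine ⟨?_, ?_, ?_⟩
  · nlinarith [mul_nonneg h0.le c]
  · nlinarith
  · nlinarith [mul_nonneg h0.le a]

lemma err_rep (ρ : ℝ) (a0 : ℕ) (hρ : ρ ^ 2 + a0 * ρ = 1) (v : List ℕ) (m : ℕ) :
    Nr ρ (List.replicate m a0 ++ v) - ρ * Dr ρ (List.replicate m a0 ++ v) =
      (-ρ) ^ m * (Nr ρ v - ρ * Dr ρ v) := by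
  induction m with
  | zero => simp
  | succ m ih =>
    rw [List.replicate_succ, List.cons_append, Nr_cons, Dr_cons, pow_succ]
    linear_combination (-ρ) * ih - (Dr ρ (List.replicate m a0 ++ v)) * hρ

lemma Dr_rep (ρ : ℝ) (h0 : 0 < ρ) (h1 : ρ ≤ 1) (a0 : ℕ) (ha : 1 ≤ a0) (v : List ℕ) (hv : Pos v) (m : ℕ) :
    Dr ρ v ≤ Dr ρ (List.replicate m a0 ++ v) := by
  induction m with
  | zero => simp
  | succ m ih =>
    rw [List.replicate_succ, List.cons_append, Dr_cons]
    have hp : Pos (List.replicate m a0 ++ v) := by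
      apply Pos.append _ hv
      intro b hb
      rw [List.eq_of_mem_replicate hb]; exact ha
    have h2 := Dr_bd ρ h0 h1 _ hp
    have h3 := wposR _ hp
    have : (1 : ℝ) ≤ a0 := by exact_mod_cast ha
    nlinarith

lemma err_le (ρ : ℝ) (h0 : 0 < ρ) (a0 : ℕ) (ha : 1 ≤ a0) (hρ : ρ ^ 2 + a0 * ρ = 1) (v : List ℕ)
    (hv : Pos v) (hne : v ≠ []) (m : ℕ) (a : List ℕ) (hap : Pos a) :
    |Dr ρ (a ++ (List.replicate m a0 ++ v)) - Dr ρ a * Dr ρ (List.replicate m a0 ++ v)| ≤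
      (5 / 8) ^ m * (Dr ρ a * Dr ρ (List.replicate m a0 ++ v)) := by
  have ha' : (1 : ℝ) ≤ a0 := by exact_mod_cast ha
  have hρ1 : ρ ≤ 5 / 8 := by nlinarith
  have h1 : ρ ≤ 1 := by linarith
  set b := List.replicate m a0 ++ v with hb
  have hp : Pos b := by
      apply Pos.append _ hv
      intro b hb
      rw [List.eq_of_mem_replicate hb]; exact ha
  have e : Dr ρ (a ++ b) - Dr ρ a * Dr ρ b = cC a * ((-ρ) ^ m * (Nr ρ v - ρ * Dr ρ v)) := by
    rw [← err_rep ρ a0 hρ v m, ← hb, Dr_append]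
    simp only [Dr]; ring
  have hv1 : |Nr ρ v - ρ * Dr ρ v| ≤ Dr ρ v := by
    obtain ⟨c, l, rfl⟩ := List.exists_cons_of_ne_nil hne
    obtain ⟨hc, hl⟩ := hv.cons
    have g1 := Dr_bd ρ h0 h1 _ hv
    have g2 := Dr_bd ρ h0 h1 _ hl
    have g3 := wposR _ hl
    have g4 := wposR _ hv
    have hc' : (1 : ℝ) ≤ c := by exact_mod_cast hc
    have : Nr ρ (c :: l) ≤ Dr ρ (c :: l) := by
      rw [Nr_cons, Dr_cons]; nlinarith
    rw [abs_le]; constructor <;> nlinarith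
  have hD := Dr_rep ρ h0 h1 a0 ha v hv m
  have g := Dr_bd ρ h0 h1 _ hap
  have g3 := wposR _ hap
  have gv := Dr_bd ρ h0 h1 _ hv
  have gv3 := wposR _ hv
  rw [e, abs_mul, abs_mul, abs_pow, abs_neg, abs_of_pos h0, abs_of_nonneg g3.2.2.1]
  calc cC a * (ρ ^ m * |Nr ρ v - ρ * Dr ρ v|) ≤ Dr ρ a * ((5 / 8) ^ m * Dr ρ b) := by
        apply mul_le_mul (by linarith) _ (by positivity) (by linarith)
        apply mul_le_mul _ (hv1.trans hD) (abs_nonneg _) (by positivity)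
        exact pow_le_pow_left₀ h0.le hρ1 m
    _ = _ := by ring

lemma len_bd (v : List ℕ) (hv : Pos v) (Y : ℝ) (h : (cD v : ℝ) ≤ Y) :
    (v.length : ℝ) ≤ 4000 * Y ^ (0.001 : ℝ) := by
  have h1 := cD_len v.length v hv rfl
  have h2 : (2 : ℝ) ^ (v.length / 2) ≤ Y := le_trans (by exact_mod_cast h1) h
  have hY1 : 1 ≤ Y := le_trans (wposR v hv).2.2.2.1 h
  have h3 := Real.log_le_log (by positivity) h2
  rw [Real.log_pow] at h3
  have h4 := Real.log_le_rpow_div (by linarith : 0 ≤ Y) (show (0:ℝ) < 0.001 by norm_num)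
  have h5 := Real.log_two_gt_d9
  have h6 : (1:ℝ) ≤ Y ^ (0.001 : ℝ) := Real.one_le_rpow hY1 (by norm_num)
  have h7 : (v.length : ℝ) ≤ 2 * ((v.length / 2 : ℕ) : ℝ) + 1 := by
    exact_mod_cast (by omega : v.length ≤ 2 * (v.length / 2) + 1)
  have h8 : ((v.length / 2 : ℕ) : ℝ) * 0.6 ≤ ((v.length / 2 : ℕ) : ℝ) * Real.log 2 :=
    mul_le_mul_of_nonneg_left (by linarith) (by positivity)
  have h9 : Y ^ (0.001 : ℝ) / 0.001 = 1000 * Y ^ (0.001 : ℝ) := by ring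
  rw [h9] at h4
  linarith

lemma rep_bd (R a0 : ℕ) (ha : 1 ≤ a0) (haR : a0 ≤ R) (m : ℕ) :
    Pos (List.replicate m a0) ∧ (cD (List.replicate m a0) : ℝ) ≤ (R + 1) ^ m := by
  have hp : ∀ m, Pos (List.replicate m a0) := by
    intro m b hb
    rw [List.eq_of_mem_replicate hb]; exact ha
  refine ⟨hp m, ?_⟩
  induction m with
  | zero => simp [cD_nil]
  | succ m ih =>
    rw [List.replicate_succ, cD_cons, pow_succ]
    have h1 := wpos _ (hp m)
    have h2 : (cB (List.replicate m a0) : ℝ) ≤ cD (List.replicate m a0) := by exact_mod_cast h1.2.2.2.2.1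
    have h3 := wposR _ (hp m)
    have : (a0 : ℝ) ≤ R := by exact_mod_cast haR
    push_cast
    nlinarith

set_option maxHeartbeats 2000000 in
lemma block (A : Finset ℕ) (hA : ∀ a ∈ A, 0 < a) (R : ℕ) (hR : ∀ a ∈ A, a ≤ R) (a0 : ℕ) (ha0 : a0 ∈ A)
    (ρ : ℝ) (h0 : 0 < ρ) (hρ : ρ ^ 2 + a0 * ρ = 1) (Y0 : ℝ) (hY0 : 1 ≤ Y0)
    (hcount : ∀ Y : ℝ, Y0 ≤ Y → Y ^ (1.967 : ℝ) ≤ (Vf A R Y).card) :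
    ∃ B : ℝ, 1 ≤ B ∧ ∀ m : ℕ, 1 ≤ m → ∀ ϱ Y : ℝ, B ^ m ≤ ϱ →
      ϱ ≤ 4 * cD (List.replicate m a0) * Y →
      ∃ (Ξ : Finset (List ℕ)) (n : ℕ), (∀ l ∈ Ξ, (∀ a ∈ l, a ∈ A) ∧ l.length = n ∧
        ∃ v, v ≠ [] ∧ l = List.replicate m a0 ++ v ∧
          cD (List.replicate m a0) * Y ≤ (R + 1) * cD l ∧
          cD l ≤ 2 * cD (List.replicate m a0) * Y) ∧
        (∀ l ∈ Ξ, ∀ l' ∈ Ξ, Dr ρ l ≤ (1 + (5 / 8) ^ m) * Dr ρ l') ∧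
        ϱ ^ (1.96 : ℝ) ≤ Ξ.card := by
  classical
  have ha1 : 1 ≤ a0 := hA a0 ha0
  have ha' : (1 : ℝ) ≤ a0 := by exact_mod_cast ha1
  have hR1 : (1 : ℝ) ≤ R := by exact_mod_cast ha1.trans (hR a0 ha0)
  have hρ1 : ρ ≤ 1 := by nlinarith
  set Q : ℝ := 10 ^ 6 * (R + 1) ^ 3 * Y0 with hQ
  have hQ1 : 1 ≤ Q := by
    have : (1:ℝ) ≤ (R + 1) ^ 3 := one_le_pow₀ (by linarith)
    nlinarith
  refine ⟨Q ^ 167, one_le_pow₀ hQ1, ?_⟩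
  intro m hm ϱ Y hϱ hϱY
  obtain ⟨hKp, hKb⟩ := rep_bd R a0 ha1 (hR a0 ha0) m
  set rm := List.replicate m a0 with hrm
  set K : ℝ := ((cD rm : ℤ) : ℝ) with hK
  have hK1 : 1 ≤ K := (wposR _ hKp).2.2.2.1
  -- consequences of the size of rho
  have hQm : Q ^ m ≤ ϱ ^ (0.006 : ℝ) := by
    calc Q ^ m ≤ (Q ^ m) ^ (1.002 : ℝ) := by
          conv_lhs => rw [← Real.rpow_one (Q ^ m)]
          exact Real.rpow_le_rpow_of_exponent_le (one_le_pow₀ hQ1) (by norm_num)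
      _ = ((Q ^ 167) ^ m) ^ (0.006 : ℝ) := by
          rw [← pow_mul, mul_comm, pow_mul, ← Real.rpow_natCast (Q ^ m) 167,
            ← Real.rpow_mul (by positivity)]
          norm_num
      _ ≤ _ := Real.rpow_le_rpow (by positivity) hϱ (by norm_num)
  have hϱ1 : 1 ≤ ϱ := le_trans (one_le_pow₀ (one_le_pow₀ hQ1)) hϱ
  have hQmϱ : Q ^ m ≤ ϱ := le_trans (by
    rw [← pow_mul]; exact pow_le_pow_right₀ hQ1 (by omega)) hϱ
  have hQmsplit : 10 ^ 6 * ((R:ℝ) + 1) * Y0 * (((R:ℝ) + 1) ^ m) ^ 2 * 2 ^ m ≤ 2 * Q ^ m := by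
    have e : Q ^ m = ((10 ^ 6 / 2) * ((R:ℝ) + 1) * Y0) ^ m * ((((R:ℝ) + 1) ^ m) ^ 2 * 2 ^ m) := by
      rw [← pow_mul, mul_comm m 2, pow_mul, ← mul_pow, ← mul_pow, hQ]; congr 1; ring
    rw [e]
    have h1 : (10 ^ 6 / 2) * ((R:ℝ) + 1) * Y0 ≤ ((10 ^ 6 / 2) * ((R:ℝ) + 1) * Y0) ^ m := by
      apply le_self_pow₀ _ (by omega)
      nlinarith
    have := mul_le_mul_of_nonneg_right h1 (show 0 ≤ (((R:ℝ) + 1) ^ m) ^ 2 * 2 ^ m by positivity)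
    linarith
  have hYlow : ϱ / (4 * K) ≤ Y := by
    rw [div_le_iff₀ (by positivity)]; linarith
  have hKm1 : 1 ≤ ((R:ℝ) + 1) ^ m := one_le_pow₀ (by linarith)
  have h2m : (1:ℝ) ≤ 2 ^ m := one_le_pow₀ (by norm_num)
  have hYY0 : Y0 ≤ Y := by
    refine le_trans ?_ hYlow
    rw [le_div_iff₀ (by positivity)]
    refine le_trans ?_ hQmϱ
    have : Y0 * (4 * K) ≤ Y0 * (4 * ((R:ℝ) + 1) ^ m) := by
      apply mul_le_mul_of_nonneg_left _ (by linarith); linarith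
    have h3 : Y0 * (4 * ((R:ℝ) + 1) ^ m) ≤ (10 ^ 6 * ((R:ℝ) + 1) * Y0 * (((R:ℝ) + 1) ^ m) ^ 2 * 2 ^ m) / 2 := by
      have g1 : ((R:ℝ) + 1) ^ m ≤ (((R:ℝ) + 1) ^ m) ^ 2 := le_self_pow₀ hKm1 (by norm_num)
      have g2 : ((R:ℝ) + 1) ^ m * 1 ≤ (((R:ℝ) + 1) ^ m) ^ 2 * 2 ^ m :=
        mul_le_mul g1 h2m (by norm_num) (by positivity)
      have g3 : 4 * Y0 ≤ 10 ^ 6 * ((R:ℝ) + 1) * Y0 / 2 := by nlinarith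
      calc Y0 * (4 * ((R:ℝ) + 1) ^ m) = (4 * Y0) * (((R:ℝ) + 1) ^ m * 1) := by ring
        _ ≤ (10 ^ 6 * ((R:ℝ) + 1) * Y0 / 2) * ((((R:ℝ) + 1) ^ m) ^ 2 * 2 ^ m) := by
            apply mul_le_mul g3 g2 (by positivity) (by positivity)
        _ = _ := by ring
    linarith
  have hY1 : 1 ≤ Y := hY0.trans hYY0
  have hcardV := hcount Y hYY0
  set V := Vf A R Y with hV
  have hVm := mem_Vf A hA R Y
  have hVP : ∀ v ∈ V, Pos v := fun v hv a ha => hA a (((hVm v).1 hv).1 a ha)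
  have hκ : (0:ℝ) < (5 / 8) ^ m := by positivity
  have hκ1 : ((5:ℝ) / 8) ^ m ≤ 1 := pow_le_one₀ (by norm_num) (by norm_num)
  set δ : ℝ := (5 / 8) ^ m / (R + 1) with hδ
  have hδ0 : 0 < δ := by positivity
  set f : List ℕ → ℕ × ℕ := fun v => (v.length, ⌊Dr ρ (rm ++ v) / (K * Y) / δ⌋₊) with hf
  set n1 := ⌊4000 * Y ^ (0.001 : ℝ)⌋₊ + 1 with hn1
  set n2 := ⌊4 / δ⌋₊ + 1 with hn2
  have hcD : ∀ v ∈ V, K * cD v ≤ cD (rm ++ v) ∧ (cD (rm ++ v) : ℝ) ≤ 2 * (K * cD v) := by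
    intro v hv
    have := cD_mul_le rm v hKp (hVP v hv)
    exact ⟨by rw [hK]; exact_mod_cast this.1, by rw [hK]; exact_mod_cast this.2⟩
  have hDr : ∀ v ∈ V, 1 / (R + 1) ≤ Dr ρ (rm ++ v) / (K * Y) ∧ Dr ρ (rm ++ v) / (K * Y) ≤ 4 := by
    intro v hv
    have g := Dr_bd ρ h0 hρ1 _ (hKp.append (hVP v hv))
    have g2 := hcD v hv
    have g3 := (hVm v).1 hv
    constructor
    · rw [div_le_div_iff₀ (by positivity) (by positivity)]
      have : K * Y ≤ K * ((R + 1) * cD v) := mul_le_mul_of_nonneg_left g3.2.2.1.le (by linarith)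
      have : K * cD v * (R + 1) ≤ Dr ρ (rm ++ v) * (R + 1) :=
        mul_le_mul_of_nonneg_right (by linarith) (by linarith)
      linarith
    · rw [div_le_iff₀ (by positivity)]
      have : K * cD v ≤ K * Y := mul_le_mul_of_nonneg_left g3.2.2.2 (by linarith)
      linarith
  have hmaps : ∀ v ∈ V, f v ∈ Finset.range n1 ×ˢ Finset.range n2 := by
    intro v hv
    rw [Finset.mem_product, Finset.mem_range, Finset.mem_range]
    constructor
    · rw [hn1]
      have : v.length ≤ ⌊4000 * Y ^ (0.001 : ℝ)⌋₊ := Nat.le_floor (len_bd v (hVP v hv) Y ((hVm v).1 hv).2.2.2)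
      exact Nat.lt_succ_of_le this
    · rw [hn2]
      have : ⌊Dr ρ (rm ++ v) / (K * Y) / δ⌋₊ ≤ ⌊4 / δ⌋₊ := by
        apply Nat.floor_le_floor
        exact div_le_div_of_nonneg_right (hDr v hv).2 hδ0.le
      exact Nat.lt_succ_of_le this
  have hYe : (1:ℝ) ≤ Y ^ (0.001 : ℝ) := Real.one_le_rpow hY1 (by norm_num)
  have hn1' : (n1 : ℝ) ≤ 4001 * Y ^ (0.001 : ℝ) := by
    rw [hn1]; push_cast
    have := Nat.floor_le (show 0 ≤ 4000 * Y ^ (0.001 : ℝ) by positivity)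
    linarith
  have hn2' : (n2 : ℝ) ≤ 5 * (R + 1) * 2 ^ m := by
    rw [hn2]; push_cast
    have := Nat.floor_le (show 0 ≤ 4 / δ by positivity)
    have e : 4 / δ ≤ 4 * (R + 1) * 2 ^ m := by
      rw [div_le_iff₀ hδ0, hδ]
      have : (4 * ((R:ℝ) + 1) * 2 ^ m) * ((5 / 8) ^ m / (R + 1)) = 4 * (2 * (5 / 8)) ^ m := by
        rw [mul_pow]; field_simp
      rw [this]
      have : (1:ℝ) ≤ (2 * (5 / 8)) ^ m := one_le_pow₀ (by norm_num)
      linarith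
    nlinarith
  have hnum : ((Finset.range n1 ×ˢ Finset.range n2).card : ℕ) • (ϱ ^ (1.96 : ℝ)) ≤ (V.card : ℝ) := by
    rw [nsmul_eq_mul, Finset.card_product, Finset.card_range, Finset.card_range]
    push_cast
    refine le_trans ?_ hcardV
    have e1 : Y ^ (1.967 : ℝ) = Y ^ (1.966 : ℝ) * Y ^ (0.001 : ℝ) := by
      rw [← Real.rpow_add (by linarith)]; norm_num
    have e2 : (ϱ / (4 * K)) ^ (1.966 : ℝ) ≤ Y ^ (1.966 : ℝ) :=
      Real.rpow_le_rpow (by positivity) hYlow (by norm_num)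
    have e3 : (ϱ / (4 * K)) ^ (1.966 : ℝ) = ϱ ^ (1.96 : ℝ) * ϱ ^ (0.006 : ℝ) / (4 * K) ^ (1.966 : ℝ) := by
      rw [Real.div_rpow (by linarith) (by positivity), ← Real.rpow_add (by linarith)]; norm_num
    have e4 : (4 * K) ^ (1.966 : ℝ) ≤ 16 * (((R:ℝ) + 1) ^ m) ^ 2 := by
      calc (4 * K) ^ (1.966 : ℝ) ≤ (4 * K) ^ (2 : ℝ) :=
            Real.rpow_le_rpow_of_exponent_le (by linarith) (by norm_num)
        _ = (4 * K) ^ 2 := by norm_num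
        _ ≤ (4 * ((R:ℝ) + 1) ^ m) ^ 2 := by gcongr
        _ = _ := by ring
    have e5 : (n1 : ℝ) * n2 ≤ 4001 * Y ^ (0.001 : ℝ) * (5 * (R + 1) * 2 ^ m) :=
      mul_le_mul hn1' hn2' (by positivity) (by positivity)
    have e6 : 4001 * (5 * ((R:ℝ) + 1) * 2 ^ m) * (16 * (((R:ℝ) + 1) ^ m) ^ 2) ≤ ϱ ^ (0.006 : ℝ) := by
      refine le_trans ?_ hQm
      have g : 4001 * 5 * 16 * (((R:ℝ) + 1) * (((R:ℝ) + 1) ^ m) ^ 2 * 2 ^ m) ≤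
        (10 ^ 6 / 2 * Y0) * (((R:ℝ) + 1) * (((R:ℝ) + 1) ^ m) ^ 2 * 2 ^ m) := by
        apply mul_le_mul_of_nonneg_right _ (by positivity)
        linarith
      linarith
    have e7 : 4001 * (5 * ((R:ℝ) + 1) * 2 ^ m) * ϱ ^ (1.96 : ℝ) ≤ Y ^ (1.966 : ℝ) := by
      refine le_trans ?_ e2
      rw [e3, le_div_iff₀ (by positivity)]
      calc 4001 * (5 * ((R:ℝ) + 1) * 2 ^ m) * ϱ ^ (1.96 : ℝ) * (4 * K) ^ (1.966 : ℝ)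
          ≤ 4001 * (5 * ((R:ℝ) + 1) * 2 ^ m) * ϱ ^ (1.96 : ℝ) * (16 * (((R:ℝ) + 1) ^ m) ^ 2) := by gcongr
        _ = ϱ ^ (1.96 : ℝ) * (4001 * (5 * ((R:ℝ) + 1) * 2 ^ m) * (16 * (((R:ℝ) + 1) ^ m) ^ 2)) := by ring
        _ ≤ _ := by gcongr
    rw [e1]
    calc (n1 : ℝ) * n2 * ϱ ^ (1.96 : ℝ) ≤ 4001 * Y ^ (0.001 : ℝ) * (5 * (R + 1) * 2 ^ m) * ϱ ^ (1.96 : ℝ) := by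
          gcongr
      _ = 4001 * (5 * ((R:ℝ) + 1) * 2 ^ m) * ϱ ^ (1.96 : ℝ) * Y ^ (0.001 : ℝ) := by ring
      _ ≤ _ := by gcongr
  have hne : (Finset.range n1 ×ˢ Finset.range n2).Nonempty := by
    rw [Finset.nonempty_product]
    simp [hn1, hn2]
  obtain ⟨⟨y1, y2⟩, hy, hfib⟩ := Finset.exists_le_card_fiber_of_nsmul_le_card_of_maps_to hmaps hne hnum
  refine ⟨(V.filter (fun v => f v = (y1, y2))).image (fun v => rm ++ v), m + y1, ?_, ?_, ?_⟩
  · intro l hl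
    obtain ⟨v, hv, rfl⟩ := Finset.mem_image.1 hl
    obtain ⟨hv, hfv⟩ := Finset.mem_filter.1 hv
    have g := (hVm v).1 hv
    have g2 := hcD v hv
    simp only [hf, Prod.mk.injEq] at hfv
    refine ⟨?_, ?_, v, g.2.1, rfl, ?_, ?_⟩
    · intro a ha
      rcases List.mem_append.1 ha with h | h
      · rw [hrm] at h; rw [List.eq_of_mem_replicate h]; exact ha0
      · exact g.1 a h
    · rw [List.length_append, hfv.1, hrm, List.length_replicate]
    · have : K * Y ≤ K * ((R + 1) * cD v) := mul_le_mul_of_nonneg_left g.2.2.1.le (by linarith)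
      have : K * cD v * (R + 1) ≤ cD (rm ++ v) * (R + 1) :=
        mul_le_mul_of_nonneg_right (by linarith) (by linarith)
      linarith
    · have : K * cD v ≤ K * Y := mul_le_mul_of_nonneg_left g.2.2.2 (by linarith)
      linarith
  · intro l hl l' hl'
    obtain ⟨v, hv, rfl⟩ := Finset.mem_image.1 hl
    obtain ⟨hv, hfv⟩ := Finset.mem_filter.1 hv
    obtain ⟨v', hv', rfl⟩ := Finset.mem_image.1 hl'
    obtain ⟨hv', hfv'⟩ := Finset.mem_filter.1 hv'
    simp only [hf, Prod.mk.injEq] at hfv hfv'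
    have g1 := Nat.lt_floor_add_one (Dr ρ (rm ++ v) / (K * Y) / δ)
    have g2 := Nat.floor_le (show 0 ≤ Dr ρ (rm ++ v') / (K * Y) / δ by
      have := (hDr v' hv').1
      have : 0 ≤ Dr ρ (rm ++ v') / (K * Y) := le_trans (by positivity) this
      positivity)
    rw [hfv.2] at g1
    rw [hfv'.2] at g2
    have g3 : Dr ρ (rm ++ v) / (K * Y) / δ ≤ Dr ρ (rm ++ v') / (K * Y) / δ + 1 := by linarith
    rw [div_le_iff₀ hδ0, add_mul, div_mul_cancel₀ _ hδ0.ne', one_mul] at g3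
    have g4 := (hDr v' hv').1
    have g5 : δ ≤ (5 / 8) ^ m * (Dr ρ (rm ++ v') / (K * Y)) := by
      rw [hδ, div_eq_mul_one_div]
      exact mul_le_mul_of_nonneg_left g4 hκ.le
    have g6 : Dr ρ (rm ++ v) / (K * Y) ≤ (1 + (5 / 8) ^ m) * (Dr ρ (rm ++ v') / (K * Y)) := by linarith
    rw [← mul_div_assoc] at g6
    exact (div_le_div_iff_of_pos_right (by positivity)).1 g6
  · rw [Finset.card_image_of_injective _ (List.append_right_injective rm)]
    exact hfib

/-- concatenation of the blocks `i, …, i+k-1` -/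
noncomputable def seg (Ξ : ℕ → Finset (List ℕ)) : ℕ → ℕ → Finset (List ℕ)
  | _, 0 => {[]}
  | i, k + 1 => cat (Ξ i) (seg Ξ (i + 1) k)

lemma cat_assoc (X Y Z : Finset (List ℕ)) : cat (cat X Y) Z = cat X (cat Y Z) := by
  ext l
  simp only [mem_cat]
  constructor
  · rintro ⟨_, ⟨a, ha, b, hb, rfl⟩, c, hc, rfl⟩
    exact ⟨a, ha, _, ⟨b, hb, c, hc, rfl⟩, by simp⟩
  · rintro ⟨a, ha, _, ⟨b, hb, c, hc, rfl⟩, rfl⟩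
    exact ⟨_, ⟨a, ha, b, hb, rfl⟩, c, hc, by simp⟩

lemma nil_cat (X : Finset (List ℕ)) : cat {[]} X = X := by
  ext l; simp [mem_cat]
lemma cat_nil (X : Finset (List ℕ)) : cat X {[]} = X := by
  ext l; simp [mem_cat]

lemma seg_add (Ξ : ℕ → Finset (List ℕ)) (i k l : ℕ) :
    seg Ξ i (k + l) = cat (seg Ξ i k) (seg Ξ (i + k) l) := by
  induction k generalizing i with
  | zero => simp [seg, nil_cat]
  | succ k ih =>
    rw [show k + 1 + l = (k + l) + 1 by omega]
    simp only [seg]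
    rw [ih, cat_assoc, show i + 1 + k = i + (k + 1) by omega]

lemma seg_succ (Ξ : ℕ → Finset (List ℕ)) (k : ℕ) : seg Ξ 0 (k + 1) = cat (seg Ξ 0 k) (Ξ k) := by
  rw [seg_add]; simp [seg, cat_nil]

lemma seg_congr (Ξ Ξ' : ℕ → Finset (List ℕ)) (i k : ℕ) (h : ∀ j, i ≤ j → j < i + k → Ξ j = Ξ' j) :
    seg Ξ i k = seg Ξ' i k := by
  induction k generalizing i with
  | zero => simp [seg]
  | succ k ih =>
    simp only [seg]
    rw [h i le_rfl (by omega), ih (i + 1) (fun j h1 h2 => h j (by omega) (by omega))]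

lemma exp_aux (x : ℝ) (h0 : 0 ≤ x) (h1 : x ≤ 1 / 2) : (1 + x) ^ 2 ≤ (1 - x) * Real.exp (4 * x) := by
  have a := Real.add_one_le_exp (2 * x)
  have a' := Real.add_one_le_exp x
  have e : Real.exp (4 * x) = Real.exp x ^ 2 * Real.exp (2 * x) := by
    rw [← Real.exp_nat_mul, ← Real.exp_add]; congr 1; push_cast; ring
  have b : 1 ≤ (1 - x) * Real.exp (2 * x) := by nlinarith
  have c : (1 + x) ^ 2 ≤ Real.exp x ^ 2 := pow_le_pow_left₀ (by linarith) (by linarith) 2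
  rw [e]
  nlinarith

set_option maxHeartbeats 2000000 in
lemma ensemble (A : Finset ℕ) (hA : ∀ a ∈ A, 0 < a) (R : ℕ) (hR : ∀ a ∈ A, a ≤ R) (a0 : ℕ) (ha0 : a0 ∈ A)
    (Y0 : ℝ) (hY0 : 1 ≤ Y0)
    (hcount : ∀ Y : ℝ, Y0 ≤ Y → Y ^ (1.967 : ℝ) ≤ (Vf A R Y).card) :
    ∃ B C : ℝ, 1 ≤ B ∧ 1 ≤ C ∧ ∀ T : ℕ → ℝ, T 0 = 1 → ∀ n : ℕ, (∀ j < n, B ^ (j + 2) * T j ≤ T (j + 1)) →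
      ∃ (Ξ : ℕ → Finset (List ℕ)) (len : ℕ → ℕ),
        (∀ i < n, 2 ≤ len i ∧ (∀ l ∈ Ξ i, (∀ a ∈ l, a ∈ A) ∧ l.length = len i) ∧
          (T (i + 1) / T i) ^ (1.96 : ℝ) ≤ (Ξ i).card) ∧
        ∀ j ≤ n, ∀ l ∈ seg Ξ 0 j, T j ≤ C * cD l ∧ cD l ≤ T j := by
  have ha1 : 1 ≤ a0 := hA a0 ha0
  have ha' : (1 : ℝ) ≤ a0 := by exact_mod_cast ha1
  obtain ⟨ρ, h0, hρ⟩ : ∃ ρ : ℝ, 0 < ρ ∧ ρ ^ 2 + a0 * ρ = 1 := by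
    have hs : (a0 : ℝ) < √(a0 ^ 2 + 4) := by
      apply Real.lt_sqrt_of_sq_lt; linarith
    refine ⟨(√(a0 ^ 2 + 4) - a0) / 2, by linarith, ?_⟩
    have := Real.sq_sqrt (show (0:ℝ) ≤ (a0:ℝ) ^ 2 + 4 by positivity)
    nlinarith
  have hρ1 : ρ ≤ 1 := by nlinarith
  obtain ⟨B, hB, hblk⟩ := block A hA R hR a0 ha0 ρ h0 hρ Y0 hY0 hcount
  have hRpos : (0:ℝ) ≤ R := by positivity
  have he12 : (1:ℝ) ≤ Real.exp 12 := Real.one_le_exp (by norm_num)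
  refine ⟨B, 8 * (R + 1) * Real.exp 12, hB, by nlinarith, ?_⟩
  intro T hT0 n
  induction n with
  | zero =>
    intro _
    refine ⟨fun _ => ∅, fun _ => 0, by simp, ?_⟩
    intro j hj l hl
    have : j = 0 := by omega
    subst this
    simp only [seg, Finset.mem_singleton] at hl
    subst hl
    rw [hT0, cD_nil]; push_cast
    constructor <;> nlinarith
  | succ n _ =>
    -- strengthened induction
    have key : ∀ k : ℕ, (∀ j < k, B ^ (j + 2) * T j ≤ T (j + 1)) →
      ∃ (Ξ : ℕ → Finset (List ℕ)) (len : ℕ → ℕ),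
        (∀ i < k, 2 ≤ len i ∧ (∀ l ∈ Ξ i, (∀ a ∈ l, a ∈ A) ∧ l.length = len i) ∧
          (T (i + 1) / T i) ^ (1.96 : ℝ) ≤ (Ξ i).card) ∧
        (∀ j ≤ k, ∀ l ∈ seg Ξ 0 j, T j ≤ (8 * (R + 1) * Real.exp 12) * cD l ∧ cD l ≤ T j) ∧
        1 ≤ T k ∧ (seg Ξ 0 k).Nonempty ∧ (∀ l ∈ seg Ξ 0 k, Pos l) ∧
        (∀ l ∈ seg Ξ 0 k, ∀ l' ∈ seg Ξ 0 k,
          Dr ρ l ≤ Real.exp (12 * (1 - (5 / 8) ^ k)) * Dr ρ l') := by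
      intro k
      induction k with
      | zero =>
        intro _
        refine ⟨fun _ => ∅, fun _ => 0, by simp, ?_, hT0.ge, by simp [seg], ?_, ?_⟩
        · intro j hj l hl
          have : j = 0 := by omega
          subst this
          simp only [seg, Finset.mem_singleton] at hl
          subst hl
          rw [hT0, cD_nil]; push_cast
          constructor <;> nlinarith
        · simp [seg, Pos]
        · simp [seg]
      | succ k ih =>
        intro hT
        obtain ⟨Ξ, len, h1, h2, hTk, hne, hP, hrat⟩ := ih (fun j hj => hT j (by omega))
        obtain ⟨ls, hls, hmax⟩ := Finset.exists_max_image (seg Ξ 0 k) cD hne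
        set M : ℝ := ((cD ls : ℤ) : ℝ) with hM
        have hM1 : 1 ≤ M := (wposR _ (hP _ hls)).2.2.2.1
        have hMT : M ≤ T k := (h2 k le_rfl ls hls).2
        set K : ℝ := ((cD (List.replicate (k + 2) a0) : ℤ) : ℝ) with hK
        have hrp : Pos (List.replicate (k + 2) a0) := by
          intro b hb
          rw [List.eq_of_mem_replicate hb]; exact ha1
        have hK1 : 1 ≤ K := (wposR _ hrp).2.2.2.1
        have hTpos : 0 < T k := by linarith
        have hTk1 := hT k (by omega)
        have hBk : 1 ≤ B ^ (k + 2) := one_le_pow₀ hB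
        have hTT : 1 ≤ T (k + 1) := by nlinarith
        set Y : ℝ := T (k + 1) / (4 * M * K) with hY
        have hKY : 4 * K * Y = T (k + 1) / M := by rw [hY]; field_simp
        obtain ⟨Ξn, ln, b1, b2, b3⟩ := hblk (k + 2) (by omega) (T (k + 1) / T k) Y
          (by rw [le_div_iff₀ hTpos]; exact hTk1)
          (by rw [← hK, hKY]; exact div_le_div_of_nonneg_left (by linarith) (by linarith) hMT)
        rw [← hK] at b1
        have hMKY : M * (K * Y) = T (k + 1) / 4 := by rw [hY]; field_simp
        have hΞne : Ξn.Nonempty := by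
          rw [← Finset.card_pos]
          have : (0:ℝ) < Ξn.card := lt_of_lt_of_le (Real.rpow_pos_of_pos (by positivity) _) b3
          exact_mod_cast this
        have hΞP : ∀ l ∈ Ξn, Pos l := fun l hl a ha => hA a ((b1 l hl).1 a ha)
        set Ξ' : ℕ → Finset (List ℕ) := fun i => if i = k then Ξn else Ξ i with hΞ'
        have hseg : ∀ j ≤ k, seg Ξ' 0 j = seg Ξ 0 j := by
          intro j hj
          apply seg_congr
          intro i _ hi
          simp only [hΞ']; rw [if_neg (by omega)]
        have hseg1 : seg Ξ' 0 (k + 1) = cat (seg Ξ 0 k) Ξn := by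
          rw [seg_succ, hseg k le_rfl]; simp [hΞ']
        set x : ℝ := (5 / 8) ^ (k + 2) with hx
        have hx0 : 0 < x := by positivity
        have hx1 : x ≤ 1 / 2 := by
          rw [hx, pow_add]
          have : ((5:ℝ) / 8) ^ k ≤ 1 := pow_le_one₀ (by norm_num) (by norm_num)
          nlinarith
        have hDrpos : ∀ l, Pos l → 0 < Dr ρ l := fun l hl => by
          have := (Dr_bd ρ h0 hρ1 l hl).1
          have := (wposR l hl).2.2.2.1
          linarith
        have herr : ∀ p, Pos p → ∀ g ∈ Ξn, (1 - x) * (Dr ρ p * Dr ρ g) ≤ Dr ρ (p ++ g) ∧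
            Dr ρ (p ++ g) ≤ (1 + x) * (Dr ρ p * Dr ρ g) := by
          intro p hp g hg
          obtain ⟨c1, -, v, hv, rfl, -⟩ := b1 g hg
          have := err_le ρ h0 a0 ha1 hρ v (fun a ha => hA a (c1 a (by simp [ha]))) hv (k + 2) p hp
          rw [abs_le] at this
          constructor <;> linarith [this.1, this.2]
        have hrat' : ∀ l ∈ seg Ξ' 0 (k + 1), ∀ l' ∈ seg Ξ' 0 (k + 1),
          Dr ρ l ≤ Real.exp (12 * (1 - (5 / 8) ^ (k + 1))) * Dr ρ l' := by
          intro l hl l' hl'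
          rw [hseg1] at hl hl'
          obtain ⟨p, hp, g, hg, rfl⟩ := mem_cat.1 hl
          obtain ⟨p', hp', g', hg', rfl⟩ := mem_cat.1 hl'
          have d1 := (herr p (hP p hp) g hg).2
          have d2 := (herr p' (hP p' hp') g' hg').1
          have d3 := hrat p hp p' hp'
          have d4 := b2 g hg g' hg'
          have q1 := hDrpos p (hP p hp)
          have q2 := hDrpos p' (hP p' hp')
          have q3 := hDrpos g (hΞP g hg)
          have q4 := hDrpos g' (hΞP g' hg')
          have d5 := exp_aux x hx0.le hx1
          set E := Real.exp (12 * (1 - (5 / 8) ^ k)) with hE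
          have hE0 : 0 < E := Real.exp_pos _
          have hEE : E * Real.exp (4 * x) ≤ Real.exp (12 * (1 - (5 / 8) ^ (k + 1))) := by
            rw [hE, ← Real.exp_add]
            apply Real.exp_le_exp.2
            have e1 : x = (5 / 8) ^ k * (25 / 64) := by rw [hx, pow_add]; norm_num
            have e2 : ((5:ℝ) / 8) ^ (k + 1) = (5 / 8) ^ k * (5 / 8) := pow_succ _ _
            have : (0:ℝ) < (5 / 8) ^ k := by positivity
            rw [e1, e2]
            linarith
          calc Dr ρ (p ++ g) ≤ (1 + x) * (Dr ρ p * Dr ρ g) := d1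
            _ ≤ (1 + x) * ((E * Dr ρ p') * ((1 + x) * Dr ρ g')) := by
                apply mul_le_mul_of_nonneg_left _ (by linarith)
                apply mul_le_mul d3 d4 q3.le (by positivity)
            _ = (1 + x) ^ 2 * (E * (Dr ρ p' * Dr ρ g')) := by ring
            _ ≤ ((1 - x) * Real.exp (4 * x)) * (E * (Dr ρ p' * Dr ρ g')) := by gcongr
            _ = (E * Real.exp (4 * x)) * ((1 - x) * (Dr ρ p' * Dr ρ g')) := by ring
            _ ≤ (E * Real.exp (4 * x)) * Dr ρ (p' ++ g') := by gcongr
            _ ≤ _ := by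
                apply mul_le_mul_of_nonneg_right hEE
                exact (hDrpos _ ((hP p' hp').append (hΞP g' hg'))).le
        have hP' : ∀ l ∈ seg Ξ' 0 (k + 1), Pos l := by
          intro l hl
          rw [hseg1] at hl
          obtain ⟨p, hp, g, hg, rfl⟩ := mem_cat.1 hl
          exact (hP p hp).append (hΞP g hg)
        refine ⟨Ξ', fun i => if i = k then ln else len i, ?_, ?_, hTT, ?_, hP', hrat'⟩
        · intro i hi
          by_cases hik : i = k
          · subst hik
            simp only [hΞ', if_true]
            refine ⟨?_, fun l hl => ⟨(b1 l hl).1, (b1 l hl).2.1⟩, b3⟩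
            obtain ⟨g, hg⟩ := hΞne
            obtain ⟨-, c2, v, hv, c3, -⟩ := b1 g hg
            rw [← c2, c3, List.length_append, List.length_replicate]; omega
          · simp only [hΞ', if_neg hik]
            exact h1 i (by omega)
        · intro j hj l hl
          rcases Nat.lt_or_ge j (k + 1) with hjk | hjk
          · rw [hseg j (by omega)] at hl
            exact h2 j (by omega) l hl
          · have : j = k + 1 := by omega
            subst this
            constructor
            · obtain ⟨g, hg⟩ := hΞne
              have hmem : ls ++ g ∈ seg Ξ' 0 (k + 1) := by
                rw [hseg1]; exact mem_cat.2 ⟨ls, hls, g, hg, rfl⟩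
              have d := hrat' _ hmem l hl
              have d1 := (Dr_bd ρ h0 hρ1 _ (hP' l hl)).2.1
              have d2 := (Dr_bd ρ h0 hρ1 _ (hP' _ hmem)).1
              have d3 : M * cD g ≤ cD (ls ++ g) := by
                rw [hM]; exact_mod_cast (cD_mul_le ls g (hP _ hls) (hΞP g hg)).1
              obtain ⟨-, -, v, -, -, c4, -⟩ := b1 g hg
              have d4 : M * (K * Y) ≤ M * ((R + 1) * cD g) := mul_le_mul_of_nonneg_left c4 (by linarith)
              rw [hMKY] at d4
              have d5 : (R + 1) * (M * cD g) ≤ (R + 1) * (cD (ls ++ g) : ℝ) :=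
                mul_le_mul_of_nonneg_left d3 (by linarith)
              have d6 : Real.exp (12 * (1 - (5 / 8) ^ (k + 1))) ≤ Real.exp 12 := by
                apply Real.exp_le_exp.2
                have : (0:ℝ) < (5 / 8) ^ (k + 1) := by positivity
                nlinarith
              have d7 : Dr ρ (ls ++ g) ≤ Real.exp 12 * (2 * cD l) := by
                refine d.trans ?_
                apply mul_le_mul d6 d1 (hDrpos _ (hP' l hl)).le (by positivity)
              have d8 : (R + 1) * (cD (ls ++ g) : ℝ) ≤ (R + 1) * (Real.exp 12 * (2 * cD l)) :=
                mul_le_mul_of_nonneg_left (by linarith) (by linarith)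
              nlinarith
            · rw [hseg1] at hl
              obtain ⟨p, hp, g, hg, rfl⟩ := mem_cat.1 hl
              have d3 : (cD (p ++ g) : ℝ) ≤ 2 * (cD p * cD g) := by
                exact_mod_cast (cD_mul_le p g (hP _ hp) (hΞP g hg)).2
              obtain ⟨-, -, v, -, -, -, c4⟩ := b1 g hg
              have d4 : (cD p : ℝ) ≤ M := by rw [hM]; exact_mod_cast hmax p hp
              have d5 := (wposR _ (hΞP g hg)).2.2.2.1
              have d6 : (cD p : ℝ) * cD g ≤ M * (2 * K * Y) :=
                mul_le_mul d4 c4 (by linarith) (by linarith)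
              linarith
        · obtain ⟨g, hg⟩ := hΞne
          exact ⟨ls ++ g, by rw [hseg1]; exact mem_cat.2 ⟨ls, hls, g, hg, rfl⟩⟩
    intro hT
    obtain ⟨Ξ, len, h1, h2, -⟩ := key (n + 1) hT
    exact ⟨Ξ, len, h1, h2⟩

open ZMod in
lemma dens (P : ℕ) [NeZero P] {α : Type} [DecidableEq α] (Ω : Finset α) (hne : Ω.Nonempty) (d : α → ℤ) (K : ℝ)
    (h : ∑ t : ZMod P, ‖∑ l ∈ Ω, stdAddChar (t * (d l : ZMod P))‖ ^ 2 ≤ K * (Ω.card : ℝ) ^ 2) :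
    (P : ℝ) ≤ K * ((Ω.image (fun l => (d l : ZMod P))).card : ℝ) := by
  classical
  set f : α → ZMod P := fun l => (d l : ZMod P) with hf
  set r : ZMod P → ℝ := fun x => ((Ω.filter (fun l => f l = x)).card : ℝ) with hr
  have h1 : ((∑ t : ZMod P, ‖∑ l ∈ Ω, stdAddChar (t * (d l : ZMod P))‖ ^ 2 : ℝ) : ℂ) =
      ((P * ∑ l ∈ Ω, r (f l) : ℝ) : ℂ) := by
    push_cast
    calc _ = ∑ t : ZMod P, ∑ i ∈ Ω, ∑ j ∈ Ω, stdAddChar (t * (f j - f i)) := by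
          refine Finset.sum_congr rfl fun u _ => ?_
          rw [← Complex.conj_mul', map_sum, Finset.sum_mul_sum]
          refine Finset.sum_congr rfl fun i _ => Finset.sum_congr rfl fun j _ => ?_
          rw [char_conj, ← AddChar.map_add_eq_mul]; congr 1; simp only [hf]; ring
      _ = ∑ i ∈ Ω, ∑ j ∈ Ω, ∑ t : ZMod P, stdAddChar (t * (f j - f i)) := by
          rw [Finset.sum_comm]
          refine Finset.sum_congr rfl fun i _ => ?_
          rw [Finset.sum_comm]
      _ = ∑ i ∈ Ω, (P : ℂ) * r (f i) := by
          refine Finset.sum_congr rfl fun i _ => ?_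
          simp_rw [char_orth, sub_eq_zero]
          rw [← Finset.sum_filter, Finset.sum_const, nsmul_eq_mul, hr]
          push_cast; ring
      _ = _ := by rw [Finset.mul_sum]
  have h2 : ∑ t : ZMod P, ‖∑ l ∈ Ω, stdAddChar (t * (d l : ZMod P))‖ ^ 2 = P * ∑ l ∈ Ω, r (f l) := by
    exact_mod_cast h1
  have h3 : ∑ l ∈ Ω, r (f l) = ∑ x ∈ Ω.image f, r x ^ 2 := by
    rw [← Finset.sum_fiberwise_of_maps_to (t := Ω.image f) (g := f) (fun i hi => Finset.mem_image_of_mem f hi)]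
    refine Finset.sum_congr rfl fun x _ => ?_
    rw [Finset.sum_congr rfl (g := fun _ => r x) (fun i hi => by rw [(Finset.mem_filter.1 hi).2])]
    rw [Finset.sum_const, nsmul_eq_mul]; simp only [hr]; ring
  have h4 : (Ω.card : ℝ) = ∑ x ∈ Ω.image f, r x := by
    rw [Finset.card_eq_sum_card_image f Ω]; push_cast; rfl
  have h5 : (Ω.card : ℝ) ^ 2 ≤ (Ω.image f).card * ∑ x ∈ Ω.image f, r x ^ 2 := by
    rw [h4]; exact sq_sum_le_card_mul_sum_sq
  rw [h2, h3] at h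
  have hpos : (0 : ℝ) < (Ω.card : ℝ) ^ 2 := by
    have : 0 < Ω.card := Finset.card_pos.2 hne
    positivity
  have hP : (0:ℝ) ≤ P := by positivity
  have hD : (0:ℝ) ≤ (Ω.image f).card := by positivity
  have h6 : (P : ℝ) * (Ω.card : ℝ) ^ 2 ≤ (K * (Ω.image f).card) * (Ω.card : ℝ) ^ 2 := by
    calc (P : ℝ) * (Ω.card : ℝ) ^ 2 ≤ P * ((Ω.image f).card * ∑ x ∈ Ω.image f, r x ^ 2) :=
          mul_le_mul_of_nonneg_left h5 hP
      _ = (Ω.image f).card * (P * ∑ x ∈ Ω.image f, r x ^ 2) := by ring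
      _ ≤ (Ω.image f).card * (K * (Ω.card : ℝ) ^ 2) := mul_le_mul_of_nonneg_left h hD
      _ = _ := by ring
  exact le_of_mul_le_mul_right h6 hpos

open Classical in
lemma maj_card (P : ℕ) [NeZero P] (Y : ℕ) :
    (Finset.univ.filter (fun t : ZMod P => Maj P Y t)).card ≤ Y * (2 * Y + 1) * (3 * Y + 1) := by
  have hsub : Finset.univ.filter (fun t : ZMod P => Maj P Y t) ⊆
      (Finset.Icc (1:ℤ) Y ×ˢ Finset.Icc (-(Y:ℤ)) Y ×ˢ Finset.Icc (-(Y:ℤ)) (2 * Y)).image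
        (fun x => (((x.2.1 + x.2.2 * P) / x.1 : ℤ) : ZMod P)) := by
    intro t ht
    obtain ⟨-, n, r, h1, h2, h3, h⟩ := Finset.mem_filter.1 ht
    have hP : 0 < P := Nat.pos_of_ne_zero (NeZero.ne P)
    have e : ((t.val * n - r : ℤ) : ZMod P) = 0 := by
      push_cast; rw [ZMod.natCast_zmod_val, h]; ring
    rw [ZMod.intCast_zmod_eq_zero_iff_dvd] at e
    obtain ⟨k, hk⟩ := e
    have hv : (t.val : ℤ) < P := by exact_mod_cast ZMod.val_lt t
    have hv0 : (0:ℤ) ≤ t.val := by positivity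
    have h3' := abs_le.1 h3
    rw [Finset.mem_image]
    refine ⟨(n, r, k), ?_, ?_⟩
    · simp only [Finset.mem_product, Finset.mem_Icc]
      have hP' : (1:ℤ) ≤ P := by exact_mod_cast hP
      have hY : (0:ℤ) ≤ Y := by positivity
      refine ⟨⟨h1, h2⟩, h3', ?_, ?_⟩
      · by_contra hlt
        push Not at hlt
        have : (P:ℤ) * k ≤ P * (-(Y:ℤ) - 1) := mul_le_mul_of_nonneg_left (by omega) (by omega)
        have h5 : 0 ≤ (t.val:ℤ) * n := mul_nonneg hv0 (by omega)
        nlinarith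
      · by_contra hlt
        push Not at hlt
        have : (P:ℤ) * (2 * Y + 1) ≤ P * k := mul_le_mul_of_nonneg_left (by omega) (by omega)
        have h5 : (t.val:ℤ) * n ≤ P * Y := mul_le_mul hv.le h2 (by omega) (by omega)
        nlinarith
    · have : r + k * P = t.val * n := by linarith
      simp only [this]
      rw [Int.mul_ediv_cancel _ (by omega)]
      push_cast; exact ZMod.natCast_zmod_val t
  refine (Finset.card_le_card hsub).trans (Finset.card_image_le.trans ?_)
  rw [Finset.card_product, Finset.card_product, Int.card_Icc, Int.card_Icc, Int.card_Icc]
  apply le_of_eq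
  rw [mul_assoc]
  congr 1
  · omega
  · congr 1 <;> omega

lemma cat_injOn (U V : Finset (List ℕ)) (n : ℕ) (hU : ∀ a ∈ U, a.length = n) :
    Set.InjOn (fun p : List ℕ × List ℕ => p.1 ++ p.2) (↑(U ×ˢ V) : Set (List ℕ × List ℕ)) := by
  rintro ⟨a, b⟩ hp ⟨a', b'⟩ hp' e
  have h1 := (Finset.mem_product.1 (Finset.mem_coe.1 hp)).1
  have h2 := (Finset.mem_product.1 (Finset.mem_coe.1 hp')).1
  have := List.append_inj e ((hU a h1).trans (hU a' h2).symm)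
  exact Prod.ext this.1 this.2

lemma cat_eq (U V : Finset (List ℕ)) : cat U V = (U ×ˢ V).image (fun p => p.1 ++ p.2) := by
  ext l; simp only [mem_cat, Finset.mem_image, Finset.mem_product, Prod.exists]
  constructor
  · rintro ⟨a, ha, b, hb, rfl⟩; exact ⟨a, b, ⟨ha, hb⟩, rfl⟩
  · rintro ⟨a, b, ⟨ha, hb⟩, rfl⟩; exact ⟨a, ha, b, hb, rfl⟩

lemma card_cat (U V : Finset (List ℕ)) (n : ℕ) (hU : ∀ a ∈ U, a.length = n) :
    (cat U V).card = U.card * V.card := by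
  rw [cat_eq, Finset.card_image_of_injOn (cat_injOn U V n hU), Finset.card_product]

lemma sum_cat (U V : Finset (List ℕ)) (n : ℕ) (hU : ∀ a ∈ U, a.length = n) (f : List ℕ → ℂ) :
    ∑ l ∈ cat U V, f l = ∑ a ∈ U, ∑ b ∈ V, f (a ++ b) := by
  rw [cat_eq, Finset.sum_image (cat_injOn U V n hU), Finset.sum_product]

lemma sum_cat_char (P : ℕ) [NeZero P] (U V : Finset (List ℕ)) (n : ℕ) (hU : ∀ a ∈ U, a.length = n)
    (t : ZMod P) : ∑ l ∈ cat U V, ZMod.stdAddChar (t * (cD l : ZMod P)) =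
      ∑ a ∈ U, ∑ b ∈ V, ZMod.stdAddChar (t * (cC a * cB b + cD a * cD b) : ZMod P) := by
  rw [sum_cat U V n hU]
  refine Finset.sum_congr rfl fun a _ => Finset.sum_congr rfl fun b _ => ?_
  rw [cD_append]; push_cast; rfl

structure Ens (C : ℝ) (T : ℕ → ℝ) (n : ℕ) (Ξ : ℕ → Finset (List ℕ)) : Prop where
  hC : 1 ≤ C
  T0 : T 0 = 1
  mono : ∀ j < n, T j ≤ T (j + 1)
  len : ∃ len : ℕ → ℕ, ∀ i < n, 2 ≤ len i ∧ ∀ l ∈ Ξ i, Pos l ∧ l.length = len i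
  card : ∀ i < n, (T (i + 1) / T i) ^ (1.96 : ℝ) ≤ ((Ξ i).card : ℝ)
  size : ∀ j ≤ n, ∀ l ∈ seg Ξ 0 j, T j ≤ C * cD l ∧ (cD l : ℝ) ≤ T j

namespace Ens
variable {C : ℝ} {T : ℕ → ℝ} {n : ℕ} {Ξ : ℕ → Finset (List ℕ)}

lemma Tge (h : Ens C T n Ξ) : ∀ j ≤ n, 1 ≤ T j := by
  intro j
  induction j with
  | zero => intro _; rw [h.T0]
  | succ k ih => intro hk; exact (ih (by omega)).trans (h.mono k (by omega))

lemma rge (h : Ens C T n Ξ) (j : ℕ) (hj : j < n) : 1 ≤ T (j + 1) / T j := by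
  rw [le_div_iff₀ (by linarith [h.Tge j hj.le])]; linarith [h.mono j hj]

lemma blk_ne (h : Ens C T n Ξ) (i : ℕ) (hi : i < n) : (Ξ i).Nonempty := by
  rw [← Finset.card_pos]
  have h1 := h.card i hi
  have h2 : (1:ℝ) ≤ (T (i + 1) / T i) ^ (1.96 : ℝ) := Real.one_le_rpow (h.rge i hi) (by norm_num)
  have : (1:ℝ) ≤ ((Ξ i).card : ℝ) := h2.trans h1
  exact_mod_cast this

lemma seg_ne (h : Ens C T n Ξ) : ∀ k i, i + k ≤ n → (seg Ξ i k).Nonempty := by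
  intro k
  induction k with
  | zero => intro i _; exact ⟨[], by simp [seg]⟩
  | succ k ih =>
    intro i hi
    obtain ⟨a, ha⟩ := h.blk_ne i (by omega)
    obtain ⟨b, hb⟩ := ih (i + 1) (by omega)
    exact ⟨a ++ b, mem_cat.2 ⟨a, ha, b, hb, rfl⟩⟩

lemma seg_len (h : Ens C T n Ξ) : ∀ k i, i + k ≤ n → ∃ m, k ≤ m ∧ ∀ l ∈ seg Ξ i k, Pos l ∧ l.length = m := by
  intro k
  obtain ⟨len, hl⟩ := h.len
  induction k with
  | zero => intro i _; exact ⟨0, le_rfl, by simp [seg, Pos]⟩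
  | succ k ih =>
    intro i hi
    obtain ⟨m, hkm, hm⟩ := ih (i + 1) (by omega)
    have h2 := hl i (by omega)
    refine ⟨len i + m, by omega, ?_⟩
    intro l hl
    obtain ⟨a, ha, b, hb, rfl⟩ := mem_cat.1 hl
    exact ⟨(h2.2 a ha).1.append (hm b hb).1, by rw [List.length_append, (h2.2 a ha).2, (hm b hb).2]⟩

lemma seg_card (h : Ens C T n Ξ) : ∀ j ≤ n, (T j) ^ (1.96 : ℝ) ≤ ((seg Ξ 0 j).card : ℝ) := by
  intro j
  induction j with
  | zero => intro _; rw [h.T0]; simp [seg]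
  | succ k ih =>
    intro hk
    obtain ⟨m, -, hm⟩ := h.seg_len k 0 (by omega)
    rw [seg_succ, card_cat _ _ m (fun a ha => (hm a ha).2)]
    push_cast
    have hT := h.Tge k (by omega)
    have h1 : T (k + 1) = T k * (T (k + 1) / T k) := by field_simp
    rw [h1, Real.mul_rpow (by linarith) (by linarith [h.rge k (by omega)])]
    exact mul_le_mul (ih (by omega)) (h.card k (by omega)) (by have := h.rge k (by omega); positivity) (by positivity)

lemma seg_size (h : Ens C T n Ξ) (i k : ℕ) (hik : i + k ≤ n) (l : List ℕ) (hl : l ∈ seg Ξ i k) :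
    T (i + k) / (2 * C * T i) ≤ cD l ∧ (cD l : ℝ) ≤ C * T (i + k) / T i := by
  obtain ⟨a, ha⟩ := h.seg_ne i 0 (by omega)
  obtain ⟨m, -, hm⟩ := h.seg_len i 0 (by omega)
  obtain ⟨m', -, hm'⟩ := h.seg_len k i hik
  have hal : a ++ l ∈ seg Ξ 0 (i + k) := by
    rw [seg_add, Nat.zero_add]; exact mem_cat.2 ⟨a, ha, l, hl, rfl⟩
  have h1 := h.size _ hik _ hal
  have h2 := h.size i (by omega) a ha
  have h3 := cD_mul_le a l (hm a ha).1 (hm' l hl).1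
  have h3a : (cD a : ℝ) * cD l ≤ cD (a ++ l) := by exact_mod_cast h3.1
  have h3b : (cD (a ++ l) : ℝ) ≤ 2 * (cD a * cD l) := by exact_mod_cast h3.2
  have hT := h.Tge i (by omega)
  have hC := h.hC
  have hl0 : (1:ℝ) ≤ cD l := by exact_mod_cast (wpos l (hm' l hl).1).2.2.2.1
  constructor
  · rw [div_le_iff₀ (by positivity)]
    have : (cD a : ℝ) * cD l ≤ T i * cD l := by gcongr; exact h2.2
    nlinarith
  · rw [le_div_iff₀ (by positivity)]
    have : T i * (cD l : ℝ) ≤ C * cD a * cD l := by gcongr; exact h2.1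
    have : C * ((cD a : ℝ) * cD l) ≤ C * T (i + k) := by gcongr; linarith
    nlinarith

end Ens

lemma params (N : ℕ) (τ C : ℝ) (hτ : 1 ≤ τ) (hC : 1 ≤ C) (hN : 6 * τ ≤ N) :
    ∃ (M W : ℤ) (H w0 : ℕ), 1 ≤ w0 ∧ 1 ≤ M ∧ 0 ≤ W ∧ 1 ≤ H ∧ 6 * (H:ℤ) * M ≤ (N + 1 : ℕ) ∧
      (∀ x : ℤ, (x:ℝ) ≤ τ → x ≤ M) ∧ (∀ x : ℤ, N / τ / (2 * C) ≤ x → (w0:ℤ) ≤ x) ∧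
      (∀ x : ℤ, (x:ℝ) ≤ C * (N / τ) → x ≤ W) ∧ (H:ℝ) ≤ N / τ ∧ (W:ℝ) ≤ C * (N / τ) ∧
      N / τ / (2 * C) ≤ w0 ∧ ((H / w0 : ℕ):ℝ) ≤ 2 * C ∧ ((2 * H / w0 : ℕ):ℝ) ≤ 4 * C ∧
      ((N + 1 : ℕ):ℝ) ^ 2 / (H:ℝ) ^ 2 ≤ 144 * τ ^ 2 := by
  obtain ⟨m, hm⟩ : ∃ m : ℕ, m = ⌊τ⌋₊ := ⟨_, rfl⟩
  have hτ0 : 0 < τ := by linarith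
  have hm1 : 1 ≤ m := by rw [hm]; exact Nat.le_floor (by simpa using hτ)
  have hm2 : (m:ℝ) ≤ τ := by rw [hm]; exact Nat.floor_le hτ0.le
  have hm3 : τ < m + 1 := by rw [hm]; exact Nat.lt_floor_add_one τ
  have hm1' : (1:ℝ) ≤ m := by exact_mod_cast hm1
  have hν : (6:ℝ) ≤ N / τ := by rw [le_div_iff₀ hτ0]; exact hN
  obtain ⟨H, hH⟩ : ∃ H : ℕ, H = (N + 1) / (6 * m) := ⟨_, rfl⟩
  have hHm : 6 * m * H ≤ N + 1 := by rw [hH]; exact Nat.mul_div_le _ _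
  have hHm2 : N + 1 < 6 * m * (H + 1) := by
    have := Nat.lt_mul_div_succ (N + 1) (b := 6 * m) (by omega)
    rw [hH]; exact this
  have h6 : 6 * m ≤ N + 1 := by
    have : (6 * m : ℝ) ≤ N := by linarith
    have : 6 * m ≤ N := by exact_mod_cast this
    omega
  have hH1 : 1 ≤ H := by rw [hH]; exact (Nat.one_le_div_iff (by omega)).2 h6
  have hH1' : (1:ℝ) ≤ H := by exact_mod_cast hH1
  have hHmR : 6 * (m:ℝ) * H ≤ N + 1 := by exact_mod_cast hHm
  have hHmR2 : (N:ℝ) + 1 < 6 * m * (H + 1) := by exact_mod_cast hHm2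
  have hHν : (H:ℝ) ≤ N / τ := by
    rw [le_div_iff₀ hτ0]
    have : τ * H ≤ 2 * m * H := by gcongr; linarith
    nlinarith
  have hw : N / τ / (2 * C) ≤ (⌈N / τ / (2 * C)⌉₊ : ℝ) := Nat.le_ceil _
  have hwpos : (0:ℝ) < N / τ / (2 * C) := by positivity
  have hdiv : (N / τ / (2 * C)) * (2 * C) = N / τ := by field_simp
  refine ⟨m, ⌊C * (N / τ)⌋, H, ⌈N / τ / (2 * C)⌉₊, Nat.ceil_pos.2 hwpos, by exact_mod_cast hm1,
    Int.floor_nonneg.2 (by positivity), hH1, ?_, ?_, ?_, ?_, hHν, Int.floor_le _, hw, ?_, ?_, ?_⟩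
  · push_cast; have : (6 * m * H : ℤ) ≤ N + 1 := by exact_mod_cast hHm
    linarith
  · intro x hx
    have : (x:ℝ) < m + 1 := by linarith
    have : x < m + 1 := by exact_mod_cast this
    omega
  · intro x hx
    have h0 : (0:ℝ) < x := by linarith
    have h0' : 0 < x := by exact_mod_cast h0
    lift x to ℕ using h0'.le
    exact_mod_cast Nat.ceil_le.2 (by exact_mod_cast hx)
  · intro x hx; exact Int.le_floor.2 hx
  · refine Nat.cast_div_le.trans ?_
    rw [div_le_iff₀ (by linarith)]
    nlinarith
  · refine Nat.cast_div_le.trans ?_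
    rw [div_le_iff₀ (by linarith)]
    push_cast
    nlinarith
  · rw [div_le_iff₀ (by positivity)]
    push_cast
    have : (N:ℝ) + 1 ≤ 12 * τ * H := by nlinarith
    calc ((N:ℝ) + 1) ^ 2 ≤ (12 * τ * H) ^ 2 := by gcongr
      _ = _ := by ring

lemma finB (P H u q x v CB X1 C r τ t ρ : ℝ) (hu : 0 < u) (hx : 0 < x) (hv : 0 ≤ v) (hq : 0 ≤ q) (hX0 : 0 ≤ X1)
    (hCB : 1 ≤ CB) (hC : 1 ≤ C) (hP : P ^ 2 / H ^ 2 ≤ 144 * τ ^ 2) (hq4 : q ≤ 4 * C)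
    (hτ : τ ^ 2 ≤ t * u) (hX : X1 ≤ C ^ 2 * (ρ * x)) :
    16 * P ^ 2 / H ^ 2 * u * ((2 * q + 1) * (x * v * v * (CB * X1))) ≤
      16 * 144 * (8 * C + 1) * CB * C ^ 2 * (t * ρ) * (u * (x * v)) ^ 2 := by
  have h1 : P ^ 2 / H ^ 2 ≤ 144 * (t * u) := by linarith
  have h0 : 0 ≤ P ^ 2 / H ^ 2 := by positivity
  have h2 : (P ^ 2 / H ^ 2) * ((2 * q + 1) * X1) ≤ 144 * (t * u) * ((2 * (4 * C) + 1) * (C ^ 2 * (ρ * x))) := by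
    apply mul_le_mul h1 _ (by positivity) (h0.trans h1)
    apply mul_le_mul (by linarith) hX hX0 (by linarith)
  have h3 : 0 ≤ 16 * u * (x * v * v) * CB := by positivity
  have := mul_le_mul_of_nonneg_left h2 h3
  calc _ = 16 * u * (x * v * v) * CB * ((P ^ 2 / H ^ 2) * ((2 * q + 1) * X1)) := by ring
    _ ≤ _ := this
    _ = _ := by ring

lemma cellA (C : ℝ) (T : ℕ → ℝ) (j : ℕ) (Ξ : ℕ → Finset (List ℕ)) (h : Ens C T (j + 1) Ξ)
    (N : ℕ) (hTN : T (j + 1) = N) (Y : ℤ) (hr : 6 ≤ T (j + 1) / T j)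
    (hY : 2 * C ^ 2 * (T (j + 1) / T j) ^ 2 ≤ Y) (hYN : Y ≤ N) (hT2 : T j ^ 2 ≤ (N:ℝ) ^ (1.96 : ℝ))
    (Z : Finset (ZMod (N + 1))) (hZ : ∀ t ∈ Z, ¬ Maj (N + 1) Y t) :
    ∑ t ∈ Z, ‖∑ l ∈ seg Ξ 0 (j + 1), ZMod.stdAddChar (t * (cD l : ZMod (N + 1)))‖ ^ 2 ≤
      16 * 144 * (4 * C + 1) * ((seg Ξ 0 (j + 1)).card : ℝ) ^ 2 := by
  have hT := h.Tge j (by omega)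
  have hC := h.hC
  have hN6 : 6 * T j ≤ N := by rw [← hTN]; rwa [le_div_iff₀ (by linarith)] at hr
  obtain ⟨M, W, H, w0, hw0, hM, hW, hH, hHM, hxM, hxw, hxW, hHν, hWν, hwν, hHw, hHw2, hPH⟩ :=
    params N (T j) C hT hC hN6
  obtain ⟨nu, -, hU⟩ := h.seg_len j 0 (by omega)
  obtain ⟨nv, -, hV⟩ := h.seg_len 1 j (by omega)
  have hΩ : seg Ξ 0 (j + 1) = cat (seg Ξ 0 j) (seg Ξ j 1) := by rw [seg_add, Nat.zero_add]
  rw [hTN] at hY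
  have hW0 : (0:ℝ) ≤ W := by exact_mod_cast hW
  have hν0 : (0:ℝ) ≤ N / T j := by positivity
  have hHW : (H:ℝ) * W ≤ (N / T j) * (C * (N / T j)) := mul_le_mul hHν hWν hW0 hν0
  have hCC : C ≤ C ^ 2 := by nlinarith
  have e2 : 2 * (H:ℤ) * W ≤ Y := by
    have : 2 * (H:ℝ) * W ≤ Y := by
      have : C * (N / T j) ^ 2 ≤ C ^ 2 * (N / T j) ^ 2 := by gcongr
      nlinarith
    exact_mod_cast this
  have e1 : W ^ 2 ≤ Y := by
    have : (W:ℝ) ^ 2 ≤ Y := by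
      have : (W:ℝ) ^ 2 ≤ (C * (N / T j)) ^ 2 := by gcongr
      have : 0 ≤ C ^ 2 * (N / T j) ^ 2 := by positivity
      nlinarith
    exact_mod_cast this
  have key := regimeA (N + 1) (seg Ξ 0 j) (seg Ξ j 1) nu nv hU hV M W Y H w0 hw0 hM hH (by exact_mod_cast hHM)
    (fun a ha => hxM _ (h.size j (by omega) a ha).2) (fun b hb => by
      have := h.seg_size j 1 le_rfl b hb
      rw [hTN] at this
      refine ⟨hxw _ (le_trans (le_of_eq ?_) this.1), hxW _ (this.2.trans (le_of_eq ?_))⟩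
      · field_simp
      · field_simp) e1 e2 (by push_cast; linarith) Z hZ
  rw [hΩ, card_cat _ _ nu (fun a ha => (hU a ha).2)]
  simp_rw [sum_cat_char (N + 1) _ _ nu (fun a ha => (hU a ha).2)]
  refine key.trans ?_
  have hcard := h.seg_card (j + 1) le_rfl
  rw [hTN, hΩ, card_cat _ _ nu (fun a ha => (hU a ha).2)] at hcard
  have h5 : T j ^ 2 ≤ ((seg Ξ 0 j).card * (seg Ξ j 1).card : ℝ) := by
    push_cast at hcard; linarith
  push_cast
  push_cast at hPH hHw
  have u0 : (0:ℝ) ≤ (seg Ξ 0 j).card := by positivity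
  have v0 : (0:ℝ) ≤ (seg Ξ j 1).card := by positivity
  set u : ℝ := ((seg Ξ 0 j).card : ℝ)
  set v : ℝ := ((seg Ξ j 1).card : ℝ)
  calc 16 * ((N:ℝ) + 1) ^ 2 / (H:ℝ) ^ 2 * u * (v * (2 * ((H / w0 : ℕ):ℝ) + 1))
      = 16 * (((N:ℝ) + 1) ^ 2 / (H:ℝ) ^ 2) * u * (v * (2 * ((H / w0 : ℕ):ℝ) + 1)) := by ring
    _ ≤ 16 * (144 * T j ^ 2) * u * (v * (2 * (2 * C) + 1)) := by gcongr
    _ = 16 * 144 * (4 * C + 1) * (u * v) * T j ^ 2 := by ring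
    _ ≤ 16 * 144 * (4 * C + 1) * (u * v) * (u * v) := by gcongr
    _ = _ := by ring

lemma cellB (C : ℝ) (hC1 : 1 ≤ C) : ∃ K : ℝ, 1 ≤ K ∧ ∀ (T : ℕ → ℝ) (n : ℕ) (Ξ : ℕ → Finset (List ℕ)), Ens C T n Ξ →
    ∀ (N : ℕ), T n = N → ∀ j, j < n → 6 ≤ T (j + 1) / T j → ∀ Y Y' : ℤ,
    3 * C * (Y:ℝ) ^ 2 ≤ T j → 192 * C ^ 6 * (T (j + 1) / T j) ^ 4 ≤ Y' →
    ∀ (Z : Finset (ZMod (N + 1))), (∀ t ∈ Z, Maj (N + 1) Y t ∧ ¬ Maj (N + 1) Y' t) →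
    ∑ t ∈ Z, ‖∑ l ∈ seg Ξ 0 n, ZMod.stdAddChar (t * (cD l : ZMod (N + 1)))‖ ^ 2 ≤
      K * (T j ^ (0.04 : ℝ) * (T (j + 1) / T j) ^ (-0.86 : ℝ)) * ((seg Ξ 0 n).card : ℝ) ^ 2 := by
  obtain ⟨CB, hCB, hB⟩ := regimeB
  refine ⟨16 * 144 * (8 * C + 1) * CB * C ^ 2, ?_, ?_⟩
  · have : 1 ≤ CB * C ^ 2 := one_le_mul_of_one_le_of_one_le hCB (one_le_pow₀ hC1)
    nlinarith
  intro T n Ξ h N hTN j hjn hr Y Y' hY hY' Z hZ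
  have hT := h.Tge j (by omega)
  have hT' := h.Tge (j + 1) (by omega)
  have hTm : T (j + 1) ≤ N := by
    rw [← hTN]
    have : ∀ k, j + 1 + k ≤ n → T (j + 1) ≤ T (j + 1 + k) := by
      intro k
      induction k with
      | zero => intro _; exact le_rfl
      | succ k ih => intro hk; exact (ih (by omega)).trans (h.mono _ (by omega))
    have h1 := this (n - (j + 1)) (by omega)
    rwa [show j + 1 + (n - (j + 1)) = n by omega] at h1
  have hC := h.hC
  have hT0 : 0 < T j := by linarith
  have hN6 : 6 * T j ≤ N := by
    rw [le_div_iff₀ hT0] at hr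
    linarith
  obtain ⟨M, W, H, w0, hw0, hM, hW, hH, hHM, hxM, hxw, hxW, hHν, hWν, hwν, hHw, hHw2, hPH⟩ :=
    params N (T j) C hT hC hN6
  obtain ⟨len, hlen⟩ := h.len
  obtain ⟨nu, -, hU⟩ := h.seg_len j 0 (by omega)
  obtain ⟨nv, -, hV⟩ := h.seg_len (n - j - 1) (j + 1) (by omega)
  have hcatV : seg Ξ j (n - j) = cat (Ξ j) (seg Ξ (j + 1) (n - j - 1)) := by
    obtain ⟨k, hk⟩ : ∃ k, n - j = k + 1 := ⟨n - j - 1, by omega⟩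
    rw [hk, Nat.add_sub_cancel]; rfl
  have hΩ : seg Ξ 0 n = cat (seg Ξ 0 j) (cat (Ξ j) (seg Ξ (j + 1) (n - j - 1))) := by
    rw [← hcatV]
    have := seg_add Ξ 0 j (n - j)
    rwa [show j + (n - j) = n by omega, Nat.zero_add] at this
  set V4 := seg Ξ (j + 1) (n - j - 1) with hV4
  set r := T (j + 1) / T j with hrdef
  have hr1 : 1 ≤ r := by linarith
  obtain ⟨X, hX⟩ : ∃ X : ℕ, X = ⌊C * r⌋₊ := ⟨_, rfl⟩
  have hXle : (X:ℝ) ≤ C * r := by rw [hX]; exact Nat.floor_le (by positivity)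
  have hX1 : 1 ≤ X := by rw [hX]; exact Nat.le_floor (by push_cast; nlinarith)
  obtain ⟨y0, hy0⟩ : ∃ y0 : ℤ, y0 = ⌈(N:ℝ) / (2 * C * T (j + 1))⌉ := ⟨_, rfl⟩
  have hNpos : (0:ℝ) < N := by linarith
  have hy0le : (N:ℝ) / (2 * C * T (j + 1)) ≤ y0 := by rw [hy0]; exact Int.le_ceil _
  have hy01 : 1 ≤ y0 := by rw [hy0]; exact Int.one_le_ceil_iff.2 (by positivity)
  have hW0 : (0:ℝ) ≤ W := by exact_mod_cast hW
  set ν := N / T j with hν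
  have hν0 : (0:ℝ) < ν := by positivity
  have hHW : (H:ℝ) * W ≤ ν * (C * ν) := mul_le_mul hHν hWν hW0 hν0.le
  have hsz : Y ^ 2 * (H + 2 * W) < ((N + 1 : ℕ) : ℤ) := by
    have : (Y:ℝ) ^ 2 * (H + 2 * W) ≤ N := by
      calc (Y:ℝ) ^ 2 * (H + 2 * W) ≤ Y ^ 2 * (C * ν + 2 * (C * ν)) := by
            gcongr; nlinarith
        _ = 3 * C * Y ^ 2 * ν := by ring
        _ ≤ T j * ν := by gcongr
        _ = N := by rw [hν]; field_simp
    have : Y ^ 2 * (H + 2 * W) ≤ (N:ℤ) := by exact_mod_cast this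
    push_cast; linarith
  have hs1 : 24 * (X:ℤ) ^ 4 ≤ Y' := by
    have : 24 * (X:ℝ) ^ 4 ≤ Y' := by
      calc 24 * (X:ℝ) ^ 4 ≤ 24 * (C * r) ^ 4 := by gcongr
        _ = 24 * C ^ 4 * r ^ 4 := by ring
        _ ≤ 192 * C ^ 6 * r ^ 4 := by
          gcongr
          · norm_num
          · norm_num
        _ ≤ Y' := hY'
    exact_mod_cast this
  have hs2 : 24 * (X:ℤ) ^ 3 * (2 * H * W) ≤ Y' * (y0 * w0) := by
    have : 24 * (X:ℝ) ^ 3 * (2 * H * W) ≤ Y' * (y0 * w0) := by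
      calc 24 * (X:ℝ) ^ 3 * (2 * H * W) = 48 * X ^ 3 * (H * W) := by ring
        _ ≤ 48 * (C * r) ^ 3 * (ν * (C * ν)) := by gcongr
        _ = 192 * C ^ 6 * r ^ 4 * (N / (2 * C * T (j + 1)) * (ν / (2 * C))) := by
          rw [hrdef, hν]; field_simp; ring
        _ ≤ Y' * (y0 * w0) := by
          gcongr
          · exact le_trans (by positivity) hY'
    exact_mod_cast this
  have key := hB (N + 1) (seg Ξ 0 j) (Ξ j) V4 nu (len j) nv X hX1 hU (hlen j hjn).2 (hlen j hjn).1
    (fun g hg => by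
      have hg' : g ∈ seg Ξ j 1 := mem_cat.2 ⟨g, hg, [], by simp [seg], by simp⟩
      have h1 := (h.seg_size j 1 (by omega) g hg').2
      have h0 := (wpos g ((hlen j hjn).2 g hg).1).2.2.2.1
      have h3 : (cD g : ℝ) ≤ C * r := by rw [hrdef, ← mul_div_assoc]; exact h1
      obtain ⟨d, hd⟩ : ∃ d : ℕ, cD g = d := ⟨(cD g).toNat, by omega⟩
      rw [hd] at h3 ⊢
      rw [hX]; exact_mod_cast Nat.le_floor (by exact_mod_cast h3)) hV
    M W Y Y' y0 H w0 hw0 hM hW hH (by exact_mod_cast hHM)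
    (fun a ha => hxM _ (h.size j (by omega) a ha).2) (fun b hb => by
      rw [← hcatV] at hb
      have := h.seg_size j (n - j) (by omega) b hb
      rw [show j + (n - j) = n by omega, hTN] at this
      refine ⟨hxw _ (le_trans (le_of_eq ?_) this.1), hxW _ (this.2.trans (le_of_eq ?_))⟩
      · rw [hν]; field_simp
      · rw [hν]; field_simp) hy01 (fun v hv => by
      have := (h.seg_size (j + 1) (n - j - 1) (by omega) v hv).1
      rw [show j + 1 + (n - j - 1) = n by omega, hTN] at this
      rw [hy0]; exact Int.ceil_le.2 this) hsz hs1 hs2 Z hZ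
  have hUc := h.seg_card j (by omega)
  have hΞc := h.card j hjn
  rw [hΩ]
  simp_rw [sum_cat_char (N + 1) _ _ nu (fun a ha => (hU a ha).2)]
  refine key.trans ?_
  rw [card_cat _ _ nu (fun a ha => (hU a ha).2), card_cat _ _ (len j) (fun a ha => ((hlen j hjn).2 a ha).2)]
  push_cast
  push_cast at hPH hHw2
  rw [← hrdef] at hΞc
  have v0 : (0:ℝ) ≤ V4.card := by positivity
  set u : ℝ := ((seg Ξ 0 j).card : ℝ)
  set v : ℝ := (V4.card : ℝ)
  set x : ℝ := ((Ξ j).card : ℝ)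
  have hX11 : (X:ℝ) ^ (1.1:ℝ) ≤ C ^ 2 * r ^ (1.1:ℝ) := by
    calc (X:ℝ) ^ (1.1:ℝ) ≤ (C * r) ^ (1.1:ℝ) := Real.rpow_le_rpow (by positivity) hXle (by norm_num)
      _ = C ^ (1.1:ℝ) * r ^ (1.1:ℝ) := Real.mul_rpow (by linarith) (by linarith)
      _ ≤ C ^ (2:ℝ) * r ^ (1.1:ℝ) := by
        gcongr
        norm_num
      _ = _ := by norm_num
  have hu0 : 0 < u := lt_of_lt_of_le (by positivity) hUc
  have hx0 : 0 < x := lt_of_lt_of_le (by positivity) hΞc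
  have hτu : T j ^ 2 ≤ T j ^ (0.04:ℝ) * u := by
    calc T j ^ 2 = T j ^ (0.04:ℝ) * T j ^ (1.96:ℝ) := by
          rw [← Real.rpow_add hT0]; norm_num
      _ ≤ _ := by gcongr
  have hrx : r ^ (1.1:ℝ) ≤ r ^ (-0.86:ℝ) * x := by
    calc r ^ (1.1:ℝ) = r ^ (-0.86:ℝ) * r ^ (1.96:ℝ) := by
          rw [← Real.rpow_add (by linarith)]; norm_num
      _ ≤ _ := by gcongr
  exact finB ((N:ℝ) + 1) H u _ x v CB _ C r _ _ _ hu0 hx0 v0 (by positivity) (by positivity) hCB hC hPH hHw2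
    hτu (hX11.trans (by gcongr))

lemma sum_split {α : Type} [Fintype α] (f : α → ℝ) (hf : ∀ t, 0 ≤ f t) (p q : α → Prop)
    [DecidablePred p] [DecidablePred q] :
    ∑ t ∈ Finset.univ.filter p, f t ≤ ∑ t ∈ Finset.univ.filter q, f t +
      ∑ t ∈ Finset.univ.filter (fun t => p t ∧ ¬ q t), f t := by
  simp only [Finset.sum_filter]
  rw [← Finset.sum_add_distrib]
  refine Finset.sum_le_sum fun t _ => ?_
  have := hf t
  by_cases h1 : p t <;> by_cases h2 : q t <;> simp [h1, h2, this]

lemma total (C : ℝ) (hC1 : 1 ≤ C) : ∃ K : ℝ, 1 ≤ K ∧ ∀ (T : ℕ → ℝ) (J : ℕ) (Ξ : ℕ → Finset (List ℕ)),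
    Ens C T (J + 1) Ξ → 1 ≤ J → ∀ (N : ℕ), T (J + 1) = N → ∀ Y : ℕ → ℕ,
    (∀ j, 1 ≤ j → j ≤ J → 6 ≤ T (j + 1) / T j ∧ 3 * C * (Y j : ℝ) ^ 2 ≤ T j ∧
      T j ^ (0.04 : ℝ) * (T (j + 1) / T j) ^ (-0.86 : ℝ) ≤ (1 / 2) ^ j) →
    (∀ j, 1 ≤ j → j + 1 ≤ J → 192 * C ^ 6 * (T (j + 2) / T (j + 1)) ^ 4 ≤ Y j) →
    2 * C ^ 2 * (T (J + 1) / T J) ^ 2 ≤ Y J → Y J ≤ N → T J ^ 2 ≤ (N:ℝ) ^ (1.96 : ℝ) →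
    ∑ t : ZMod (N + 1), ‖∑ l ∈ seg Ξ 0 (J + 1), ZMod.stdAddChar (t * (cD l : ZMod (N + 1)))‖ ^ 2 ≤
      ((Y 1 * (2 * Y 1 + 1) * (3 * Y 1 + 1) : ℕ) + K) * ((seg Ξ 0 (J + 1)).card : ℝ) ^ 2 := by
  classical
  obtain ⟨K, hK, hB⟩ := cellB C hC1
  refine ⟨K + 16 * 144 * (4 * C + 1), by linarith, ?_⟩
  intro T J Ξ h hJ N hTN Y h1 h2 h3 h4 h5
  set f : ZMod (N + 1) → ℝ := fun t =>
    ‖∑ l ∈ seg Ξ 0 (J + 1), ZMod.stdAddChar (t * (cD l : ZMod (N + 1)))‖ ^ 2 with hf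
  set Q : ℝ := ((seg Ξ 0 (J + 1)).card : ℝ) ^ 2 with hQ
  have hQ0 : 0 ≤ Q := by positivity
  have hf0 : ∀ t, 0 ≤ f t := fun t => by positivity
  have hfQ : ∀ t, f t ≤ Q := by
    intro t
    simp only [hf, hQ]
    gcongr
    refine (norm_sum_le _ _).trans ?_
    simp
  have hind : ∀ j, 1 ≤ j → j ≤ J → ∑ t ∈ Finset.univ.filter (fun t => Maj (N + 1) (Y j) t), f t ≤
      ((Y 1 * (2 * Y 1 + 1) * (3 * Y 1 + 1) : ℕ) + K * (1 - (1 / 2) ^ j)) * Q := by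
    intro j hj
    induction j, hj using Nat.le_induction with
    | base =>
      intro _
      have hc := maj_card (N + 1) (Y 1)
      have hc' : ((Finset.univ.filter (fun t : ZMod (N + 1) => Maj (N + 1) (Y 1) t)).card : ℝ) ≤
        ((Y 1 * (2 * Y 1 + 1) * (3 * Y 1 + 1) : ℕ) : ℝ) := by exact_mod_cast hc
      calc _ ≤ ∑ t ∈ Finset.univ.filter (fun t => Maj (N + 1) (Y 1) t), Q :=
            Finset.sum_le_sum fun t _ => hfQ t
        _ = (Finset.univ.filter (fun t : ZMod (N + 1) => Maj (N + 1) (Y 1) t)).card * Q := by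
            rw [Finset.sum_const, nsmul_eq_mul]
        _ ≤ ((Y 1 * (2 * Y 1 + 1) * (3 * Y 1 + 1) : ℕ) : ℝ) * Q := by gcongr
        _ ≤ _ := by gcongr; norm_num; linarith
    | succ j hj ih =>
      intro hjJ
      have hs := sum_split f hf0 (fun t => Maj (N + 1) (Y (j + 1)) t) (fun t => Maj (N + 1) (Y j) t)
      have ih' := ih (by omega)
      obtain ⟨a1, a2, a3⟩ := h1 (j + 1) (by omega) hjJ
      have hb := hB T (J + 1) Ξ h N hTN (j + 1) (by omega) a1 (Y (j + 1)) (Y j) (by exact_mod_cast a2)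
        (by exact_mod_cast h2 j hj hjJ) (Finset.univ.filter (fun t => Maj (N + 1) (Y (j + 1)) t ∧ ¬ Maj (N + 1) (Y j) t))
        (fun t ht => (Finset.mem_filter.1 ht).2)
      have hb' : ∑ t ∈ Finset.univ.filter (fun t => Maj (N + 1) (Y (j + 1)) t ∧ ¬ Maj (N + 1) (Y j) t), f t ≤
          K * (1 / 2) ^ (j + 1) * Q := hb.trans (by gcongr)
      have e : (1 / 2 : ℝ) ^ j = 2 * (1 / 2) ^ (j + 1) := by rw [pow_succ]; ring
      rw [e] at ih'
      refine (hs.trans (add_le_add ih' hb')).trans (le_of_eq ?_)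
      ring
  have hJs := hind J hJ le_rfl
  have hA := cellA C T J Ξ h N hTN (Y J) (h1 J hJ le_rfl).1 (by exact_mod_cast h3) (by exact_mod_cast h4) h5
    (Finset.univ.filter (fun t => True ∧ ¬ Maj (N + 1) (Y J) t)) (fun t ht => (Finset.mem_filter.1 ht).2.2)
  have hs := sum_split f hf0 (fun _ => True) (fun t => Maj (N + 1) (Y J) t)
  rw [Finset.filter_true_of_mem (fun _ _ => trivial)] at hs
  have hp : (0:ℝ) ≤ (1 / 2) ^ J := by positivity
  have hKQ : 0 ≤ K * (1 / 2) ^ J * Q := by positivity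
  refine (hs.trans (add_le_add hJs hA)).trans ?_
  rw [← hQ]
  nlinarith

lemma finish (A : Set ℕ) (hA : ∀ a ∈ A, 0 < a) (C : ℝ) (T : ℕ → ℝ) (n : ℕ) (Ξ : ℕ → Finset (List ℕ))
    (h : Ens C T n Ξ) (hn : 2 ≤ n) (N : ℕ) (hTN : T n = N) (hAΞ : ∀ l ∈ seg Ξ 0 n, ∀ a ∈ l, a ∈ A) (K : ℝ)
    (hK : 0 ≤ K) (hs : ∑ t : ZMod (N + 1), ‖∑ l ∈ seg Ξ 0 n, ZMod.stdAddChar (t * (cD l : ZMod (N + 1)))‖ ^ 2 ≤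
      K * ((seg Ξ 0 n).card : ℝ) ^ 2) : (N:ℝ) ≤ K * (Dcount A N : ℝ) := by
  classical
  have h1 := dens (N + 1) (seg Ξ 0 n) (h.seg_ne n 0 (by omega)) cD K hs
  obtain ⟨m, hm, hl⟩ := h.seg_len n 0 (by omega)
  have h2 : ((seg Ξ 0 n).image (fun l => (cD l : ZMod (N + 1)))).card ≤ Dcount A N := by
    have e : (seg Ξ 0 n).image (fun l => (cD l : ZMod (N + 1))) =
        ((seg Ξ 0 n).image (fun l => (cD l).toNat)).image (fun d : ℕ => (d : ZMod (N + 1))) := by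
      rw [Finset.image_image]
      refine Finset.image_congr fun l hl' => ?_
      have := (wpos l (hl l hl').1).2.2.2.1
      obtain ⟨d, hd⟩ : ∃ d : ℕ, cD l = d := ⟨(cD l).toNat, by omega⟩
      simp [hd]
    rw [e]
    refine Finset.card_image_le.trans ?_
    unfold Dcount
    rw [← Set.ncard_coe_finset]
    refine Set.ncard_le_ncard ?_ ((Set.finite_Iic N).subset fun d hd => hd.1)
    intro d hd
    obtain ⟨l, hl', rfl⟩ := Finset.mem_image.1 (Finset.mem_coe.1 hd)
    refine ⟨?_, memD_word A hA l (hAΞ l hl') (by rw [(hl l hl').2]; omega)⟩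
    have := (h.size n le_rfl l hl').2
    rw [hTN] at this
    have : cD l ≤ N := by exact_mod_cast this
    omega
  have h3 : (((seg Ξ 0 n).image (fun l => (cD l : ZMod (N + 1)))).card : ℝ) ≤ Dcount A N := by exact_mod_cast h2
  have h4 := mul_le_mul_of_nonneg_left h3 hK
  push_cast at h1
  linarith

noncomputable def tt (L : ℝ) (J N : ℕ) : ℕ → ℝ
  | 0 => 0
  | j + 1 => if j < J then L * 1.05 ^ j else Real.log N

lemma tt_props (L : ℝ) (hL : 5000 ≤ L) (J N : ℕ) (hJ : 1 ≤ J) (h1 : L * 1.05 ^ J ≤ Real.log N)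
    (h2 : Real.log N < L * 1.05 ^ (J + 1)) :
    tt L J N 1 = L ∧ tt L J N (J + 1) = Real.log N ∧
    (∀ j, 1 ≤ j → j ≤ J → L ≤ tt L J N j ∧ L * (0.05 * (j + 2)) ≤ tt L J N j ∧
      1.05 * tt L J N j ≤ tt L J N (j + 1) ∧ tt L J N (j + 1) ≤ 1.1025 * tt L J N j) ∧
    (∀ j, 1 ≤ j → j + 1 ≤ J → tt L J N (j + 1) = 1.05 * tt L J N j) := by
  refine ⟨?_, by simp [tt], ?_, ?_⟩
  · have : 0 < J := hJ
    simp [tt, this]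
  · intro j hj hjJ
    obtain ⟨i, rfl⟩ : ∃ i, j = i + 1 := ⟨j - 1, by omega⟩
    have e : tt L J N (i + 1) = L * 1.05 ^ i := by
      have : i < J := by omega
      simp [tt, this]
    rw [e]
    have hb : (1:ℝ) + i * 0.05 ≤ 1.05 ^ i := by
      have := one_add_mul_le_pow (a := (0.05:ℝ)) (by norm_num) i
      norm_num at this ⊢; linarith
    have hL0 : 0 < L := by linarith
    have hi : (0:ℝ) ≤ i := by positivity
    have hp : (0:ℝ) < L * 1.05 ^ i := by positivity
    refine ⟨?_, ?_, ?_⟩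
    · nlinarith
    · apply mul_le_mul_of_nonneg_left _ hL0.le
      push_cast; linarith
    · by_cases hlt : i + 1 < J
      · have : tt L J N (i + 1 + 1) = L * 1.05 ^ (i + 1) := by simp [tt, hlt]
        rw [this, pow_succ]
        constructor <;> nlinarith
      · have : tt L J N (i + 1 + 1) = Real.log N := by simp [tt, hlt]
        rw [this]
        have : J = i + 1 := by omega
        subst this
        rw [pow_succ] at h1
        rw [pow_succ, pow_succ] at h2
        constructor <;> nlinarith
  · intro j hj hjJ
    obtain ⟨i, rfl⟩ : ∃ i, j = i + 1 := ⟨j - 1, by omega⟩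
    have a1 : i < J := by omega
    have a2 : i + 1 < J := by omega
    simp only [tt, a1, a2, if_true, pow_succ]; ring

lemma Ylow (C t : ℝ) (hC : 1 ≤ C) (ht : 0 ≤ t) (h : 12 * C ≤ Real.exp (0.1 * t)) :
    3 * C * (⌊Real.sqrt (Real.exp t / (3 * C))⌋₊ : ℝ) ^ 2 ≤ Real.exp t ∧
    Real.exp (0.45 * t) ≤ (⌊Real.sqrt (Real.exp t / (3 * C))⌋₊ : ℝ) := by
  set s := Real.sqrt (Real.exp t / (3 * C)) with hs
  have hs0 : 0 ≤ s := Real.sqrt_nonneg _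
  have hsq : s ^ 2 = Real.exp t / (3 * C) := Real.sq_sqrt (by positivity)
  constructor
  · have h1 : (⌊s⌋₊ : ℝ) ≤ s := Nat.floor_le hs0
    calc 3 * C * (⌊s⌋₊ : ℝ) ^ 2 ≤ 3 * C * s ^ 2 := by gcongr
      _ = _ := by rw [hsq]; field_simp
  · have h1 : s < ⌊s⌋₊ + 1 := Nat.lt_floor_add_one s
    have h2 : 1 ≤ Real.exp (0.45 * t) := Real.one_le_exp (by linarith)
    have h3 : 2 * Real.exp (0.45 * t) ≤ s := by
      apply Real.le_sqrt_of_sq_le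
      rw [le_div_iff₀ (by positivity)]
      calc (2 * Real.exp (0.45 * t)) ^ 2 * (3 * C) = 12 * C * (Real.exp (0.45 * t) * Real.exp (0.45 * t)) := by ring
        _ ≤ Real.exp (0.1 * t) * (Real.exp (0.45 * t) * Real.exp (0.45 * t)) := by gcongr
        _ = Real.exp t := by rw [← Real.exp_add, ← Real.exp_add]; congr 1; ring
    linarith

lemma seg_mem (A : Finset ℕ) (Ξ : ℕ → Finset (List ℕ)) (n : ℕ) (h : ∀ i < n, ∀ l ∈ Ξ i, ∀ a ∈ l, a ∈ A) :
    ∀ k i, i + k ≤ n → ∀ l ∈ seg Ξ i k, ∀ a ∈ l, a ∈ A := by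
  intro k
  induction k with
  | zero => intro i _ l hl; simp [seg] at hl; simp [hl]
  | succ k ih =>
    intro i hi l hl a ha
    obtain ⟨u, hu, v, hv, rfl⟩ := mem_cat.1 hl
    rcases List.mem_append.1 ha with h1 | h1
    · exact h i (by omega) u hu a h1
    · exact ih (i + 1) (by omega) v hv a h1

lemma assemble (A : Finset ℕ) (hA : ∀ a ∈ A, 0 < a) (B C : ℝ) (hB : 1 ≤ B) (hC : 1 ≤ C)
    (hens : ∀ T : ℕ → ℝ, T 0 = 1 → ∀ n : ℕ, (∀ j < n, B ^ (j + 2) * T j ≤ T (j + 1)) →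
      ∃ (Ξ : ℕ → Finset (List ℕ)) (len : ℕ → ℕ),
        (∀ i < n, 2 ≤ len i ∧ (∀ l ∈ Ξ i, (∀ a ∈ l, a ∈ A) ∧ l.length = len i) ∧
          (T (i + 1) / T i) ^ (1.96 : ℝ) ≤ (Ξ i).card) ∧
        ∀ j ≤ n, ∀ l ∈ seg Ξ 0 j, T j ≤ C * cD l ∧ cD l ≤ T j) :
    ∃ K : ℝ, 1 ≤ K ∧ ∃ N₀ : ℕ, ∀ N : ℕ, N₀ ≤ N → (N : ℝ) ≤ K * (Dcount (A : Set ℕ) N : ℝ) := by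
  obtain ⟨K, hK, htot⟩ := total C hC
  have hlB : 0 ≤ Real.log B := Real.log_nonneg hB
  have hC6 : (1:ℝ) ≤ C ^ 6 := one_le_pow₀ hC
  have hlC : 0 ≤ Real.log (192 * C ^ 6) := Real.log_nonneg (by linarith)
  obtain ⟨L, hL⟩ : ∃ L : ℝ, L = 5000 + 400 * Real.log B + 100 * Real.log (192 * C ^ 6) := ⟨_, rfl⟩
  have hL1 : 5000 ≤ L := by linarith
  have hL2 : 400 * Real.log B ≤ L := by linarith
  have hL3 : 100 * Real.log (192 * C ^ 6) ≤ L := by linarith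
  set Y1 : ℕ := ⌊Real.sqrt (Real.exp L / (3 * C))⌋₊ with hY1
  refine ⟨(Y1 * (2 * Y1 + 1) * (3 * Y1 + 1) : ℕ) + K, ?_, ⌈Real.exp (2 * L)⌉₊, ?_⟩
  · have : (0:ℝ) ≤ ((Y1 * (2 * Y1 + 1) * (3 * Y1 + 1) : ℕ) : ℝ) := by positivity
    linarith
  intro N hN
  have hN' : Real.exp (2 * L) ≤ N := Nat.ceil_le.1 hN
  have hN0 : (0:ℝ) < N := lt_of_lt_of_le (Real.exp_pos _) hN'
  have hlogN : 2 * L ≤ Real.log N := (Real.le_log_iff_exp_le hN0).2 hN'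
  have hL0 : 0 < L := by linarith
  have hx : 2 ≤ Real.log N / L := by rw [le_div_iff₀ hL0]; exact hlogN
  obtain ⟨J, hJ1, hJ2⟩ := exists_nat_pow_near (x := Real.log N / L) (y := (1.05:ℝ)) (by linarith) (by norm_num)
  have hJ : 1 ≤ J := by
    by_contra hlt
    have : J = 0 := by omega
    subst this
    norm_num at hJ2; linarith
  rw [le_div_iff₀ hL0, mul_comm] at hJ1
  rw [div_lt_iff₀ hL0, mul_comm] at hJ2
  obtain ⟨p1, p2, p3, p4⟩ := tt_props L hL1 J N hJ hJ1 hJ2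
  set t := tt L J N with htdef
  have t0 : t 0 = 0 := rfl
  set T : ℕ → ℝ := fun j => Real.exp (t j) with hT
  have hTN : T (J + 1) = N := by simp only [hT]; rw [p2, Real.exp_log hN0]
  have hBexp : ∀ k : ℕ, B ^ k = Real.exp (k * Real.log B) := by
    intro k; rw [mul_comm, Real.exp_mul, Real.exp_log (by linarith), Real.rpow_natCast]
  have hr : ∀ j, T (j + 1) / T j = Real.exp (t (j + 1) - t j) := fun j => by
    simp only [hT]; rw [Real.exp_sub]
  have hgrow : ∀ j < J + 1, B ^ (j + 2) * T j ≤ T (j + 1) := by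
    intro j hj
    simp only [hT]
    rw [hBexp, ← Real.exp_add, Real.exp_le_exp]
    rcases Nat.eq_zero_or_pos j with rfl | hjp
    · rw [t0, p1]; push_cast; linarith
    · obtain ⟨a1, a2, a3, a4⟩ := p3 j hjp (by omega)
      push_cast
      have : (j + 2 : ℝ) * Real.log B ≤ 0.05 * (L * (0.05 * (j + 2))) := by
        have : (j + 2 : ℝ) * (400 * Real.log B) ≤ (j + 2) * L := by gcongr
        linarith
      linarith
  obtain ⟨Ξ, len, e1, e2⟩ := hens T (by simp [hT, t0]) (J + 1) hgrow
  have hE : Ens C T (J + 1) Ξ := by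
    refine ⟨hC, by simp [hT, t0], ?_, ⟨len, fun i hi => ⟨(e1 i hi).1, fun l hl => ⟨fun a ha => ?_, ((e1 i hi).2.1 l hl).2⟩⟩⟩,
      fun i hi => (e1 i hi).2.2, e2⟩
    · intro j hj
      refine le_trans ?_ (hgrow j hj)
      have : 0 < T j := Real.exp_pos _
      nlinarith [one_le_pow₀ (n := j + 2) hB]
    · exact hA a (((e1 i hi).2.1 l hl).1 a ha)
  have hc : ∀ j, 1 ≤ j → j ≤ J → 192 * C ^ 6 ≤ Real.exp (0.01 * t j) := by
    intro j h1 h2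
    have := (p3 j h1 h2).1
    rw [← Real.log_le_iff_le_exp (by positivity)]
    linarith
  have hCle : C ≤ C ^ 6 := le_self_pow₀ hC (by norm_num)
  have hY : ∀ j, 1 ≤ j → j ≤ J → 3 * C * (⌊Real.sqrt (Real.exp (t j) / (3 * C))⌋₊ : ℝ) ^ 2 ≤ Real.exp (t j) ∧
    Real.exp (0.45 * t j) ≤ (⌊Real.sqrt (Real.exp (t j) / (3 * C))⌋₊ : ℝ) := by
    intro j h1 h2
    have h3 := (p3 j h1 h2).1
    refine Ylow C (t j) hC (by linarith) ?_
    have := hc j h1 h2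
    have : Real.exp (0.01 * t j) ≤ Real.exp (0.1 * t j) := Real.exp_le_exp.2 (by linarith)
    linarith
  have hfin := htot T J Ξ hE hJ N hTN (fun j => ⌊Real.sqrt (Real.exp (t j) / (3 * C))⌋₊) ?_ ?_ ?_ ?_ ?_
  · rw [p1] at hfin
    refine finish (A : Set ℕ) (fun a ha => hA a ha) C T (J + 1) Ξ hE (by omega) N hTN ?_ _ ?_ hfin
    · exact seg_mem A Ξ (J + 1) (fun i hi l hl a ha => ((e1 i hi).2.1 l hl).1 a ha) (J + 1) 0 (by omega)
    · positivity
  · intro j h1 h2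
    obtain ⟨a1, a2, a3, a4⟩ := p3 j h1 h2
    rw [hr]
    refine ⟨?_, (hY j h1 h2).1, ?_⟩
    · have := Real.add_one_le_exp (t (j + 1) - t j)
      linarith
    · simp only [hT]
      have e : (1 / 2 : ℝ) ^ j = Real.exp (-(j * Real.log 2)) := by
        rw [Real.exp_neg, mul_comm, Real.exp_mul, Real.exp_log (by norm_num), Real.rpow_natCast]; simp
      rw [e, ← Real.exp_mul, ← Real.exp_mul, ← Real.exp_add, Real.exp_le_exp]
      have hl2 := Real.log_two_lt_d9
      have hj0 : (0:ℝ) ≤ j := by positivity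
      have h5 : (j:ℝ) * Real.log 2 ≤ j * 0.7 := by gcongr; linarith
      have h6 : 5000 * (0.05 * ((j:ℝ) + 2)) ≤ L * (0.05 * (j + 2)) := by gcongr
      linarith
  · intro j h1 h2
    obtain ⟨a1, a2, a3, a4⟩ := p3 (j + 1) (by omega) h2
    have a5 := p4 j h1 h2
    refine le_trans ?_ (hY j h1 (by omega)).2
    rw [hr, ← Real.exp_nat_mul]
    refine (mul_le_mul_of_nonneg_right (hc j h1 (by omega)) (Real.exp_pos _).le).trans ?_
    rw [← Real.exp_add, Real.exp_le_exp]
    have := (p3 j h1 (by omega)).1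
    push_cast
    rw [show j + 1 + 1 = j + 2 by rfl] at a4
    rw [a5] at a4 ⊢
    linarith
  · obtain ⟨a1, a2, a3, a4⟩ := p3 J hJ le_rfl
    refine le_trans ?_ (hY J hJ le_rfl).2
    rw [hr, ← Real.exp_nat_mul]
    have h7 : 2 * C ^ 2 ≤ 192 * C ^ 6 := by
      gcongr
      · norm_num
      · norm_num
    refine (mul_le_mul_of_nonneg_right (h7.trans (hc J hJ le_rfl)) (Real.exp_pos _).le).trans ?_
    rw [← Real.exp_add, Real.exp_le_exp]
    push_cast
    linarith
  · have h8 := (hY J hJ le_rfl).1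
    obtain ⟨a1, a2, a3, a4⟩ := p3 J hJ le_rfl
    have h9 : Real.exp (t J) ≤ N := by
      rw [← hTN]; simp only [hT]; exact Real.exp_le_exp.2 (by linarith)
    set y := ⌊Real.sqrt (Real.exp (t J) / (3 * C))⌋₊
    have h10 : (y:ℝ) ≤ (y:ℝ) ^ 2 := by exact_mod_cast Nat.le_self_pow (by norm_num) y
    have h11 : (y:ℝ) ≤ N := by nlinarith [sq_nonneg (y:ℝ)]
    exact_mod_cast h11
  · obtain ⟨a1, a2, a3, a4⟩ := p3 J hJ le_rfl
    rw [← hTN]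
    simp only [hT]
    rw [← Real.exp_nat_mul, ← Real.exp_mul, Real.exp_le_exp]
    push_cast
    linarith

theorem zaremba_positive_proportion (A : Finset ℕ) (hA : ∀ a ∈ A, 0 < a)
    (hdimA : hdim (A : Set ℕ) > 1 - 5 / 312) :
    ∃ c : ℝ, 0 < c ∧ ∃ N₀ : ℕ, ∀ N : ℕ, N₀ ≤ N →
      c * (N : ℝ) ≤ (Dcount (A : Set ℕ) N : ℝ) := by
  have hR : ∀ a ∈ A, a ≤ A.sup id := fun a ha => Finset.le_sup (f := id) ha
  obtain ⟨Y0, hY0, hcount⟩ := dim_count A hA (A.sup id) hR (1 - 5 / 312) (by norm_num) hdimA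
  obtain ⟨a0, ha0⟩ : ∃ a0, a0 ∈ A := by
    have h1 := hcount Y0 le_rfl
    have h2 : (0:ℝ) < Y0 ^ (2 * (1 - 5 / 312) : ℝ) := by positivity
    have h3 : (0:ℝ) < (Vf A (A.sup id) Y0).card := by linarith
    have h4 : 0 < (Vf A (A.sup id) Y0).card := by exact_mod_cast h3
    obtain ⟨v, hv⟩ := Finset.card_pos.1 h4
    obtain ⟨g1, g2, -⟩ := (mem_Vf A hA _ _ v).1 hv
    obtain ⟨a, ha⟩ := List.exists_mem_of_ne_nil v g2
    exact ⟨a, g1 a ha⟩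
  obtain ⟨B, C, hB, hC, hens⟩ := ensemble A hA (A.sup id) hR a0 ha0 Y0 hY0 (fun Y hY =>
    (Real.rpow_le_rpow_of_exponent_le (hY0.trans hY) (by norm_num)).trans (hcount Y hY))
  obtain ⟨K, hK, N₀, h⟩ := assemble A hA B C hB hC hens
  refine ⟨K⁻¹, by positivity, N₀, fun N hN => ?_⟩
  rw [inv_mul_le_iff₀ (by linarith)]
  exact h N hN
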